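/- arXiv:2312.04120 — 12 statements merged into one kernel-verified Lean document; each statement's English description precedes it below -/
import Mathlib

section
/- Let a be a positive integer. The arithmetic progression {11184810 h + a : h = 0, 1, 2, …} is a longest quasi-non-representable infinite arithmetic progression if and only if a belongs to the set {509203, 762701, 992077, 1247173, 1254341, 1330207, 1330319, 1730653, 1730681, 1976473, 2313487, 2344211, 2554843, 3177553, 3292241, 3419789, 3423373, 3661529, 3661543, 3784439, 4384979, 4442323, 4506097, 4507889, 4626967, 5049251, 5050147, 6610811, 7117807, 7576559, 7629217, 8086751, 8101087, 8252819, 8253043, 8643209, 9053711, 9053767, 9545351, 9560713, 9666029, 10219379, 10280827, 10581097, 10609769, 10702091, 10913233, 10913681}. -/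
open Filter

/-- `U` is the set of positive odd integers that cannot be written as `p + 2^k`
with `p` prime and `k` a positive integer. -/
def U : Set ℕ :=
  {n | 0 < n ∧ Odd n ∧ ¬ ∃ (p k : ℕ), p.Prime ∧ 0 < k ∧ n = p + 2 ^ k}

/-- The infinite arithmetic progression `{m*h + a : h = 0, 1, 2, ...}`. -/
def AP (m a : ℕ) : Set ℕ := {n | ∃ h : ℕ, n = m * h + a}

/-- A set of natural numbers has asymptotic density zero. -/
def DensityZero (S : Set ℕ) : Prop :=
  Tendsto (fun N : ℕ => (Nat.card ↥(S ∩ Set.Icc 1 N) : ℝ) / N) atTop (nhds 0)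

/-- The arithmetic progression `{m*h + a : h = 0, 1, ...}` is quasi-non-representable:
`m, a` are positive and `AP m a \ U` has asymptotic density zero. -/
def QuasiNonRep (m a : ℕ) : Prop := 0 < m ∧ 0 < a ∧ DensityZero (AP m a \ U)

section

open Finset

open scoped ArithmeticFunction.Moebius

namespace BoundingSieve

/-- The divisors of the sifting product that are at most `z`. -/
def levelDivisors (s : BoundingSieve) (z : ℕ) : Finset ℕ :=
  {l ∈ s.prodPrimes.divisors | l ≤ z}

/-- The normalising sum of the Selberg weights of level `z`. -/
noncomputable def selbergSum (s : BoundingSieve) (z : ℕ) : ℝ :=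
  ∑ l ∈ s.levelDivisors z, s.selbergTerms l

/-- The optimal Selberg weights of level `z`. -/
noncomputable def selbergWeight (s : BoundingSieve) (z d : ℕ) : ℝ :=
  μ d * (s.nu d)⁻¹ * (∑ l ∈ s.levelDivisors z with d ∣ l, s.selbergTerms l) / s.selbergSum z

lemma mem_levelDivisors {s : BoundingSieve} {z l : ℕ} :
    l ∈ s.levelDivisors z ↔ l ∣ s.prodPrimes ∧ l ≤ z := by
  simp [levelDivisors, s.prodPrimes_ne_zero]

lemma sum_moebius_filter_dvd {P l m : ℕ} (hP : Squarefree P) (hm : m ∣ P) :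
    ∑ d ∈ P.divisors with l ∣ d ∧ d ∣ m, μ d = if m = l then μ l else 0 := by
  have hP0 : P ≠ 0 := hP.ne_zero
  by_cases hlm : l ∣ m
  · obtain ⟨k, rfl⟩ := hlm
    have hsq : Squarefree (l * k) := hP.squarefree_of_dvd hm
    have hl0 : l ≠ 0 := by rintro rfl; simp at hsq
    have hk0 : k ≠ 0 := by rintro rfl; simp at hsq
    have hset : {d ∈ P.divisors | l ∣ d ∧ d ∣ l * k} = k.divisors.image (l * ·) := by
      ext d
      simp only [mem_filter, Nat.mem_divisors, mem_image]
      constructor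
      · rintro ⟨-, ⟨e, rfl⟩, h⟩
        exact ⟨e, ⟨Nat.dvd_of_mul_dvd_mul_left (Nat.pos_of_ne_zero hl0) h, hk0⟩, rfl⟩
      · rintro ⟨e, ⟨he, -⟩, rfl⟩
        exact ⟨⟨(mul_dvd_mul_left l he).trans hm, hP0⟩, dvd_mul_right _ _, mul_dvd_mul_left l he⟩
    rw [hset, sum_image fun x _ y _ h => Nat.eq_of_mul_eq_mul_left (Nat.pos_of_ne_zero hl0) h]
    have hcop : ∀ e ∈ k.divisors, μ (l * e) = μ l * μ e := fun e he =>
      ArithmeticFunction.isMultiplicative_moebius.map_mul_of_coprime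
        ((Nat.coprime_of_squarefree_mul hsq).coprime_dvd_right (Nat.dvd_of_mem_divisors he))
    rw [sum_congr rfl hcop, ← mul_sum, ← ArithmeticFunction.coe_mul_zeta_apply,
      ArithmeticFunction.moebius_mul_coe_zeta, ArithmeticFunction.one_apply]
    by_cases hk : k = 1 <;> simp [hk, hl0]
  · rw [if_neg (by rintro rfl; exact hlm dvd_rfl)]
    refine sum_eq_zero fun d hd => ?_
    simp only [mem_filter] at hd
    exact absurd (hd.2.1.trans hd.2.2) hlm

variable {s : BoundingSieve} {z : ℕ}

lemma selbergSum_pos (hz : 1 ≤ z) : 0 < s.selbergSum z :=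
  sum_pos (fun _ hl => selbergTerms_pos (mem_levelDivisors.1 hl).1)
    ⟨1, mem_levelDivisors.2 ⟨one_dvd _, hz⟩⟩

lemma sum_nu_mul_selbergWeight {l : ℕ} :
    (∑ d ∈ s.prodPrimes.divisors, if l ∣ d then s.nu d * s.selbergWeight z d else 0) =
      if l ∈ s.levelDivisors z then μ l * s.selbergTerms l / s.selbergSum z else 0 := by
  have h1 : ∀ d ∈ s.prodPrimes.divisors,
      (if l ∣ d then s.nu d * s.selbergWeight z d else 0) =
      ∑ m ∈ s.levelDivisors z, if l ∣ d ∧ d ∣ m then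
        (μ d : ℝ) * (s.selbergTerms m / s.selbergSum z) else 0 := by
    intro d hd
    have hnu : s.nu d ≠ 0 := nu_ne_zero (Nat.dvd_of_mem_divisors hd)
    by_cases hl : l ∣ d
    · simp only [hl, if_true, true_and, selbergWeight]
      rw [← sum_filter, ← mul_sum, ← sum_div]
      field_simp
    · simp [hl]
  rw [sum_congr rfl h1, sum_comm]
  have h2 : ∀ m ∈ s.levelDivisors z, (∑ d ∈ s.prodPrimes.divisors, if l ∣ d ∧ d ∣ m then
        (μ d : ℝ) * (s.selbergTerms m / s.selbergSum z) else 0) =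
      if m = l then (μ l : ℝ) * s.selbergTerms l / s.selbergSum z else 0 := by
    intro m hm
    rw [← sum_filter, ← sum_mul, ← Int.cast_sum,
      sum_moebius_filter_dvd s.prodPrimes_squarefree (mem_levelDivisors.1 hm).1]
    split_ifs with h
    · subst h; ring
    · simp
  rw [sum_congr rfl h2, sum_ite_eq']

lemma mainSum_selbergWeight (hz : 1 ≤ z) :
    s.mainSum (lambdaSquared (s.selbergWeight z)) = (s.selbergSum z)⁻¹ := by
  have hG := (selbergSum_pos (s := s) hz).ne'
  rw [mainSum_lambdaSquared_eq_sum_mul_sum_sq]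
  simp_rw [sum_nu_mul_selbergWeight]
  have h1 : ∀ l ∈ s.prodPrimes.divisors, (s.selbergTerms l)⁻¹ *
      (if l ∈ s.levelDivisors z then (μ l : ℝ) * s.selbergTerms l / s.selbergSum z else 0) ^ 2 =
      if l ≤ z then s.selbergTerms l * (s.selbergSum z)⁻¹ ^ 2 else 0 := by
    intro l hl
    have hl' := Nat.dvd_of_mem_divisors hl
    have hg := (selbergTerms_pos hl').ne'
    have hmu : (μ l : ℝ) ^ 2 = 1 := by
      exact_mod_cast ArithmeticFunction.moebius_sq_eq_one_of_squarefree
        (squarefree_of_dvd_prodPrimes hl')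
    simp only [mem_levelDivisors, hl', true_and]
    split_ifs
    · rw [div_pow, mul_pow, hmu]; field_simp
    · simp
  rw [sum_congr rfl h1, ← sum_filter, ← sum_mul]
  change s.selbergSum z * _ = _
  field_simp

lemma abs_selbergWeight_le {d : ℕ} (hz : 1 ≤ z) (hd : d ∣ s.prodPrimes) :
    |s.selbergWeight z d| ≤ if d ∈ s.levelDivisors z then (s.nu d)⁻¹ else 0 := by
  have hG := selbergSum_pos (s := s) hz
  have hnu := nu_pos_of_dvd_prodPrimes hd
  split_ifs with h
  · rw [selbergWeight, abs_div, abs_of_pos hG, div_le_iff₀ hG, abs_mul, abs_mul,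
      abs_of_pos (inv_pos.2 hnu)]
    have hmu : |(μ d : ℝ)| ≤ 1 := by
      exact_mod_cast ArithmeticFunction.abs_moebius_le_one
    have hpos : ∀ l ∈ s.levelDivisors z, 0 ≤ s.selbergTerms l := fun l hl =>
      (selbergTerms_pos (mem_levelDivisors.1 hl).1).le
    have h0 : 0 ≤ ∑ l ∈ s.levelDivisors z with d ∣ l, s.selbergTerms l :=
      sum_nonneg fun l hl => hpos l (mem_of_mem_filter l hl)
    rw [abs_of_nonneg h0]
    have h1 : ∑ l ∈ s.levelDivisors z with d ∣ l, s.selbergTerms l ≤ s.selbergSum z :=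
      sum_le_sum_of_subset_of_nonneg (filter_subset _ _) fun l hl _ => hpos l hl
    calc |(μ d : ℝ)| * (s.nu d)⁻¹ * _ ≤ 1 * (s.nu d)⁻¹ * s.selbergSum z := by gcongr
      _ = _ := by ring
  · have : {l ∈ s.levelDivisors z | d ∣ l} = ∅ := by
      refine filter_eq_empty_iff.2 fun l hl hdl => h ?_
      rw [mem_levelDivisors] at hl ⊢
      exact ⟨hd, (Nat.le_of_dvd (Nat.pos_of_dvd_of_pos hl.1
        (Nat.pos_of_ne_zero s.prodPrimes_ne_zero)) hdl).trans hl.2⟩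
    simp [selbergWeight, this]

lemma errSum_lambdaSquared_le (w : ℕ → ℝ) :
    s.errSum (lambdaSquared w) ≤ ∑ d₁ ∈ s.prodPrimes.divisors, ∑ d₂ ∈ s.prodPrimes.divisors,
      |w d₁| * |w d₂| * |s.rem (d₁.lcm d₂)| := by
  have h1 : ∀ d ∈ s.prodPrimes.divisors, |lambdaSquared w d| * |s.rem d| ≤
      ∑ d₁ ∈ s.prodPrimes.divisors, ∑ d₂ ∈ s.prodPrimes.divisors,
        if d = d₁.lcm d₂ then |w d₁| * |w d₂| * |s.rem (d₁.lcm d₂)| else 0 := by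
    intro d hd
    have hsub := Nat.divisors_subset_of_dvd s.prodPrimes_ne_zero (Nat.dvd_of_mem_divisors hd)
    have habs : |lambdaSquared w d| ≤ ∑ d₁ ∈ s.prodPrimes.divisors,
        ∑ d₂ ∈ s.prodPrimes.divisors, if d = d₁.lcm d₂ then |w d₁| * |w d₂| else 0 := by
      calc |lambdaSquared w d| ≤ ∑ d₁ ∈ d.divisors, ∑ d₂ ∈ d.divisors,
            if d = d₁.lcm d₂ then |w d₁| * |w d₂| else 0 := by
            refine (abs_sum_le_sum_abs _ _).trans (sum_le_sum fun d₁ _ => ?_)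
            refine (abs_sum_le_sum_abs _ _).trans (sum_le_sum fun d₂ _ => ?_)
            split_ifs <;> simp [abs_mul]
        _ ≤ ∑ d₁ ∈ d.divisors, ∑ d₂ ∈ s.prodPrimes.divisors,
            if d = d₁.lcm d₂ then |w d₁| * |w d₂| else 0 :=
            sum_le_sum fun d₁ _ => sum_le_sum_of_subset_of_nonneg hsub
              fun _ _ _ => by positivity
        _ ≤ _ := sum_le_sum_of_subset_of_nonneg hsub
              fun _ _ _ => sum_nonneg fun _ _ => by positivity
    refine (mul_le_mul_of_nonneg_right habs (abs_nonneg _)).trans_eq ?_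
    simp_rw [sum_mul]
    refine sum_congr rfl fun d₁ _ => sum_congr rfl fun d₂ _ => ?_
    split_ifs with h
    · rw [h]
    · simp
  refine (sum_le_sum h1).trans ?_
  rw [sum_comm]
  refine sum_le_sum fun d₁ _ => ?_
  rw [sum_comm]
  refine sum_le_sum fun d₂ _ => ?_
  rw [sum_ite_eq']
  split_ifs
  · rfl
  · positivity

/-- The Selberg sieve with an error term that is crude but sufficient for small levels. -/
theorem siftedSum_le_div_selbergSum_add (hz : 1 ≤ z) :
    s.siftedSum ≤ s.totalMass / s.selbergSum z + ∑ d₁ ∈ s.levelDivisors z,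
      ∑ d₂ ∈ s.levelDivisors z, (s.nu d₁)⁻¹ * (s.nu d₂)⁻¹ * |s.rem (d₁.lcm d₂)| := by
  have hw : s.selbergWeight z 1 = 1 := by
    simp [selbergWeight, s.nu_mult.map_one]
    exact div_self (selbergSum_pos hz).ne'
  refine (siftedSum_le_mainSum_errSum_of_upperMoebius _
    (upperMoebius_lambdaSquared _ hw)).trans ?_
  rw [mainSum_selbergWeight hz, ← div_eq_mul_inv]
  gcongr
  refine (errSum_lambdaSquared_le _).trans ?_
  have hS : s.levelDivisors z = {d ∈ s.prodPrimes.divisors | d ∈ s.levelDivisors z} := by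
    ext d; simp +contextual [mem_levelDivisors, s.prodPrimes_ne_zero]
  rw [hS, sum_filter]
  refine sum_le_sum fun d₁ h₁ => ?_
  have b₁ := abs_selbergWeight_le (s := s) hz (Nat.dvd_of_mem_divisors h₁)
  have n₁ := nu_pos_of_dvd_prodPrimes (Nat.dvd_of_mem_divisors h₁)
  rw [sum_filter, ite_sum_zero]
  refine sum_le_sum fun d₂ h₂ => ?_
  have b₂ := abs_selbergWeight_le (s := s) hz (Nat.dvd_of_mem_divisors h₂)
  have n₂ := nu_pos_of_dvd_prodPrimes (Nat.dvd_of_mem_divisors h₂)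
  calc _ ≤ (if d₁ ∈ s.levelDivisors z then (s.nu d₁)⁻¹ else 0) *
        (if d₂ ∈ s.levelDivisors z then (s.nu d₂)⁻¹ else 0) * |s.rem (d₁.lcm d₂)| := by
        gcongr
    _ = _ := by split_ifs <;> simp

end BoundingSieve

/-- The completely multiplicative function with prescribed values at the primes. -/
noncomputable def primeWeightHom (f : ℕ → ℝ) : ℕ →* ℝ where
  toFun n := if n = 0 then 0 else n.factorization.prod fun p k => f p ^ k
  map_one' := by simp
  map_mul' m n := by
    by_cases hm : m = 0
    · simp [hm]
    by_cases hn : n = 0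
    · simp [hn]
    simp only [mul_eq_zero, hm, hn, or_self, if_false]
    rw [Nat.factorization_mul hm hn, Finsupp.prod_add_index' (by simp) (by intros; ring)]

lemma primeWeightHom_prime (f : ℕ → ℝ) {p : ℕ} (hp : p.Prime) : primeWeightHom f p = f p := by
  simp [primeWeightHom, hp.ne_zero, hp.factorization]

lemma primeWeightHom_nonneg {f : ℕ → ℝ} (hf : ∀ p, 0 ≤ f p) (n : ℕ) :
    0 ≤ primeWeightHom f n := by
  simp only [primeWeightHom, MonoidHom.coe_mk, OneHom.coe_mk]
  split_ifs
  · rfl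
  · exact Finset.prod_nonneg fun p _ => pow_nonneg (hf p) _

namespace BoundingSieve

lemma sum_le_selbergSum {s : BoundingSieve} {z : ℕ} (hP : s.prodPrimes = primorial z)
    {c : ℕ →* ℝ} (hc : ∀ n, 0 ≤ c n) (hnu : ∀ p, p.Prime → p ≤ z → c p = s.nu p)
    (hlt : ∀ p, p.Prime → c p < 1) :
    ∑ n ∈ Icc 1 z, c n ≤ s.selbergSum z := by
  classical
  have hmaps : ∀ n ∈ Icc 1 z, (∏ p ∈ n.primeFactors, p) ∈ s.levelDivisors z := by
    intro n hn
    rw [mem_Icc] at hn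
    rw [mem_levelDivisors, hP, primorial_eq_prod_primesLE]
    refine ⟨prod_dvd_prod_of_subset _ _ _ fun p hp => ?_,
      (Nat.le_of_dvd hn.1 (Nat.prod_primeFactors_dvd n)).trans hn.2⟩
    rw [Nat.mem_primesLE]
    exact ⟨(Nat.le_of_mem_primeFactors hp).trans hn.2, Nat.prime_of_mem_primeFactors hp⟩
  rw [← sum_fiberwise_of_maps_to hmaps, selbergSum]
  refine sum_le_sum fun l hl => ?_
  rw [mem_levelDivisors] at hl
  have hlsq := squarefree_of_dvd_prodPrimes hl.1
  have hple : ∀ p ∈ l.primeFactors, p ≤ z := fun p hp =>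
    (Nat.le_of_mem_primeFactors hp).trans hl.2
  have hcl : c l = s.nu l := by
    rw [← prod_primeFactors_nu hl.1]
    conv_lhs => rw [← Nat.prod_primeFactors_of_squarefree hlsq]
    rw [map_prod]
    exact prod_congr rfl fun p hp => hnu p (Nat.prime_of_mem_primeFactors hp) (hple p hp)
  have hE := EulerProduct.summable_and_hasSum_factoredNumbers_prod_filter_prime_geometric
    (f := c) (fun {p} hp => by rw [Real.norm_of_nonneg (hc p)]; exact hlt p hp) l.primeFactors
  have hprod : (∏ p ∈ l.primeFactors with p.Prime, (1 - c p)⁻¹) =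
      ∏ p ∈ l.primeFactors, (1 - s.nu p)⁻¹ := by
    rw [filter_true_of_mem fun p hp => Nat.prime_of_mem_primeFactors hp]
    exact prod_congr rfl fun p hp => by
      rw [hnu p (Nat.prime_of_mem_primeFactors hp) (hple p hp)]
  rw [selbergTerms_apply, ← hcl, ← hprod]
  set F : Finset ℕ := {n ∈ Icc 1 z | ∏ p ∈ n.primeFactors, p = l} with hF
  have hFspec : ∀ n ∈ F, l ∣ n ∧ n / l ∈ Nat.factoredNumbers l.primeFactors := by
    intro n hn
    rw [hF, mem_filter, mem_Icc] at hn
    have hdvd : l ∣ n := hn.2 ▸ Nat.prod_primeFactors_dvd n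
    have hpf : n.primeFactors = l.primeFactors := by
      rw [← hn.2, Nat.primeFactors_prod fun p hp => Nat.prime_of_mem_primeFactors hp]
    have hn0 : n ≠ 0 := by omega
    refine ⟨hdvd, Nat.mem_factoredNumbers_of_primeFactors_subset ?_ ?_⟩
    · exact (Nat.div_pos (Nat.le_of_dvd hn.1.1 hdvd)
        (Nat.pos_of_ne_zero hlsq.ne_zero)).ne'
    · rw [← hpf]
      exact Nat.primeFactors_mono (Nat.div_dvd_of_dvd hdvd) hn0
  calc ∑ n ∈ F, c n = ∑ n ∈ F, c l * c (n / l) := by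
        refine sum_congr rfl fun n hn => ?_
        rw [← map_mul, Nat.mul_div_cancel' (hFspec n hn).1]
    _ = c l * ∑ n ∈ F, c (n / l) := (mul_sum _ _ _).symm
    _ ≤ c l * _ := by
        refine mul_le_mul_of_nonneg_left ?_ (hc l)
        have hinj : Set.InjOn (fun n => n / l) F := by
          intro a ha b hb hab
          rw [← Nat.mul_div_cancel' (hFspec a ha).1, ← Nat.mul_div_cancel' (hFspec b hb).1]
          exact congrArg (l * ·) hab
        rw [← sum_image (f := fun m => c m) (g := fun n => n / l) hinj]
        rw [← sum_attach]
        have hmem : ∀ m ∈ F.image (fun n => n / l), m ∈ Nat.factoredNumbers l.primeFactors := by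
          intro m hm
          obtain ⟨n, hn, rfl⟩ := mem_image.1 hm
          exact (hFspec n hn).2
        let e : {m // m ∈ F.image (fun n => n / l)} ↪ Nat.factoredNumbers l.primeFactors :=
          ⟨fun m => ⟨m, hmem m m.2⟩, fun a b h => Subtype.ext (congrArg (fun x => x.1) h)⟩
        rw [show ∑ m ∈ (F.image (fun n => n / l)).attach, c m =
          ∑ m ∈ (F.image (fun n => n / l)).attach.map e, c m by rw [sum_map]; rfl]
        exact sum_le_hasSum _ (fun m _ => hc m) hE.2

end BoundingSieve

lemma sum_inv_le_prod_mul_sum_coprime (Q : Finset ℕ) (hQ : ∀ p ∈ Q, p.Prime) (y : ℕ) :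
    ∑ a ∈ Icc 1 y, (a : ℝ)⁻¹ ≤
      (∏ p ∈ Q, (1 - (p : ℝ)⁻¹)⁻¹) * ∑ a ∈ Icc 1 y with ∀ p ∈ Q, ¬ p ∣ a, (a : ℝ)⁻¹ := by
  classical
  induction Q using Finset.induction_on with
  | empty => simp
  | insert p Q hpQ ih =>
    have hp : p.Prime := hQ p (mem_insert_self _ _)
    have hQ' : ∀ q ∈ Q, q.Prime := fun q hq => hQ q (mem_insert_of_mem hq)
    have hp1 : 0 < 1 - (p : ℝ)⁻¹ :=
      sub_pos.2 (inv_lt_one_of_one_lt₀ (by exact_mod_cast hp.one_lt))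
    refine (ih hQ').trans ?_
    rw [prod_insert hpQ, mul_comm (1 - (p : ℝ)⁻¹)⁻¹, mul_assoc]
    refine mul_le_mul_of_nonneg_left ?_ (prod_nonneg fun q hq => ?_)
    swap
    · exact inv_nonneg.2 (sub_nonneg.2 (inv_le_one_of_one_le₀
        (by exact_mod_cast (hQ' q hq).one_lt.le)))
    rw [inv_mul_eq_div, le_div_iff₀ hp1]
    set T := ∑ a ∈ Icc 1 y with ∀ q ∈ Q, ¬ q ∣ a, (a : ℝ)⁻¹ with hT
    have hsplit := sum_filter_add_sum_filter_not {a ∈ Icc 1 y | ∀ q ∈ Q, ¬ q ∣ a}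
      (fun a => p ∣ a) (fun a => (a : ℝ)⁻¹)
    have hmult : ∑ a ∈ {a ∈ Icc 1 y | ∀ q ∈ Q, ¬ q ∣ a} with p ∣ a, (a : ℝ)⁻¹ ≤
        (p : ℝ)⁻¹ * T := by
      rw [hT, mul_sum]
      have hsub : {a ∈ {a ∈ Icc 1 y | ∀ q ∈ Q, ¬ q ∣ a} | p ∣ a} ⊆
          ({a ∈ Icc 1 y | ∀ q ∈ Q, ¬ q ∣ a}).image (p * ·) := by
        intro a ha
        simp only [mem_filter, mem_Icc, mem_image] at ha ⊢
        obtain ⟨⟨⟨h1, h2⟩, h3⟩, b, rfl⟩ := ha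
        refine ⟨b, ⟨⟨?_, ?_⟩, fun q hq hqb => h3 q hq (hqb.mul_left p)⟩, rfl⟩
        · exact Nat.pos_of_mul_pos_left (by omega : 0 < p * b)
        · exact (Nat.le_mul_of_pos_left b hp.pos).trans h2
      refine (sum_le_sum_of_subset_of_nonneg hsub fun _ _ _ => by positivity).trans_eq ?_
      rw [sum_image fun a _ b _ h => Nat.eq_of_mul_eq_mul_left hp.pos h]
      exact sum_congr rfl fun a _ => by push_cast; rw [mul_inv]
    have hset : {a ∈ Icc 1 y | ∀ q ∈ insert p Q, ¬ q ∣ a} =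
        {a ∈ {a ∈ Icc 1 y | ∀ q ∈ Q, ¬ q ∣ a} | ¬ p ∣ a} := by
      ext a; simp only [mem_filter, mem_insert, forall_eq_or_imp]; tauto
    rw [hset]
    nlinarith [hsplit, hmult]

/-- The local weights of the sieve for the pairs `n`, `n + h`. -/
noncomputable def pairWeight (h p : ℕ) : ℝ := if p ∣ h then (p : ℝ)⁻¹ else 2 * (p : ℝ)⁻¹

lemma pairWeight_nonneg (h p : ℕ) : 0 ≤ pairWeight h p := by
  rw [pairWeight]; positivity

lemma card_divisors_coprime_le {h : ℕ} (hh : h ≠ 0) {n : ℕ} (hn : n ≠ 0) :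
    (#{a ∈ n.divisors | ∀ p ∈ h.primeFactors, ¬ p ∣ a} : ℝ) ≤
      n * primeWeightHom (pairWeight h) n := by
  induction n using induction_on_primes with
  | zero => exact absurd rfl hn
  | one =>
    simp
    exact_mod_cast card_le_one.2 (by simp +contextual)
  | prime_mul p n hp ih =>
    have hn0 : n ≠ 0 := right_ne_zero_of_mul hn
    have ih := ih hn0
    rw [map_mul, primeWeightHom_prime _ hp]
    have hp0 : (p : ℝ) ≠ 0 := by exact_mod_cast hp.ne_zero
    have hrw : ((p * n : ℕ) : ℝ) * (pairWeight h p * primeWeightHom (pairWeight h) n) =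
        (if p ∣ h then 1 else 2) * (n * primeWeightHom (pairWeight h) n) := by
      rw [pairWeight]; push_cast; split_ifs <;> field_simp
    rw [hrw]
    have hsub : {a ∈ (p * n).divisors | ∀ q ∈ h.primeFactors, ¬ q ∣ a} ⊆
        {a ∈ n.divisors | ∀ q ∈ h.primeFactors, ¬ q ∣ a} ∪
        (if p ∣ h then ∅ else
          ({a ∈ n.divisors | ∀ q ∈ h.primeFactors, ¬ q ∣ a}).image (p * ·)) := by
      intro a ha
      rw [mem_filter, Nat.mem_divisors] at ha
      obtain ⟨⟨had, -⟩, hc⟩ := ha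
      rw [mem_union]
      by_cases hpa : p ∣ a
      · right
        obtain ⟨b, rfl⟩ := hpa
        have hph : ¬ p ∣ h := fun hph =>
          hc p (Nat.mem_primeFactors.2 ⟨hp, hph, hh⟩) (dvd_mul_right _ _)
        rw [if_neg hph, mem_image]
        exact ⟨b, mem_filter.2 ⟨Nat.mem_divisors.2 ⟨Nat.dvd_of_mul_dvd_mul_left hp.pos had, hn0⟩,
          fun q hq hqb => hc q hq (hqb.mul_left p)⟩, rfl⟩
      · left
        exact mem_filter.2 ⟨Nat.mem_divisors.2
          ⟨(((Nat.Prime.coprime_iff_not_dvd hp).2 hpa).symm).dvd_of_dvd_mul_left had, hn0⟩, hc⟩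
    have hcard := (card_le_card hsub).trans (card_union_le _ _)
    have hcard' : (#{a ∈ (p * n).divisors | ∀ q ∈ h.primeFactors, ¬ q ∣ a} : ℝ) ≤
      (if p ∣ h then 1 else 2) * #{a ∈ n.divisors | ∀ q ∈ h.primeFactors, ¬ q ∣ a} := by
      split_ifs at hcard ⊢ with hph
      · simpa using hcard
      · have := hcard.trans (Nat.add_le_add_left card_image_le _)
        rw [two_mul]
        exact_mod_cast this
    refine hcard'.trans (mul_le_mul_of_nonneg_left ih (by positivity))

/-- The singular series attached to `h`, up to a constant factor. -/
noncomputable def singularFactor (h : ℕ) : ℝ := ∏ p ∈ h.primeFactors, (1 - (p : ℝ)⁻¹)⁻¹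

lemma one_le_singularFactor (h : ℕ) : 1 ≤ singularFactor h := by
  refine (prod_const_one (s := h.primeFactors) (M := ℝ)).symm.le.trans
    (prod_le_prod (fun _ _ => zero_le_one) fun p hp => ?_)
  have h1 : (1 : ℝ) < p := by exact_mod_cast (Nat.prime_of_mem_primeFactors hp).one_lt
  rw [one_le_inv₀ (sub_pos.2 (inv_lt_one_of_one_lt₀ h1))]
  simp

lemma sq_harmonic_le_singularFactor_mul {h : ℕ} (hh : h ≠ 0) (y : ℕ) :
    (∑ a ∈ Icc 1 y, (a : ℝ)⁻¹) ^ 2 ≤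
      singularFactor h * ∑ n ∈ Icc 1 (y ^ 2), primeWeightHom (pairWeight h) n := by
  classical
  have h1 := sum_inv_le_prod_mul_sum_coprime h.primeFactors
    (fun p hp => Nat.prime_of_mem_primeFactors hp) y
  have hnn : 0 ≤ ∑ a ∈ Icc 1 y, (a : ℝ)⁻¹ := sum_nonneg fun _ _ => by positivity
  set A : Finset ℕ := {a ∈ Icc 1 y | ∀ p ∈ h.primeFactors, ¬ p ∣ a} with hA
  have h2 : (∑ a ∈ A, (a : ℝ)⁻¹) * ∑ b ∈ Icc 1 y, (b : ℝ)⁻¹ ≤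
      ∑ n ∈ Icc 1 (y ^ 2), primeWeightHom (pairWeight h) n := by
    rw [sum_mul_sum, ← sum_product']
    have hmaps : ∀ x ∈ A ×ˢ Icc 1 y, x.1 * x.2 ∈ Icc 1 (y ^ 2) := by
      intro x hx
      simp only [hA, mem_product, mem_filter, mem_Icc] at hx ⊢
      refine ⟨Nat.mul_pos hx.1.1.1 hx.2.1, ?_⟩
      rw [sq]
      exact Nat.mul_le_mul hx.1.1.2 hx.2.2
    rw [← sum_fiberwise_of_maps_to hmaps]
    refine sum_le_sum fun n hn => ?_
    have hn1 : 1 ≤ n := (mem_Icc.1 hn).1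
    have hn0 : (0 : ℝ) < n := by exact_mod_cast hn1
    have : ∑ x ∈ A ×ˢ Icc 1 y with x.1 * x.2 = n, (x.1 : ℝ)⁻¹ * (x.2 : ℝ)⁻¹ =
        #{x ∈ A ×ˢ Icc 1 y | x.1 * x.2 = n} * (n : ℝ)⁻¹ := by
      rw [← nsmul_eq_mul, ← sum_const]
      refine sum_congr rfl fun x hx => ?_
      rw [← mul_inv, ← (mem_filter.1 hx).2]; push_cast; rfl
    rw [this, ← div_eq_mul_inv, div_le_iff₀ hn0, mul_comm]
    refine le_trans ?_ (card_divisors_coprime_le hh (by omega))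
    rw [Nat.cast_le]
    refine card_le_card_of_injOn (fun x => x.1) ?_ ?_
    · intro x hx
      simp only [hA, coe_filter, Set.mem_ofPred_eq, mem_product, mem_filter] at hx ⊢
      exact ⟨Nat.mem_divisors.2 ⟨⟨x.2, hx.2.symm⟩, by omega⟩, hx.1.1.2⟩
    · intro a ha b hb hab
      simp only [hA, coe_filter, Set.mem_ofPred_eq, mem_product, mem_filter, mem_Icc] at ha hb
      refine Prod.ext hab ?_
      have h3 : a.1 * a.2 = a.1 * b.2 := by
        rw [ha.2, show a.1 = b.1 from hab, hb.2]
      exact Nat.eq_of_mul_eq_mul_left ha.1.1.1.1 h3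
  calc (∑ a ∈ Icc 1 y, (a : ℝ)⁻¹) ^ 2
      ≤ (singularFactor h * ∑ a ∈ A, (a : ℝ)⁻¹) * ∑ b ∈ Icc 1 y, (b : ℝ)⁻¹ := by
        rw [sq]; exact mul_le_mul_of_nonneg_right h1 hnn
    _ = singularFactor h * ((∑ a ∈ A, (a : ℝ)⁻¹) * ∑ b ∈ Icc 1 y, (b : ℝ)⁻¹) := mul_assoc _ _ _
    _ ≤ _ := mul_le_mul_of_nonneg_left h2 (zero_le_one.trans (one_le_singularFactor h))

/-- The number of solutions of `x * (x + h) = 0` modulo `d`. -/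
def pairRootCount (h d : ℕ) : ℕ := #{x ∈ range d | d ∣ x * (x + h)}

lemma dvd_mul_add_iff_of_modEq {h d x y : ℕ} (hxy : x ≡ y [MOD d]) :
    d ∣ x * (x + h) ↔ d ∣ y * (y + h) :=
  (hxy.mul (hxy.add_right h)).dvd_iff dvd_rfl

lemma pairRootCount_mul {h m n : ℕ} (hmn : m.Coprime n) :
    pairRootCount h (m * n) = pairRootCount h m * pairRootCount h n := by
  rw [pairRootCount, pairRootCount, pairRootCount, ← card_product]
  refine card_bij (fun x _ => (x % m, x % n)) ?_ ?_ ?_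
  · intro x hx
    simp only [mem_filter, mem_range, mem_product] at hx ⊢
    have hpos : 0 < m * n := by omega
    have hm := Nat.pos_of_mul_pos_right hpos
    have hn := Nat.pos_of_mul_pos_left hpos
    exact ⟨⟨Nat.mod_lt _ hm, (dvd_mul_add_iff_of_modEq (Nat.mod_modEq x m)).2
      ((dvd_mul_right m n).trans hx.2)⟩, Nat.mod_lt _ hn,
      (dvd_mul_add_iff_of_modEq (Nat.mod_modEq x n)).2 ((dvd_mul_left n m).trans hx.2)⟩
  · intro x hx y hy hxy
    simp only [mem_filter, mem_range, Prod.mk.injEq] at hx hy hxy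
    exact ((Nat.modEq_and_modEq_iff_modEq_mul hmn).1 hxy).eq_of_lt_of_lt hx.1 hy.1
  · rintro ⟨a, b⟩ hab
    simp only [mem_filter, mem_range, mem_product] at hab
    have hm : m ≠ 0 := by omega
    have hn : n ≠ 0 := by omega
    let c := Nat.chineseRemainder hmn a b
    refine ⟨c, ?_, ?_⟩
    · rw [mem_filter, mem_range]
      exact ⟨Nat.chineseRemainder_lt_mul hmn a b hm hn, hmn.mul_dvd_of_dvd_of_dvd
        ((dvd_mul_add_iff_of_modEq c.2.1).2 hab.1.2)
        ((dvd_mul_add_iff_of_modEq c.2.2).2 hab.2.2)⟩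
    · rw [Prod.mk.injEq]
      exact ⟨Nat.mod_eq_of_modEq c.2.1 hab.1.1, Nat.mod_eq_of_modEq c.2.2 hab.2.1⟩

lemma pairRootCount_pos (h : ℕ) {d : ℕ} (hd : 0 < d) : 0 < pairRootCount h d :=
  card_pos.2 ⟨0, by simp [hd]⟩

lemma pairRootCount_le (h d : ℕ) : pairRootCount h d ≤ d :=
  (card_filter_le _ _).trans_eq (card_range d)

lemma pairRootCount_prime {h p : ℕ} (hp : p.Prime) :
    pairRootCount h p = if p ∣ h then 1 else 2 := by
  rw [pairRootCount]
  split_ifs with hph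
  · rw [card_eq_one]
    refine ⟨0, ?_⟩
    ext x
    simp only [mem_filter, mem_range, mem_singleton]
    constructor
    · rintro ⟨hx, hd⟩
      rcases (Nat.Prime.dvd_mul hp).1 hd with h1 | h1
      · exact Nat.eq_zero_of_dvd_of_lt h1 hx
      · exact Nat.eq_zero_of_dvd_of_lt ((Nat.dvd_add_left hph).1 h1) hx
    · rintro rfl
      exact ⟨hp.pos, by simp⟩
  · have hr : h % p ≠ 0 := fun h0 => hph (Nat.dvd_of_mod_eq_zero h0)
    have hlt := Nat.mod_lt h hp.pos
    rw [card_eq_two]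
    refine ⟨0, p - h % p, by omega, ?_⟩
    ext x
    simp only [mem_filter, mem_range, mem_insert, mem_singleton]
    have hadd : ∀ x, p ∣ x + h ↔ p ∣ x + h % p := fun x => by
      rw [Nat.dvd_iff_mod_eq_zero, Nat.dvd_iff_mod_eq_zero, Nat.add_mod_mod]
    constructor
    · rintro ⟨hx, hd⟩
      rcases (Nat.Prime.dvd_mul hp).1 hd with h1 | h1
      · exact Or.inl (Nat.eq_zero_of_dvd_of_lt h1 hx)
      · right
        rw [hadd] at h1
        have := Nat.eq_of_dvd_of_lt_two_mul (by omega) h1 (by omega)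
        omega
    · rintro (rfl | rfl)
      · exact ⟨hp.pos, by simp⟩
      · refine ⟨by omega, dvd_mul_of_dvd_right ?_ _⟩
        rw [hadd, Nat.sub_add_cancel hlt.le]

/-- The density of the `n` with `d ∣ n * (n + h)`. -/
noncomputable def pairDensity (h : ℕ) : ArithmeticFunction ℝ :=
  ⟨fun d => pairRootCount h d / d, by simp⟩

lemma pairDensity_apply (h d : ℕ) : pairDensity h d = pairRootCount h d / d := rfl

lemma pairDensity_isMultiplicative (h : ℕ) : (pairDensity h).IsMultiplicative := by
  refine ⟨by simp [pairDensity_apply, pairRootCount], fun {m n} hmn => ?_⟩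
  simp only [pairDensity_apply, pairRootCount_mul hmn]
  push_cast
  rw [mul_div_mul_comm]

lemma pairDensity_prime {h p : ℕ} (hp : p.Prime) : pairDensity h p = pairWeight h p := by
  rw [pairDensity_apply, pairRootCount_prime hp, pairWeight]
  split_ifs <;> simp [div_eq_mul_inv]

lemma pairWeight_lt_one {h p : ℕ} (hh : Even h) (hp : p.Prime) : pairWeight h p < 1 := by
  have hp2 := hp.two_le
  rw [pairWeight]
  split_ifs with hph
  · exact inv_lt_one_of_one_lt₀ (by exact_mod_cast hp.one_lt)
  · have hp3 : 2 < p := lt_of_le_of_ne hp2 fun h2 => hph (h2 ▸ hh.two_dvd)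
    rw [← div_eq_mul_inv, div_lt_one (by exact_mod_cast hp.pos)]
    exact_mod_cast hp3

lemma card_filter_dvd_mul_add (h d q r : ℕ) :
    #{n ∈ range (d * q + r) | d ∣ n * (n + h)} =
      q * pairRootCount h d + #{n ∈ range r | d ∣ n * (n + h)} := by
  simp only [pairRootCount, ← Nat.count_eq_card_filter_range]
  have hper : ∀ k, d ∣ (d + k) * (d + k + h) ↔ d ∣ k * (k + h) := fun k =>
    dvd_mul_add_iff_of_modEq (by simp [Nat.ModEq])
  induction q with
  | zero => simp
  | succ q ih =>
    rw [show d * (q + 1) + r = d + (d * q + r) by ring, Nat.count_add]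
    simp only [hper]
    rw [ih]
    ring

lemma abs_card_filter_dvd_sub_le (h : ℕ) {d : ℕ} (hd : 0 < d) (N : ℕ) :
    |(#{n ∈ range N | d ∣ n * (n + h)} : ℝ) - pairDensity h d * N| ≤ d := by
  have hd' : (0 : ℝ) < d := by exact_mod_cast hd
  have hN := Nat.div_add_mod N d
  have hr := Nat.mod_lt N hd
  set q := N / d
  set r := N % d
  rw [← hN, card_filter_dvd_mul_add, pairDensity_apply]
  have h1 : #{n ∈ range r | d ∣ n * (n + h)} ≤ r :=
    (card_filter_le _ _).trans_eq (card_range r)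
  have h2 : (pairRootCount h d : ℝ) / d ≤ 1 := by
    rw [div_le_one hd']; exact_mod_cast pairRootCount_le h d
  have h1' : (#{n ∈ range r | d ∣ n * (n + h)} : ℝ) ≤ r := by exact_mod_cast h1
  have hr' : (r : ℝ) < d := by exact_mod_cast hr
  have e : ((q * pairRootCount h d + #{n ∈ range r | d ∣ n * (n + h)} : ℕ) : ℝ) -
      pairRootCount h d / d * ((d * q + r : ℕ) : ℝ) =
      #{n ∈ range r | d ∣ n * (n + h)} - pairRootCount h d / d * r := by
    push_cast; field_simp; ring
  rw [e]
  have h3 : 0 ≤ (pairRootCount h d : ℝ) / d * r := by positivity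
  have h4 : (pairRootCount h d : ℝ) / d * r ≤ 1 * r := by gcongr
  rw [abs_le]
  constructor <;> linarith [Nat.cast_nonneg (α := ℝ) #{n ∈ range r | d ∣ n * (n + h)}]

lemma strictMono_mul_add (h : ℕ) : StrictMono fun n : ℕ => n * (n + h) := fun a b hab => by
  have : a + h < b + h := by omega
  exact Nat.mul_lt_mul'' hab this

/-- The sieve problem for the pairs `n`, `n + h` with `n < N`, sifted by the primes up to `z`. -/
noncomputable def pairSieve {h : ℕ} (hh : Even h) (N z : ℕ) : BoundingSieve where
  support := (range N).image fun n => n * (n + h)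
  prodPrimes := primorial z
  prodPrimes_squarefree := squarefree_primorial z
  weights := fun _ => 1
  weights_nonneg := fun _ => zero_le_one
  totalMass := N
  nu := pairDensity h
  nu_mult := pairDensity_isMultiplicative h
  nu_pos_of_prime := fun p hp _ => by
    rw [pairDensity_apply]
    exact div_pos (by exact_mod_cast pairRootCount_pos h hp.pos) (by exact_mod_cast hp.pos)
  nu_lt_one_of_prime := fun p hp _ => by
    rw [pairDensity_prime hp]; exact pairWeight_lt_one hh hp

lemma abs_rem_pairSieve_le {h : ℕ} (hh : Even h) (N z : ℕ) {d : ℕ} (hd : 0 < d) :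
    |(pairSieve hh N z).rem d| ≤ d := by
  have : (pairSieve hh N z).multSum d = #{n ∈ range N | d ∣ n * (n + h)} := by
    rw [BoundingSieve.multSum]
    simp only [pairSieve]
    rw [sum_image (strictMono_mul_add h).injective.injOn, sum_boole]
  rw [BoundingSieve.rem, this]
  exact abs_card_filter_dvd_sub_le h hd N

lemma siftedSum_pairSieve {h : ℕ} (hh : Even h) (N z : ℕ) :
    (pairSieve hh N z).siftedSum =
      #{n ∈ range N | (primorial z).Coprime (n * (n + h))} := by
  have : (pairSieve hh N z).siftedSum = ∑ d ∈ (range N).image fun n => n * (n + h),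
      if (primorial z).Coprime d then (1 : ℝ) else 0 := by
    rw [BoundingSieve.siftedSum]
    rfl
  rw [this, sum_image (strictMono_mul_add h).injective.injOn, sum_boole]

lemma card_prime_pairs_le_siftedSum {h : ℕ} (hh : Even h) (N z : ℕ) :
    (#{n ∈ range N | n.Prime ∧ (n + h).Prime} : ℝ) ≤ (pairSieve hh N z).siftedSum + (z + 1) := by
  rw [siftedSum_pairSieve]
  have hsub : {n ∈ range N | n.Prime ∧ (n + h).Prime} ⊆
      {n ∈ range N | (primorial z).Coprime (n * (n + h))} ∪ range (z + 1) := by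
    intro n hn
    simp only [mem_filter, mem_range, mem_union] at hn ⊢
    by_cases hz : n < z + 1
    · exact Or.inr hz
    · refine Or.inl ⟨hn.1, ?_⟩
      have key : ∀ q, q.Prime → z < q → (primorial z).Coprime q := fun q hq hzq => by
        rw [Nat.coprime_comm, hq.coprime_iff_not_dvd, hq.dvd_primorial_iff]
        omega
      exact Nat.Coprime.mul_right (key n hn.2.1 (by omega)) (key _ hn.2.2 (by omega))
  have := (card_le_card hsub).trans (card_union_le _ _)
  rw [card_range] at this
  exact_mod_cast this

theorem card_prime_pairs_le {h : ℕ} (hh : Even h) (h0 : h ≠ 0) (N : ℕ) {y : ℕ} (hy : 1 ≤ y) :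
    (#{n ∈ range N | n.Prime ∧ (n + h).Prime} : ℝ) ≤
      N * singularFactor h / Real.log (y + 1) ^ 2 + 3 * (y : ℝ) ^ 12 := by
  set z := y ^ 2 with hz
  have hz1 : 1 ≤ z := Nat.one_le_pow _ _ hy
  have hlog : 0 < Real.log (y + 1) := Real.log_pos (by
    have : (1 : ℝ) ≤ y := by exact_mod_cast hy
    linarith)
  set s := pairSieve hh N z with hs
  have hS := BoundingSieve.siftedSum_le_div_selbergSum_add (s := s) hz1
  have hG : Real.log (y + 1) ^ 2 ≤ singularFactor h * s.selbergSum z := by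
    have h1 : Real.log (y + 1) ≤ ∑ a ∈ Icc 1 y, (a : ℝ)⁻¹ := by
      have := log_add_one_le_harmonic y
      push_cast at this
      refine this.trans_eq ?_
      rw [harmonic_eq_sum_Icc]; push_cast; rfl
    refine (pow_le_pow_left₀ hlog.le h1 2).trans
      ((sq_harmonic_le_singularFactor_mul h0 y).trans ?_)
    refine mul_le_mul_of_nonneg_left ?_ (zero_le_one.trans (one_le_singularFactor h))
    refine BoundingSieve.sum_le_selbergSum rfl (primeWeightHom_nonneg (pairWeight_nonneg h)) ?_ ?_
    · intro p hp _
      rw [primeWeightHom_prime _ hp]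
      exact (pairDensity_prime hp).symm
    · intro p hp
      rw [primeWeightHom_prime _ hp]
      exact pairWeight_lt_one hh hp
  have hGpos := BoundingSieve.selbergSum_pos (s := s) hz1
  have hmain : s.totalMass / s.selbergSum z ≤ N * singularFactor h / Real.log (y + 1) ^ 2 := by
    change (N : ℝ) / _ ≤ _
    rw [div_le_div_iff₀ hGpos (by positivity), mul_assoc]
    exact mul_le_mul_of_nonneg_left hG (Nat.cast_nonneg N)
  have hcard : (#(s.levelDivisors z) : ℝ) ≤ z := by
    have : s.levelDivisors z ⊆ Icc 1 z := fun d hd => by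
      rw [BoundingSieve.mem_levelDivisors] at hd
      exact mem_Icc.2 ⟨Nat.pos_of_dvd_of_pos hd.1 (primorial_pos z), hd.2⟩
    have := card_le_card this
    rw [Nat.card_Icc] at this
    exact_mod_cast this
  have hpos : ∀ d ∈ s.levelDivisors z, 0 < d := fun d hd =>
    Nat.pos_of_dvd_of_pos (BoundingSieve.mem_levelDivisors.1 hd).1 (primorial_pos z)
  have hnu : ∀ d ∈ s.levelDivisors z, (s.nu d)⁻¹ ≤ z := by
    intro d hd
    have hd0 := hpos d hd
    change (pairDensity h d)⁻¹ ≤ z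
    rw [pairDensity_apply, inv_div]
    have h1 : (1 : ℝ) ≤ pairRootCount h d := by exact_mod_cast pairRootCount_pos h hd0
    have h2 : (d : ℝ) ≤ z := by exact_mod_cast (BoundingSieve.mem_levelDivisors.1 hd).2
    exact (div_le_self (Nat.cast_nonneg d) h1).trans h2
  have herr : ∑ d₁ ∈ s.levelDivisors z, ∑ d₂ ∈ s.levelDivisors z,
      (s.nu d₁)⁻¹ * (s.nu d₂)⁻¹ * |s.rem (d₁.lcm d₂)| ≤ (z : ℝ) ^ 6 := by
    have hterm : ∀ d₁ ∈ s.levelDivisors z, ∀ d₂ ∈ s.levelDivisors z,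
        (s.nu d₁)⁻¹ * (s.nu d₂)⁻¹ * |s.rem (d₁.lcm d₂)| ≤ (z : ℝ) ^ 4 := by
      intro d₁ h₁ d₂ h₂
      have hr : |s.rem (d₁.lcm d₂)| ≤ (z : ℝ) * z := by
        refine (abs_rem_pairSieve_le hh N z (Nat.lcm_pos (hpos _ h₁) (hpos _ h₂))).trans ?_
        have : d₁.lcm d₂ ≤ z * z := (Nat.le_of_dvd (Nat.mul_pos (hpos _ h₁) (hpos _ h₂))
          (Nat.lcm_dvd_mul _ _)).trans (Nat.mul_le_mul (BoundingSieve.mem_levelDivisors.1 h₁).2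
            (BoundingSieve.mem_levelDivisors.1 h₂).2)
        exact_mod_cast this
      have hn₂ : 0 ≤ (s.nu d₂)⁻¹ := inv_nonneg.2
        (BoundingSieve.nu_pos_of_dvd_prodPrimes (BoundingSieve.mem_levelDivisors.1 h₂).1).le
      calc _ ≤ (z : ℝ) * z * (z * z) := by
            gcongr
            · exact hnu _ h₁
            · exact hnu _ h₂
        _ = _ := by ring
    calc _ ≤ ∑ d₁ ∈ s.levelDivisors z, ∑ d₂ ∈ s.levelDivisors z, (z : ℝ) ^ 4 :=
          sum_le_sum fun d₁ h₁ => sum_le_sum fun d₂ h₂ => hterm d₁ h₁ d₂ h₂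
      _ = #(s.levelDivisors z) * (#(s.levelDivisors z) * (z : ℝ) ^ 4) := by
          simp [sum_const, nsmul_eq_mul]
      _ ≤ z * (z * (z : ℝ) ^ 4) := by gcongr
      _ = _ := by ring
  have hz12 : (z : ℝ) ^ 6 = (y : ℝ) ^ 12 := by rw [hz]; push_cast; ring
  have hzy : (z : ℝ) ≤ (y : ℝ) ^ 12 := by
    rw [hz]; push_cast
    exact pow_le_pow_right₀ (by exact_mod_cast hy) (by norm_num)
  have hone : (1 : ℝ) ≤ (y : ℝ) ^ 12 := one_le_pow₀ (by exact_mod_cast hy)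
  have := card_prime_pairs_le_siftedSum hh N z
  linarith

lemma card_mul_log_le {S : Finset ℕ} (hS : ∀ p ∈ S, p.Prime) {k : ℕ}
    (hk : ∀ p ∈ S, Nat.log 2 p = k) : k * #S ≤ 2 ^ (k + 2) := by
  have h1 : (2 ^ k) ^ #S ≤ ∏ p ∈ S, p := by
    refine pow_card_le_prod S _ _ fun p hp => ?_
    rw [← hk p hp]
    exact Nat.pow_log_le_self 2 (hS p hp).ne_zero
  have h2 : ∏ p ∈ S, p ≤ primorial (2 ^ (k + 1)) := by
    refine prod_le_prod_of_subset_of_one_le' (fun p hp => ?_) fun p hp _ => ?_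
    · rw [mem_filter, mem_range, ← hk p hp]
      exact ⟨(Nat.lt_pow_succ_log_self one_lt_two p).trans (Nat.lt_succ_self _), hS p hp⟩
    · exact (mem_filter.1 hp).2.one_le
  have h3 := (h1.trans h2).trans (primorial_le_four_pow _)
  rw [← pow_mul, show 4 = 2 ^ 2 by rfl, ← pow_mul, Nat.pow_le_pow_iff_right one_lt_two] at h3
  calc _ ≤ _ := h3
    _ = _ := by ring

lemma sum_inv_prime_le {S : Finset ℕ} (hS : ∀ p ∈ S, p.Prime) (K : ℕ) :
    ∑ p ∈ S, (p : ℝ)⁻¹ ≤ 4 * (harmonic K : ℝ) + #S / 2 ^ K := by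
  rw [← sum_filter_add_sum_filter_not S (fun p => Nat.log 2 p ∈ Icc 1 K)]
  have hinv : ∀ p ∈ S, (p : ℝ)⁻¹ ≤ (2 ^ Nat.log 2 p : ℝ)⁻¹ := fun p hp =>
    inv_anti₀ (by positivity) (by exact_mod_cast Nat.pow_log_le_self 2 (hS p hp).ne_zero)
  refine add_le_add ?_ ?_
  · rw [← sum_fiberwise_of_maps_to (t := Icc 1 K) (g := Nat.log 2)
      (fun p hp => (mem_filter.1 hp).2), harmonic_eq_sum_Icc, Rat.cast_sum, mul_sum]
    refine sum_le_sum fun k hk => ?_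
    set F := {p ∈ {p ∈ S | Nat.log 2 p ∈ Icc 1 K} | Nat.log 2 p = k} with hF
    have hFS : ∀ p ∈ F, p ∈ S := fun p hp => (mem_filter.1 (mem_filter.1 hp).1).1
    have hFk : ∀ p ∈ F, Nat.log 2 p = k := fun p hp => (mem_filter.1 hp).2
    have hc : (k * #F : ℝ) ≤ 2 ^ (k + 2) := by
      exact_mod_cast card_mul_log_le (fun p hp => hS p (hFS p hp)) hFk
    have hk0 : (0 : ℝ) < k := by exact_mod_cast (mem_Icc.1 hk).1
    calc ∑ p ∈ F, (p : ℝ)⁻¹ ≤ ∑ p ∈ F, (2 ^ k : ℝ)⁻¹ :=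
          sum_le_sum fun p hp => (hinv p (hFS p hp)).trans_eq (by rw [hFk p hp])
      _ = #F * (2 ^ k : ℝ)⁻¹ := by rw [sum_const, nsmul_eq_mul]
      _ ≤ (2 ^ (k + 2) / k) * (2 ^ k : ℝ)⁻¹ := by
          gcongr
          rwa [le_div_iff₀' hk0]
      _ = _ := by
          push_cast
          rw [pow_add]
          field_simp
          norm_num
  · calc _ ≤ ∑ p ∈ S with ¬ Nat.log 2 p ∈ Icc 1 K, (2 ^ K : ℝ)⁻¹ := by
          refine sum_le_sum fun p hp => ?_
          rw [mem_filter, mem_Icc] at hp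
          have h1 : 1 ≤ Nat.log 2 p := Nat.log_pos one_lt_two (hS p hp.1).two_le
          refine (hinv p hp.1).trans (inv_anti₀ (by positivity) ?_)
          exact pow_le_pow_right₀ one_le_two (by omega)
      _ = #{p ∈ S | ¬ Nat.log 2 p ∈ Icc 1 K} * (2 ^ K : ℝ)⁻¹ := by rw [sum_const, nsmul_eq_mul]
      _ ≤ _ := by
          rw [← div_eq_mul_inv]
          gcongr
          exact filter_subset _ _

lemma inv_one_sub_inv_le_exp {p : ℕ} (hp : p.Prime) :
    (1 - (p : ℝ)⁻¹)⁻¹ ≤ Real.exp (2 * (p : ℝ)⁻¹) := by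
  have h2 : (2 : ℝ) ≤ p := by exact_mod_cast hp.two_le
  refine le_trans ?_ (Real.add_one_le_exp _)
  rw [inv_le_iff_one_le_mul₀ (sub_pos.2 (inv_lt_one_of_one_lt₀ (by linarith)))]
  have h3 : (p : ℝ)⁻¹ ≤ 2⁻¹ := inv_anti₀ two_pos h2
  have h4 : 0 ≤ (p : ℝ)⁻¹ := by positivity
  nlinarith

lemma prod_inv_one_sub_inv_le {S : Finset ℕ} (hS : ∀ p ∈ S, p.Prime) {i : ℕ}
    (hc : #S ≤ 4 ^ i) :
    ∏ p ∈ S, (1 - (p : ℝ)⁻¹)⁻¹ ≤ Real.exp 10 * (2 * i + 1) ^ 8 := by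
  have h1 : ∏ p ∈ S, (1 - (p : ℝ)⁻¹)⁻¹ ≤ Real.exp (∑ p ∈ S, 2 * (p : ℝ)⁻¹) := by
    rw [Real.exp_sum]
    refine prod_le_prod (fun p hp => ?_) fun p hp => inv_one_sub_inv_le_exp (hS p hp)
    have : (1 : ℝ) < p := by exact_mod_cast (hS p hp).one_lt
    exact inv_nonneg.2 (sub_nonneg.2 (inv_lt_one_of_one_lt₀ this).le)
  refine h1.trans ?_
  rw [← mul_sum]
  have h2 := sum_inv_prime_le hS (2 * i + 1)
  have h3 := harmonic_le_one_add_log (2 * i + 1)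
  have h4 : (#S : ℝ) / 2 ^ (2 * i + 1) ≤ 1 := by
    rw [div_le_one (by positivity)]
    calc (#S : ℝ) ≤ 4 ^ i := by exact_mod_cast hc
      _ = 2 ^ (2 * i) := by rw [pow_mul]; norm_num
      _ ≤ _ := pow_le_pow_right₀ one_le_two (by omega)
  calc _ ≤ Real.exp (10 + 8 * Real.log ((2 * i + 1 : ℕ) : ℝ)) :=
        Real.exp_le_exp.2 (by linarith)
    _ = _ := by
        rw [Real.exp_add, mul_comm (8 : ℝ), Real.exp_mul, Real.exp_log (by positivity)]
        push_cast
        norm_cast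

/-- The primes dividing `2 ^ j - 1` for some `1 ≤ j ≤ y`. -/
def mersenneFactors (y : ℕ) : Finset ℕ := (Icc 1 y).biUnion fun j => (2 ^ j - 1).primeFactors

lemma prime_of_mem_mersenneFactors {y p : ℕ} (hp : p ∈ mersenneFactors y) : p.Prime := by
  obtain ⟨j, -, hj⟩ := mem_biUnion.1 hp
  exact Nat.prime_of_mem_primeFactors hj

lemma card_primeFactors_two_pow_sub_one_le {j : ℕ} (hj : 1 ≤ j) :
    #(2 ^ j - 1).primeFactors ≤ j := by
  have h1 : 1 < 2 ^ j := Nat.one_lt_two_pow (by omega)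
  have h2 : 2 ^ #(2 ^ j - 1).primeFactors ≤ ∏ p ∈ (2 ^ j - 1).primeFactors, p :=
    pow_card_le_prod _ _ _ fun p hp => (Nat.prime_of_mem_primeFactors hp).two_le
  have h3 : ∏ p ∈ (2 ^ j - 1).primeFactors, p ≤ 2 ^ j - 1 :=
    Nat.le_of_dvd (by omega) (Nat.prod_primeFactors_dvd _)
  exact (Nat.pow_le_pow_iff_right one_lt_two).1 (by omega)

lemma card_mersenneFactors_le (y : ℕ) : #(mersenneFactors y) ≤ y * y := by
  refine (card_biUnion_le_card_mul _ _ y fun j hj => ?_).trans_eq (by simp)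
  exact (card_primeFactors_two_pow_sub_one_le (mem_Icc.1 hj).1).trans (mem_Icc.1 hj).2

lemma mem_primeFactors_two_pow_sub_one {p j : ℕ} (hp : p.Prime) (hj : 1 ≤ j) :
    p ∈ (2 ^ j - 1).primeFactors ↔ orderOf (2 : ZMod p) ∣ j := by
  have h1 : 1 < 2 ^ j := Nat.one_lt_two_pow (by omega)
  rw [orderOf_dvd_iff_pow_eq_one, Nat.mem_primeFactors, ← ZMod.natCast_eq_zero_iff,
    Nat.cast_sub h1.le, sub_eq_zero]
  push_cast
  exact ⟨fun h => h.2.1, fun h => ⟨hp, h, by omega⟩⟩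

/-- The weight `∏ 1 / (p - 1)`. -/
noncomputable def invTotientWeight (T : Finset ℕ) : ℝ := ∏ p ∈ T, ((p : ℝ) - 1)⁻¹

lemma invTotientWeight_nonneg {T : Finset ℕ} (hT : ∀ p ∈ T, p.Prime) :
    0 ≤ invTotientWeight T :=
  prod_nonneg fun p hp => inv_nonneg.2 (sub_nonneg.2 (by exact_mod_cast (hT p hp).one_le))

lemma prod_inv_one_sub_inv_eq_sum {S : Finset ℕ} (hS : ∀ p ∈ S, p.Prime) :
    ∏ p ∈ S, (1 - (p : ℝ)⁻¹)⁻¹ = ∑ T ∈ S.powerset, invTotientWeight T := by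
  simp only [invTotientWeight]
  rw [← prod_one_add]
  refine prod_congr rfl fun p hp => ?_
  have : (1 : ℝ) < p := by exact_mod_cast (hS p hp).one_lt
  have h1 : (p : ℝ) - 1 ≠ 0 := by linarith
  field_simp
  ring

/-- The order of `2` modulo the product of the primes in `T`. -/
noncomputable def orderTwo (T : Finset ℕ) : ℕ := T.lcm fun p => orderOf (2 : ZMod p)

lemma subset_primeFactors_two_pow_sub_one_iff {T : Finset ℕ} (hT : ∀ p ∈ T, p.Prime) {j : ℕ}
    (hj : 1 ≤ j) : T ⊆ (2 ^ j - 1).primeFactors ↔ orderTwo T ∣ j := by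
  rw [orderTwo, Finset.lcm_dvd_iff]
  exact forall₂_congr fun p hp => mem_primeFactors_two_pow_sub_one (hT p hp) hj

lemma orderTwo_pos {T : Finset ℕ} {y : ℕ} (hT : T ⊆ mersenneFactors y) : 0 < orderTwo T := by
  rw [Nat.pos_iff_ne_zero, orderTwo, Ne, Finset.lcm_eq_zero_iff]
  rintro ⟨p, hp, h0⟩
  obtain ⟨j, hj, hpj⟩ := mem_biUnion.1 (hT hp)
  rw [mem_primeFactors_two_pow_sub_one (Nat.prime_of_mem_primeFactors hpj) (mem_Icc.1 hj).1,
    h0, zero_dvd_iff] at hpj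
  have := (mem_Icc.1 hj).1
  omega

lemma subset_mersenneFactors {T : Finset ℕ} (hT : ∀ p ∈ T, p.Prime) (h0 : 0 < orderTwo T)
    {y : ℕ} (hy : orderTwo T ≤ y) : T ⊆ mersenneFactors y := fun _ hp =>
  mem_biUnion.2 ⟨orderTwo T, mem_Icc.2 ⟨h0, hy⟩,
    (subset_primeFactors_two_pow_sub_one_iff hT h0).2 dvd_rfl hp⟩

lemma sum_singularFactor_le (L : ℕ) :
    ∑ j ∈ Icc 1 L, singularFactor (2 ^ j - 1) ≤
      2 * L * ∑ i ∈ range (Nat.clog 2 L + 1),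
        (2 ^ i : ℝ)⁻¹ * ∏ p ∈ mersenneFactors (2 ^ i), (1 - (p : ℝ)⁻¹)⁻¹ := by
  classical
  have hP : ∀ T ∈ (mersenneFactors L).powerset, ∀ p ∈ T, p.Prime := fun T hT p hp =>
    prime_of_mem_mersenneFactors (mem_powerset.1 hT hp)
  have h1 : ∀ j ∈ Icc 1 L, singularFactor (2 ^ j - 1) =
      ∑ T ∈ (mersenneFactors L).powerset, if orderTwo T ∣ j then invTotientWeight T else 0 := by
    intro j hj
    rw [singularFactor, prod_inv_one_sub_inv_eq_sum fun p hp => Nat.prime_of_mem_primeFactors hp,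
      ← sum_filter]
    refine sum_congr ?_ fun _ _ => rfl
    ext T
    have hj1 := (mem_Icc.1 hj).1
    rw [mem_filter, mem_powerset]
    constructor
    · intro h
      have hsub : T ⊆ mersenneFactors L := h.trans (subset_biUnion_of_mem
        (fun j => (2 ^ j - 1).primeFactors) hj)
      exact ⟨mem_powerset.2 hsub, (subset_primeFactors_two_pow_sub_one_iff
        (hP T (mem_powerset.2 hsub)) hj1).1 h⟩
    · rintro ⟨h, hd⟩
      exact (subset_primeFactors_two_pow_sub_one_iff (hP T h) hj1).2 hd
  rw [sum_congr rfl h1, sum_comm]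
  have h2 : ∀ T ∈ (mersenneFactors L).powerset,
      (∑ j ∈ Icc 1 L, if orderTwo T ∣ j then invTotientWeight T else 0) ≤
        if orderTwo T ≤ L then 2 * L * ((2 ^ Nat.clog 2 (orderTwo T) : ℝ)⁻¹ * invTotientWeight T)
        else 0 := by
    intro T hT
    have h0 := orderTwo_pos (mem_powerset.1 hT)
    have hw := invTotientWeight_nonneg (hP T hT)
    split_ifs with hL
    · rw [← sum_filter, sum_const, nsmul_eq_mul]
      have hc : #{j ∈ Icc 1 L | orderTwo T ∣ j} = L / orderTwo T := by
        rw [← Nat.card_multiples']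
        congr 1
        ext j
        simp only [mem_filter, mem_Icc, mem_range]
        omega
      rw [hc, ← mul_assoc]
      refine mul_le_mul_of_nonneg_right ?_ hw
      refine Nat.cast_div_le.trans ?_
      rw [mul_assoc, mul_comm (2 : ℝ), mul_assoc, div_eq_mul_inv]
      refine mul_le_mul_of_nonneg_left ?_ (Nat.cast_nonneg L)
      have h3 : 2 ^ Nat.clog 2 (orderTwo T) ≤ 2 * orderTwo T := by
        rcases Nat.lt_or_ge 1 (orderTwo T) with h | h
        · have := Nat.pow_pred_clog_lt_self one_lt_two h
          have h4 : Nat.clog 2 (orderTwo T) ≠ 0 := (Nat.clog_pos one_lt_two h).ne'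
          obtain ⟨c, hc⟩ := Nat.exists_eq_succ_of_ne_zero h4
          rw [hc] at this ⊢
          rw [pow_succ]
          simp at this
          omega
        · have : orderTwo T = 1 := by omega
          simp [this]
      have h3' : (2 ^ Nat.clog 2 (orderTwo T) : ℝ) ≤ 2 * orderTwo T := by exact_mod_cast h3
      have h0' : (0 : ℝ) < orderTwo T := by exact_mod_cast h0
      rw [← div_eq_inv_mul, le_div_iff₀ (by positivity), ← div_eq_inv_mul, div_le_iff₀ h0']
      exact h3'
    · refine (sum_eq_zero fun j hj => if_neg fun hd => hL ?_).le
      exact (Nat.le_of_dvd (mem_Icc.1 hj).1 hd).trans (mem_Icc.1 hj).2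
  refine (sum_le_sum h2).trans ?_
  rw [← sum_filter, ← mul_sum]
  refine mul_le_mul_of_nonneg_left ?_ (by positivity)
  rw [← sum_fiberwise_of_maps_to (t := range (Nat.clog 2 L + 1))
    (g := fun T => Nat.clog 2 (orderTwo T)) fun T hT => mem_range.2
      (Nat.lt_succ_of_le (Nat.clog_mono_right 2 (mem_filter.1 hT).2))]
  refine sum_le_sum fun i _ => ?_
  rw [prod_inv_one_sub_inv_eq_sum fun p hp => prime_of_mem_mersenneFactors hp, mul_sum]
  have h5 : ∀ T ∈ {T ∈ {T ∈ (mersenneFactors L).powerset | orderTwo T ≤ L} |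
      Nat.clog 2 (orderTwo T) = i},
      (2 ^ Nat.clog 2 (orderTwo T) : ℝ)⁻¹ * invTotientWeight T =
        (2 ^ i : ℝ)⁻¹ * invTotientWeight T := fun T hT => by rw [(mem_filter.1 hT).2]
  rw [sum_congr rfl h5]
  refine sum_le_sum_of_subset_of_nonneg (fun T hT => ?_) fun T hT _ => ?_
  · rw [mem_filter, mem_filter] at hT
    refine mem_powerset.2 (subset_mersenneFactors (hP T hT.1.1)
      (orderTwo_pos (mem_powerset.1 hT.1.1)) ?_)
    rw [← hT.2]
    exact Nat.le_pow_clog one_lt_two _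
  · exact mul_nonneg (by positivity) (invTotientWeight_nonneg fun p hp =>
      prime_of_mem_mersenneFactors (mem_powerset.1 hT hp))

theorem exists_sum_singularFactor_two_pow_sub_one_le :
    ∃ C : ℝ, 0 < C ∧ ∀ L : ℕ, ∑ j ∈ Icc 1 L, singularFactor (2 ^ j - 1) ≤ C * L := by
  have hs : Summable fun i : ℕ => (2 ^ i : ℝ)⁻¹ * (Real.exp 10 * (2 * i + 1) ^ 8) := by
    have h1 := (summable_nat_add_iff 1).2
      (summable_pow_mul_geometric_of_norm_lt_one 8 (r := (1 / 2 : ℝ)) (by norm_num))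
    refine Summable.of_nonneg_of_le (fun i => by positivity) (fun i => ?_)
      (h1.mul_left (512 * Real.exp 10))
    have h2 : (2 * i + 1 : ℝ) ^ 8 ≤ (2 * (i + 1)) ^ 8 := by gcongr; linarith
    calc (2 ^ i : ℝ)⁻¹ * (Real.exp 10 * (2 * i + 1) ^ 8)
        ≤ (2 ^ i : ℝ)⁻¹ * (Real.exp 10 * (2 * (i + 1)) ^ 8) := by gcongr
      _ = _ := by
        push_cast
        rw [mul_pow, pow_succ (1 / 2 : ℝ), div_pow, one_pow]
        field_simp
        norm_num
  refine ⟨2 * ∑' i : ℕ, (2 ^ i : ℝ)⁻¹ * (Real.exp 10 * (2 * i + 1) ^ 8), ?_, fun L => ?_⟩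
  · exact mul_pos two_pos (hs.tsum_pos (fun i => by positivity) 0 (by positivity))
  · refine (sum_singularFactor_le L).trans ?_
    rw [mul_assoc, mul_assoc, mul_comm (L : ℝ)]
    refine mul_le_mul_of_nonneg_left (mul_le_mul_of_nonneg_right ?_ (Nat.cast_nonneg L)) two_pos.le
    refine le_trans (sum_le_sum fun i _ => mul_le_mul_of_nonneg_left ?_ (by positivity))
      (hs.sum_le_tsum _ fun i _ => by positivity)
    refine prod_inv_one_sub_inv_le (fun p hp => prime_of_mem_mersenneFactors hp) ?_
    refine (card_mersenneFactors_le _).trans_eq ?_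
    rw [← mul_pow]
    norm_num

lemma singularFactor_two_pow_mul_le (k m : ℕ) :
    singularFactor (2 ^ k * m) ≤ 2 * singularFactor m := by
  rcases eq_or_ne m 0 with rfl | hm
  · simp [singularFactor]
  have hsub : (2 ^ k * m).primeFactors ⊆ insert 2 m.primeFactors := by
    rw [Nat.primeFactors_mul (by positivity) hm]
    intro p hp
    rcases mem_union.1 hp with h | h
    · rw [Nat.mem_primeFactors] at h
      exact mem_insert.2 (Or.inl ((Nat.prime_dvd_prime_iff_eq h.1 Nat.prime_two).1
        (h.1.dvd_of_dvd_pow h.2.1)))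
    · exact mem_insert_of_mem h
  have hone : ∀ p ∈ insert 2 m.primeFactors, 1 ≤ (1 - (p : ℝ)⁻¹)⁻¹ := by
    intro p hp
    have hp : p.Prime := by
      rcases mem_insert.1 hp with rfl | h
      · exact Nat.prime_two
      · exact Nat.prime_of_mem_primeFactors h
    have h1 : (1 : ℝ) < p := by exact_mod_cast hp.one_lt
    rw [one_le_inv₀ (sub_pos.2 (inv_lt_one_of_one_lt₀ h1))]
    simp
  have h1 : singularFactor (2 ^ k * m) ≤ ∏ p ∈ insert 2 m.primeFactors, (1 - (p : ℝ)⁻¹)⁻¹ := by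
    refine prod_le_prod_of_subset_of_one_le hsub (fun p hp => ?_) fun p hp _ => hone p hp
    exact zero_le_one.trans (hone p (hsub hp))
  refine h1.trans ?_
  by_cases h2 : 2 ∈ m.primeFactors
  · rw [insert_eq_of_mem h2]
    have := one_le_singularFactor m
    rw [← singularFactor]; linarith
  · rw [prod_insert h2, ← singularFactor]
    norm_num

open ArithmeticFunction.vonMangoldt in
lemma not_tendsto_sum_residueClass_div {q : ℕ} [NeZero q] {a : ZMod q} (ha : IsUnit a) :
    ¬ Tendsto (fun N : ℕ => (∑ n ∈ Icc 1 N, residueClass a n) / (N : ℝ)) atTop (nhds 0) := by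
  intro h
  have h1 := LSeries_tendsto_sub_mul_nhds_one_of_tendsto_sum_div_and_nonneg
    (residueClass a) h (residueClass_nonneg a)
  have hL : ∀ s : ℝ, 1 < s → (((s - 1) * ∑' n, residueClass a n / (n : ℝ) ^ s : ℝ) : ℂ) =
      (s - 1) * LSeries (fun n => (residueClass a n : ℂ)) s := by
    intro s hs
    simp only [Complex.ofReal_mul, Complex.ofReal_tsum, Complex.ofReal_div,
      Complex.ofReal_cpow (Nat.cast_nonneg _), Complex.ofReal_natCast, Complex.ofReal_sub,
      Complex.ofReal_one, LSeries]
    congr 1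
    refine tsum_congr fun n => ?_
    rw [LSeries.term]
    split_ifs with hn
    · simp only [hn, residueClass_apply_zero, Complex.ofReal_zero, zero_div]
    · rfl
  have h2 : Tendsto (fun s : ℝ => (s - 1) * ∑' n, residueClass a n / (n : ℝ) ^ s)
      (nhdsWithin 1 (Set.Ioi 1)) (nhds 0) := by
    refine tendsto_ofReal_iff.1 (h1.congr' ?_)
    filter_upwards [self_mem_nhdsWithin] with s hs using (hL s hs).symm
  obtain ⟨C, hC⟩ := LSeries_residueClass_lower_bound ha
  have h3 : Tendsto (fun s : ℝ => (q.totient : ℝ)⁻¹ - C * (s - 1))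
      (nhdsWithin 1 (Set.Ioi 1)) (nhds ((q.totient : ℝ)⁻¹)) := by
    refine tendsto_nhdsWithin_of_tendsto_nhds ?_
    have : ContinuousAt (fun s : ℝ => (q.totient : ℝ)⁻¹ - C * (s - 1)) 1 := by fun_prop
    simpa using this.tendsto
  have hq : 0 < (q.totient : ℝ)⁻¹ := inv_pos.2 (mod_cast q.totient.pos_of_neZero)
  refine hq.not_ge (le_of_tendsto_of_tendsto h3 h2 ?_)
  filter_upwards [Ioc_mem_nhdsGT (show (1 : ℝ) < 2 by norm_num)] with s hs
  have hs1 : 0 < s - 1 := sub_pos.2 hs.1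
  have h4 := mul_le_mul_of_nonneg_left (hC hs) hs1.le
  rw [mul_sub, mul_div_cancel₀ _ hs1.ne'] at h4
  linarith

/-- The primes below `N` in the residue class `a`. -/
def primesInClass {q : ℕ} (a : ZMod q) (N : ℕ) : Finset ℕ :=
  (range N).filter fun p : ℕ => p.Prime ∧ (p : ZMod q) = a

open ArithmeticFunction.vonMangoldt Chebyshev in
lemma sum_residueClass_le {q : ℕ} (a : ZMod q) {N : ℕ} (hN : 1 ≤ N) :
    ∑ n ∈ Icc 1 N, residueClass a n ≤
      #(primesInClass a N) * Real.log N + 3 * (√N * Real.log N) := by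
  classical
  have hN' : (1 : ℝ) ≤ N := by exact_mod_cast hN
  have hlog : 0 ≤ Real.log N := Real.log_nonneg hN'
  rw [← sum_filter_add_sum_filter_not (Icc 1 N) Nat.Prime]
  have h1 : ∑ n ∈ Icc 1 N with ¬ n.Prime, residueClass a n ≤ 2 * √N * Real.log N := by
    refine le_trans ?_ (psi_sub_theta_le hN')
    rw [psi_sub_theta_eq_sum_not_prime, Nat.floor_natCast]
    exact sum_le_sum fun n _ => residueClass_le a n
  have h2 : ∑ n ∈ Icc 1 N with n.Prime, residueClass a n ≤
      (#(primesInClass a N) + 1 : ℕ) * Real.log N := by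
    calc ∑ n ∈ Icc 1 N with n.Prime, residueClass a n
        = ∑ n ∈ ((Icc 1 N).filter Nat.Prime).filter (fun n : ℕ => (n : ZMod q) = a),
            Real.log n := by
          rw [eq_comm, sum_filter]
          refine sum_congr rfl fun n hn => ?_
          simp only [residueClass, Set.indicator_apply, Set.mem_ofPred_eq]
          rw [ArithmeticFunction.vonMangoldt_apply_prime (mem_filter.1 hn).2]
      _ ≤ #(((Icc 1 N).filter Nat.Prime).filter fun n : ℕ => (n : ZMod q) = a) * Real.log N := by
          rw [← nsmul_eq_mul]
          refine sum_le_card_nsmul _ _ _ fun n hn => ?_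
          have hn := mem_Icc.1 (mem_filter.1 (mem_filter.1 hn).1).1
          exact Real.log_le_log (by exact_mod_cast hn.1) (by exact_mod_cast hn.2)
      _ ≤ _ := by
          refine mul_le_mul_of_nonneg_right (Nat.cast_le.2 ?_) hlog
          refine (card_le_card fun n hn => ?_).trans (card_insert_le N _)
          simp only [primesInClass, mem_filter, mem_Icc, mem_insert, mem_range] at hn ⊢
          rcases hn.1.1.2.eq_or_lt with h | h
          · exact Or.inl h
          · exact Or.inr ⟨h, hn.1.2, hn.2⟩
  have h3 : 1 * Real.log N ≤ √N * Real.log N :=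
    mul_le_mul_of_nonneg_right (Real.one_le_sqrt.2 hN') hlog
  push_cast at h2
  linarith

lemma eventually_sqrt_mul_log_le {ε : ℝ} (hε : 0 < ε) :
    ∀ᶠ N : ℕ in atTop, √N * Real.log N ≤ ε * N := by
  have h := (isLittleO_log_rpow_atTop (r := 1 / 2) (by norm_num)).def hε
  filter_upwards [tendsto_natCast_atTop_atTop.eventually h, eventually_ge_atTop 1] with N hN h1
  rw [Real.norm_of_nonneg (Real.log_natCast_nonneg N), Real.norm_of_nonneg (by positivity),
    ← Real.sqrt_eq_rpow] at hN
  calc √N * Real.log N ≤ √N * (ε * √N) := by gcongr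
    _ = ε * (√N * √N) := by ring
    _ = _ := by rw [Real.mul_self_sqrt (Nat.cast_nonneg N)]

open ArithmeticFunction.vonMangoldt in
/-- Infinitely often, the primes in a reduced residue class have the expected order of
magnitude. -/
theorem exists_frequently_le_card_primes_residueClass {q : ℕ} [NeZero q] {a : ZMod q}
    (ha : IsUnit a) : ∃ c : ℝ, 0 < c ∧ ∃ᶠ N : ℕ in atTop,
      c * N ≤ #(primesInClass a N) * Real.log N := by
  have h := not_tendsto_sum_residueClass_div ha
  have hex : ∃ ε : ℝ, 0 < ε ∧ ∃ᶠ N : ℕ in atTop,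
      ε ≤ (∑ n ∈ Icc 1 N, residueClass a n) / (N : ℝ) := by
    by_contra! hcon
    refine h (Metric.tendsto_nhds.2 fun ε hε => ?_)
    filter_upwards [hcon ε hε] with N hN
    rw [Real.dist_0_eq_abs, abs_of_nonneg (div_nonneg
      (sum_nonneg fun n _ => residueClass_nonneg a n) (Nat.cast_nonneg N))]
    exact hN
  obtain ⟨ε, hε, hf⟩ := hex
  refine ⟨ε / 2, half_pos hε, (hf.and_eventually
    ((eventually_sqrt_mul_log_le (show 0 < ε / 6 by positivity)).and
      (eventually_ge_atTop 1))).mono ?_⟩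
  rintro N ⟨h1, h2, h3⟩
  have hN : (0 : ℝ) < N := by exact_mod_cast h3
  rw [le_div_iff₀ hN] at h1
  have := sum_residueClass_le a h3
  linarith

/-- The number of `n < N` such that `n` and `n + h` are both prime. -/
def primePairCount (N h : ℕ) : ℕ := #{n ∈ range N | n.Prime ∧ (n + h).Prime}

lemma primePairCount_mul_log_sq_le {h : ℕ} (hh : Even h) (h0 : h ≠ 0) {N : ℕ} (hN : 1 ≤ N) :
    (primePairCount N h : ℝ) * Real.log N ^ 2 ≤ 1100 * (N * singularFactor h) := by
  have hN' : (1 : ℝ) ≤ N := by exact_mod_cast hN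
  have hN0 : (0 : ℝ) < N := by linarith
  have hf := one_le_singularFactor h
  set x : ℝ := (N : ℝ) ^ (1 / 32 : ℝ) with hx
  have hx1 : 1 ≤ x := Real.one_le_rpow hN' (by norm_num)
  set y := ⌊x⌋₊ with hy
  have hy1 : 1 ≤ y := (Nat.one_le_floor_iff x).2 hx1
  have hyx : (y : ℝ) ≤ x := Nat.floor_le (by linarith)
  have hxy : x ≤ y + 1 := (Nat.lt_floor_add_one x).le
  have hlogN : 0 ≤ Real.log N := Real.log_nonneg hN'
  have hlogx : Real.log N = 32 * Real.log x := by rw [hx, Real.log_rpow hN0]; ring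
  have hlogy : Real.log x ≤ Real.log (y + 1) := Real.log_le_log (by linarith) hxy
  have hlogy0 : 0 < Real.log (y + 1) := Real.log_pos (by
    have : (1 : ℝ) ≤ y := by exact_mod_cast hy1
    linarith)
  have hmain := mul_le_mul_of_nonneg_right (card_prime_pairs_le hh h0 N hy1)
    (sq_nonneg (Real.log N))
  have h1 : Real.log N ^ 2 ≤ 1024 * Real.log (y + 1) ^ 2 := by
    calc Real.log N ^ 2 ≤ (32 * Real.log (y + 1)) ^ 2 :=
          pow_le_pow_left₀ hlogN (by rw [hlogx]; linarith) 2
      _ = _ := by ring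
  have h2 : N * singularFactor h / Real.log (y + 1) ^ 2 * Real.log N ^ 2 ≤
      1024 * (N * singularFactor h) := by
    rw [div_mul_eq_mul_div, div_le_iff₀ (by positivity)]
    calc _ ≤ N * singularFactor h * (1024 * Real.log (y + 1) ^ 2) := by gcongr
      _ = _ := by ring
  have h3 : (y : ℝ) ^ 12 ≤ (N : ℝ) ^ (3 / 8 : ℝ) := by
    calc (y : ℝ) ^ 12 ≤ x ^ 12 := by gcongr
      _ = _ := by rw [hx, ← Real.rpow_natCast, ← Real.rpow_mul hN0.le]; norm_num
  have h4 : Real.log N ^ 2 ≤ 11 * (N : ℝ) ^ (5 / 8 : ℝ) := by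
    calc Real.log N ^ 2 ≤ ((N : ℝ) ^ (5 / 16 : ℝ) / (5 / 16)) ^ 2 :=
          pow_le_pow_left₀ hlogN (Real.log_le_rpow_div hN0.le (by norm_num)) 2
      _ = (16 / 5) ^ 2 * (N : ℝ) ^ (5 / 8 : ℝ) := by
          rw [div_pow, ← Real.rpow_natCast ((N : ℝ) ^ (5 / 16 : ℝ)), ← Real.rpow_mul hN0.le]
          norm_num
          ring
      _ ≤ _ := by gcongr; norm_num
  have h5 : (y : ℝ) ^ 12 * Real.log N ^ 2 ≤ 11 * N := by
    calc _ ≤ (N : ℝ) ^ (3 / 8 : ℝ) * (11 * (N : ℝ) ^ (5 / 8 : ℝ)) := by gcongr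
      _ = 11 * ((N : ℝ) ^ (3 / 8 : ℝ) * (N : ℝ) ^ (5 / 8 : ℝ)) := by ring
      _ = _ := by rw [← Real.rpow_add hN0]; norm_num
  have h6 : (N : ℝ) ≤ N * singularFactor h := le_mul_of_one_le_right hN0.le hf
  rw [add_mul] at hmain
  rw [primePairCount]
  linarith

lemma sum_le_sum_of_injOn {s t : Finset ℕ} {g : ℕ → ℝ} (hg : ∀ n, 0 ≤ g n) {φ : ℕ → ℕ}
    (hφ : Set.InjOn φ s) (hst : ∀ x ∈ s, φ x ∈ t) : ∑ x ∈ s, g (φ x) ≤ ∑ x ∈ t, g x := by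
  rw [← sum_image hφ]
  exact sum_le_sum_of_subset_of_nonneg (fun x hx => by
    obtain ⟨z, hz, rfl⟩ := mem_image.1 hx
    exact hst z hz) fun x _ _ => hg x

lemma card_pairs_le {A : Finset ℕ} {N : ℕ} (hA : ∀ p ∈ A, p.Prime ∧ p < N) {b c : ℕ} (hbc : b < c) :
    #{x ∈ A ×ˢ A | x.1 + c = x.2 + b} ≤ primePairCount N (c - b) := by
  refine card_le_card_of_injOn Prod.fst (fun x hx => ?_) fun x hx z hz hxz => ?_
  · simp only [coe_filter, mem_product, Set.mem_ofPred_eq, mem_range] at hx ⊢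
    refine ⟨(hA _ hx.1.1).2, (hA _ hx.1.1).1, ?_⟩
    rw [show x.1 + (c - b) = x.2 by omega]
    exact (hA _ hx.1.2).1
  · simp only [coe_filter, mem_product, Set.mem_ofPred_eq] at hx hz
    exact Prod.ext hxz (by omega)

lemma addEnergy_mul_log_sq_le {C : ℝ}
    (hC : ∀ L : ℕ, ∑ j ∈ Icc 1 L, singularFactor (2 ^ j - 1) ≤ C * L)
    {A K : Finset ℕ} {N L : ℕ} (hN : 1 ≤ N) (hA : ∀ p ∈ A, p.Prime ∧ p < N) (hK : K ⊆ Icc 1 L) :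
    (addEnergy A (K.image (2 ^ ·)) : ℝ) * Real.log N ^ 2 ≤
      #A * #K * Real.log N ^ 2 + 4400 * C * N * L ^ 2 := by
  classical
  set l := Real.log N ^ 2 with hl
  have hl0 : 0 ≤ l := sq_nonneg _
  set g : ℕ → ℝ := fun j => singularFactor (2 ^ j - 1) with hg
  have hg0 : ∀ j, 0 ≤ g j := fun j => zero_le_one.trans (one_le_singularFactor _)
  set R : ℕ → ℕ → ℕ := fun b c => #{x ∈ A ×ˢ A | x.1 + b = x.2 + c} with hR
  have hinj : Function.Injective fun k : ℕ => 2 ^ k := Nat.pow_right_injective le_rfl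
  have hE : addEnergy A (K.image (2 ^ ·)) = ∑ k ∈ K, ∑ j ∈ K, R (2 ^ k) (2 ^ j) := by
    rw [addEnergy, card_filter, sum_product_right, sum_product, sum_image hinj.injOn]
    refine sum_congr rfl fun k _ => ?_
    rw [sum_image hinj.injOn]
    refine sum_congr rfl fun j _ => ?_
    simp only [hR, card_filter]
  have hoff : ∀ k j, 1 ≤ k → k < j → (primePairCount N (2 ^ j - 2 ^ k) : ℝ) * l ≤
      2200 * N * g (j - k) := by
    intro k j hk hkj
    have h1 : 2 ^ j - 2 ^ k = 2 ^ k * (2 ^ (j - k) - 1) := by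
      rw [Nat.mul_sub, ← pow_add, mul_one, Nat.add_sub_cancel' hkj.le]
    have h2 : 2 ^ k < 2 ^ j := Nat.pow_lt_pow_right one_lt_two hkj
    have h3 := primePairCount_mul_log_sq_le (h := 2 ^ j - 2 ^ k)
      (by rw [h1]; exact ((Nat.even_pow.2 ⟨even_two, by omega⟩).mul_right _)) (by omega) hN
    refine h3.trans ?_
    have h4 : singularFactor (2 ^ j - 2 ^ k) ≤ 2 * g (j - k) := by
      rw [h1]; exact singularFactor_two_pow_mul_le _ _
    calc _ ≤ 1100 * (N * (2 * g (j - k))) := by gcongr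
      _ = _ := by ring
  have hrow : ∀ k ∈ K, (∑ j ∈ K, (R (2 ^ k) (2 ^ j) : ℝ) * l) ≤
      #A * l + 4400 * N * (C * L) := by
    intro k hk
    have hk1 := mem_Icc.1 (hK hk)
    rw [← add_sum_erase K _ hk]
    refine add_le_add ?_ ?_
    · refine mul_le_mul_of_nonneg_right (Nat.cast_le.2 ?_) hl0
      refine card_le_card_of_injOn Prod.fst (fun x hx => ?_) fun x hx z hz hxz => ?_
      · simp only [coe_filter, mem_product, Set.mem_ofPred_eq] at hx
        exact hx.1.1
      · simp only [coe_filter, mem_product, Set.mem_ofPred_eq] at hx hz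
        exact Prod.ext hxz (by omega)
    · have hle : ∀ j ∈ K.erase k, (R (2 ^ k) (2 ^ j) : ℝ) * l ≤
          if j < k then 2200 * N * g (k - j) else 2200 * N * g (j - k) := by
        intro j hj
        have hjk := (mem_erase.1 hj).1
        have hj1 := mem_Icc.1 (hK (mem_erase.1 hj).2)
        split_ifs with hlt
        · refine le_trans ?_ (hoff j k hj1.1 hlt)
          exact mul_le_mul_of_nonneg_right (Nat.cast_le.2
            (card_pairs_le hA (Nat.pow_lt_pow_right one_lt_two hlt))) hl0
        · have hlt' : k < j := by omega
          refine le_trans ?_ (hoff k j hk1.1 hlt')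
          refine mul_le_mul_of_nonneg_right (Nat.cast_le.2 (le_trans ?_
            (card_pairs_le hA (Nat.pow_lt_pow_right one_lt_two hlt')))) hl0
          refine card_le_card_of_injOn Prod.swap (fun x hx => ?_) Prod.swap_injective.injOn
          simp only [coe_filter, mem_product, Set.mem_ofPred_eq, Prod.fst_swap,
            Prod.snd_swap] at hx ⊢
          exact ⟨hx.1.symm, hx.2.symm⟩
      refine (sum_le_sum hle).trans ?_
      rw [sum_ite, ← mul_sum, ← mul_sum]
      have h1 : ∑ j ∈ K.erase k with j < k, g (k - j) ≤ C * L := by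
        refine (sum_le_sum_of_injOn (t := Icc 1 L) hg0 ?_ ?_).trans (hC L)
        · intro x hx z hz hxz
          simp only [coe_filter, mem_erase, Set.mem_ofPred_eq] at hx hz hxz
          omega
        · intro x hx
          simp only [mem_filter, mem_erase] at hx
          rw [mem_Icc]; omega
      have h2 : ∑ j ∈ K.erase k with ¬ j < k, g (j - k) ≤ C * L := by
        refine (sum_le_sum_of_injOn (t := Icc 1 L) hg0 ?_ ?_).trans (hC L)
        · intro x hx z hz hxz
          simp only [coe_filter, mem_erase, Set.mem_ofPred_eq] at hx hz hxz
          omega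
        · intro x hx
          simp only [mem_filter, mem_erase] at hx
          have := mem_Icc.1 (hK hx.1.2)
          rw [mem_Icc]; omega
      calc _ ≤ 2200 * N * (C * L) + 2200 * N * (C * L) := by gcongr
        _ = _ := by ring
  have hCL : 0 ≤ C * L := (sum_nonneg fun j _ => hg0 j).trans (hC L)
  have hKL : (#K : ℝ) ≤ L := by
    have := card_le_card hK
    rw [Nat.card_Icc] at this
    exact_mod_cast this
  rw [hE]
  push_cast
  rw [sum_mul]
  simp_rw [sum_mul]
  refine (sum_le_sum hrow).trans ?_
  rw [sum_const, nsmul_eq_mul]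
  calc #K * (#A * l + 4400 * N * (C * L)) = #A * #K * l + #K * (4400 * N * (C * L)) := by ring
    _ ≤ #A * #K * l + L * (4400 * N * (C * L)) := by gcongr
    _ = _ := by ring

lemma not_densityZero_of_frequently {S : Set ℕ} {δ : ℝ} (hδ : 0 < δ)
    (h : ∃ᶠ N : ℕ in atTop, δ * N ≤ Nat.card ↥(S ∩ Set.Icc 1 N)) : ¬ DensityZero S := by
  intro hS
  have h1 : ∀ᶠ N : ℕ in atTop, (Nat.card ↥(S ∩ Set.Icc 1 N) : ℝ) / N < δ :=
    hS.eventually_lt_const hδ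
  refine h ((h1.and (eventually_ge_atTop 1)).mono ?_)
  rintro N ⟨h2, h3⟩
  have : (0 : ℝ) < N := by exact_mod_cast h3
  rw [div_lt_iff₀ this] at h2
  exact not_le.2 h2

lemma mem_AP_iff {m a n : ℕ} : n ∈ AP m a ↔ a ≤ n ∧ (n : ZMod m) = a := by
  constructor
  · rintro ⟨h, rfl⟩
    simp
  · rintro ⟨h1, h2⟩
    rw [eq_comm, ZMod.natCast_eq_natCast_iff, Nat.modEq_iff_dvd' h1] at h2
    obtain ⟨c, hc⟩ := h2
    exact ⟨c, by omega⟩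

lemma two_pow_add_mul_eq {q : ℕ} (hq : q ∣ 11184810) {k : ℕ} (hk : 1 ≤ k) (t : ℕ) :
    (2 : ZMod q) ^ (k + 24 * t) = 2 ^ k := by
  have h1 : (2 : ZMod q) ^ 25 = 2 := by
    have : ((2 ^ 25 : ℕ) : ZMod q) = (2 : ℕ) := by
      rw [eq_comm, ZMod.natCast_eq_natCast_iff, Nat.modEq_iff_dvd' (by norm_num)]
      exact hq.trans (by norm_num)
    exact_mod_cast this
  obtain ⟨j, rfl⟩ := Nat.exists_eq_add_of_le hk
  induction t with
  | zero => simp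
  | succ t ih =>
    rw [show 1 + j + 24 * (t + 1) = (j + 24 * t) + 25 by ring, pow_add, h1, ← ih]
    ring

open scoped Pointwise in
lemma card_add_le_card_AP_diff_U {q a k : ℕ} (hq : q ∣ 11184810) (hk : 1 ≤ k) (N T : ℕ)
    (hT : ∀ t < T, 2 ^ (k + 24 * t) ≤ N) :
    #(primesInClass ((a : ZMod q) - 2 ^ k) N +
      ((range T).image fun t => k + 24 * t).image (2 ^ ·)) ≤
      Nat.card ↥((AP q a \ U) ∩ Set.Icc 1 (2 * N)) + a := by
  set Y := primesInClass ((a : ZMod q) - 2 ^ k) N +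
    ((range T).image fun t => k + 24 * t).image (2 ^ ·) with hY
  have hsub : (Y : Set ℕ) ⊆ ((AP q a \ U) ∩ Set.Icc 1 (2 * N)) ∪ (range a : Finset ℕ) := by
    intro n hn
    rw [mem_coe, hY, Finset.mem_add] at hn
    obtain ⟨p, hp, b, hb, rfl⟩ := hn
    rw [mem_image] at hb
    obtain ⟨j, hj, rfl⟩ := hb
    obtain ⟨t, ht, rfl⟩ := mem_image.1 hj
    rw [primesInClass, mem_filter, mem_range] at hp
    rw [mem_range] at ht
    have hp1 := hp.2.1.one_lt
    have hb := hT t ht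
    by_cases hlt : p + 2 ^ (k + 24 * t) < a
    · exact Or.inr (by simpa using hlt)
    refine Or.inl ⟨⟨mem_AP_iff.2 ⟨not_lt.1 hlt, ?_⟩, fun hU => ?_⟩, ?_, ?_⟩
    · push_cast
      rw [hp.2.2, two_pow_add_mul_eq hq hk, sub_add_cancel]
    · exact hU.2.2 ⟨p, k + 24 * t, hp.2.1, by omega, rfl⟩
    · exact hp1.le.trans (Nat.le_add_right _ _)
    · change p + 2 ^ (k + 24 * t) ≤ 2 * N
      omega
  have hfin : ((AP q a \ U) ∩ Set.Icc 1 (2 * N)).Finite :=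
    (Set.finite_Icc 1 (2 * N)).subset Set.inter_subset_right
  have h1 := (Set.ncard_le_ncard hsub (hfin.union (finite_toSet _))).trans
    (Set.ncard_union_le _ _)
  rwa [Set.ncard_coe_finset, Set.ncard_coe_finset, card_range] at h1

lemma log_le_log_two_add_one {N : ℕ} (hN : 1 ≤ N) : Real.log N ≤ Nat.log 2 N + 1 := by
  have h1 : (N : ℝ) ≤ 2 ^ (Nat.log 2 N + 1) := by
    exact_mod_cast (Nat.lt_pow_succ_log_self one_lt_two N).le
  have h2 := Real.log_le_log (by exact_mod_cast hN) h1
  rw [Real.log_pow] at h2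
  have h3 : Real.log 2 ≤ 1 := by linarith [Real.log_two_lt_d9]
  push_cast at h2
  nlinarith [Nat.cast_nonneg (α := ℝ) (Nat.log 2 N)]

lemma log_two_le_two_mul_log {N : ℕ} (hN : 1 ≤ N) : (Nat.log 2 N : ℝ) ≤ 2 * Real.log N := by
  have h1 : (2 : ℝ) ^ Nat.log 2 N ≤ N := by
    exact_mod_cast Nat.pow_log_le_self 2 (by omega)
  have h2 := Real.log_le_log (by positivity) h1
  rw [Real.log_pow] at h2
  have h3 : 1 / 2 ≤ Real.log 2 := by linarith [Real.log_two_gt_d9]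
  nlinarith [Nat.cast_nonneg (α := ℝ) (Nat.log 2 N)]

open scoped Pointwise in
/-- Romanoff's theorem in an arithmetic progression: a progression containing `p + 2 ^ k` for
every prime `p` in some reduced residue class is not quasi-non-representable. -/
theorem not_quasiNonRep_of_isUnit {q a k : ℕ} (hq : q ∣ 11184810) (hk : 1 ≤ k)
    (hu : IsUnit ((a : ZMod q) - 2 ^ k)) : ¬ QuasiNonRep q a := by
  classical
  rintro ⟨hq0, -, hS⟩
  have : NeZero q := ⟨hq0.ne'⟩
  obtain ⟨C, hC0, hC⟩ := exists_sum_singularFactor_two_pow_sub_one_le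
  obtain ⟨c, hc0, hc⟩ := exists_frequently_le_card_primes_residueClass hu
  set M : ℝ := 1 + 17600 * C * (48 / c) with hM
  have hM0 : 0 < M := by positivity
  have hlarge : ∀ᶠ N : ℕ in atTop, 2 * ((k : ℝ) + 24) ≤ Real.log N :=
    (Real.tendsto_log_atTop.comp tendsto_natCast_atTop_atTop).eventually_ge_atTop _
  have hlarge' : ∀ᶠ N : ℕ in atTop, (a : ℝ) / (c / (96 * M)) ≤ N :=
    tendsto_natCast_atTop_atTop.eventually_ge_atTop _
  have key : ∃ᶠ N : ℕ in atTop,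
      c / (192 * M) * ((2 * N : ℕ) : ℝ) ≤
        Nat.card ↥((AP q a \ U) ∩ Set.Icc 1 (2 * N)) := by
    refine (hc.and_eventually ((hlarge.and hlarge').and (eventually_ge_atTop 1))).mono ?_
    rintro N ⟨h1, ⟨h2, h3⟩, hN⟩
    have hN0 : (0 : ℝ) < N := by exact_mod_cast hN
    have hlog : 0 < Real.log N := by linarith [Nat.cast_nonneg (α := ℝ) k]
    set L := Nat.log 2 N with hL
    set T := (L - k) / 24 with hTdef
    set A := primesInClass ((a : ZMod q) - 2 ^ k) N with hA
    set K := (range T).image fun t => k + 24 * t with hK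
    have hKcard : #K = T := by
      rw [hK, card_image_of_injective _ fun x z hxz => by simpa using hxz, card_range]
    have hKL : K ⊆ Icc 1 L := by
      intro j hj
      obtain ⟨t, ht, rfl⟩ := mem_image.1 hj
      rw [mem_range] at ht
      rw [mem_Icc]
      omega
    have hBcard : #(K.image (2 ^ ·)) = T := by
      rw [card_image_of_injective _ (Nat.pow_right_injective le_rfl), hKcard]
    have hE := addEnergy_mul_log_sq_le hC hN (A := A) (fun p hp => by
      rw [hA, primesInClass, mem_filter, mem_range] at hp
      exact ⟨hp.2.1, hp.1⟩) hKL
    have hCS := le_card_add_mul_addEnergy A (K.image (2 ^ ·))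
    have hY := card_add_le_card_AP_diff_U (a := a) hq hk N T fun t ht =>
      (Nat.pow_le_pow_right two_pos (by omega)).trans (Nat.pow_log_le_self 2 (by omega))
    rw [hBcard] at hCS
    rw [hKcard] at hE
    set E := addEnergy A (K.image (2 ^ ·))
    have hT1 : Real.log N / 48 ≤ T := by
      have h4 : L ≤ 24 * T + k + 23 := by omega
      have h4' : (L : ℝ) ≤ 24 * T + k + 23 := by exact_mod_cast h4
      have h5 := log_le_log_two_add_one hN
      linarith
    set X : ℝ := #A * T with hX
    have hXN : c * N / 48 ≤ X := by
      calc c * N / 48 ≤ #A * Real.log N / 48 := by gcongr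
        _ = #A * (Real.log N / 48) := by ring
        _ ≤ _ := by rw [hX]; gcongr
    have hX0 : 0 < X := lt_of_lt_of_le (by positivity) hXN
    have hEX : (E : ℝ) ≤ X * M := by
      have h6 : (E : ℝ) * Real.log N ^ 2 ≤ (X + 17600 * C * N) * Real.log N ^ 2 := by
        refine hE.trans ?_
        rw [add_mul]
        refine add_le_add le_rfl ?_
        have h7 : (L : ℝ) ^ 2 ≤ (2 * Real.log N) ^ 2 := by
          gcongr
          exact log_two_le_two_mul_log hN
        calc 4400 * C * N * L ^ 2 ≤ 4400 * C * N * (2 * Real.log N) ^ 2 := by gcongr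
          _ = _ := by ring
      have h8 := le_of_mul_le_mul_right h6 (by positivity)
      have h9 : (N : ℝ) ≤ 48 / c * X := by
        rw [div_mul_eq_mul_div, le_div_iff₀ hc0]
        linarith
      calc (E : ℝ) ≤ X + 17600 * C * N := h8
        _ ≤ X + 17600 * C * (48 / c * X) := by gcongr
        _ = _ := by rw [hM]; ring
    set Y : ℝ := ((#(A + K.image (2 ^ ·)) : ℕ) : ℝ) with hYdef
    have hXY : X ≤ Y * M := by
      have hCS' : X ^ 2 ≤ Y * E := by
        rw [hX, hYdef, mul_pow]
        exact_mod_cast hCS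
      have : X * X ≤ Y * M * X := by
        calc X * X = X ^ 2 := (sq X).symm
          _ ≤ Y * (X * M) := hCS'.trans (by gcongr)
          _ = _ := by ring
      exact le_of_mul_le_mul_right this hX0
    have hY' : Y ≤ (Nat.card ↥((AP q a \ U) ∩ Set.Icc 1 (2 * N)) : ℝ) + a := by
      rw [hYdef, ← Nat.cast_add]
      exact Nat.cast_le.2 hY
    rw [div_le_iff₀ (by positivity)] at h3
    have hYN : c * N / 48 / M ≤ Y := by
      rw [div_le_iff₀ hM0]; exact hXN.trans hXY
    have e1 : c / (192 * M) * ((2 * N : ℕ) : ℝ) = c * N / 48 / M - N * (c / (96 * M)) := by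
      push_cast
      field_simp
      norm_num
    rw [e1]
    linarith
  exact not_densityZero_of_frequently (by positivity)
    ((tendsto_id.const_mul_atTop' two_pos).frequently key) hS

lemma quasiNonRep_even_and_odd {m a : ℕ} (h : QuasiNonRep m a) : Even m ∧ Odd a := by
  obtain ⟨hm, ha, hS⟩ := h
  by_contra hcon
  obtain ⟨b, hb0, hb, j, hj⟩ : ∃ b, 0 < b ∧ Even b ∧ ∃ j, b = m * j + a := by
    by_cases hae : Even a
    · exact ⟨a, ha, hae, 0, by simp⟩
    · rw [Nat.not_even_iff_odd] at hae
      have hmo : Odd m := by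
        rw [← Nat.not_even_iff_odd]
        exact fun hme => hcon ⟨hme, hae⟩
      exact ⟨m + a, by omega, hmo.add_odd hae, 1, by simp⟩
  refine not_densityZero_of_frequently (δ := 1 / ((2 * m + b : ℕ) : ℝ)) (by positivity) ?_ hS
  refine (tendsto_id.const_mul_atTop' (show 0 < 2 * m + b by omega)).frequently
    (Eventually.of_forall fun t => ?_).frequently
  have hsub : (((range t).image fun h => 2 * m * h + b : Finset ℕ) : Set ℕ) ⊆
      (AP m a \ U) ∩ Set.Icc 1 ((2 * m + b) * t) := by
    intro n hn
    obtain ⟨h, hh, rfl⟩ := mem_image.1 (mem_coe.1 hn)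
    rw [mem_range] at hh
    refine ⟨⟨⟨2 * h + j, by rw [hj]; ring⟩, fun hU => ?_⟩, by omega, ?_⟩
    · exact Nat.not_odd_iff_even.2 (((even_two_mul m).mul_right h).add hb) hU.2.1
    · change 2 * m * h + b ≤ (2 * m + b) * t
      have : 2 * m * h ≤ 2 * m * t := by gcongr
      nlinarith
  have hcard := Set.ncard_le_ncard hsub ((Set.finite_Icc _ _).subset Set.inter_subset_right)
  rw [Set.ncard_coe_finset, card_image_of_injective _ fun x z hxz => by
    simpa [hm.ne'] using hxz, card_range] at hcard
  calc 1 / ((2 * m + b : ℕ) : ℝ) * (((2 * m + b) * id t : ℕ) : ℝ) = t := by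
        have : ((2 * m + b : ℕ) : ℝ) ≠ 0 := by positivity
        rw [Nat.cast_mul, id]
        field_simp
    _ ≤ _ := by exact_mod_cast hcard

/-- The odd prime divisors of `11184810`. -/
def coveringPrimes : List ℕ := [3, 5, 7, 13, 17, 241]

/-- The residues modulo `11184810` all of whose differences with a power of two are divisible by
one of the `coveringPrimes`. -/
def coveringResidues : List ℕ :=
  [509203, 762701, 992077, 1247173, 1254341, 1330207, 1330319, 1730653,
    1730681, 1976473, 2313487, 2344211, 2554843, 3177553, 3292241, 3419789,
    3423373, 3661529, 3661543, 3784439, 4384979, 4442323, 4506097, 4507889,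
    4626967, 5049251, 5050147, 6610811, 7117807, 7576559, 7629217, 8086751,
    8101087, 8252819, 8253043, 8643209, 9053711, 9053767, 9545351, 9560713,
    9666029, 10219379, 10280827, 10581097, 10609769, 10702091, 10913233,
    10913681]

lemma prime_of_mem_coveringPrimes {p : ℕ} (hp : p ∈ coveringPrimes) : p.Prime := by
  simp only [coveringPrimes, List.mem_cons, List.not_mem_nil, or_false] at hp
  rcases hp with rfl | rfl | rfl | rfl | rfl | rfl <;> norm_num

lemma dvd_of_mem_coveringPrimes {p : ℕ} (hp : p ∈ coveringPrimes) : p ∣ 11184810 := by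
  simp only [coveringPrimes, List.mem_cons, List.not_mem_nil, or_false] at hp
  rcases hp with rfl | rfl | rfl | rfl | rfl | rfl <;> norm_num

lemma eq_two_or_mem_coveringPrimes {p : ℕ} (hp : p.Prime) (h : p ∣ 11184810) :
    p = 2 ∨ p ∈ coveringPrimes := by
  rw [show 11184810 = 2 * 3 * 5 * 7 * 13 * 17 * 241 by norm_num] at h
  simp only [hp.dvd_mul] at h
  simp only [coveringPrimes, List.mem_cons, List.not_mem_nil, or_false]
  rw [Nat.prime_dvd_prime_iff_eq hp (by norm_num), Nat.prime_dvd_prime_iff_eq hp (by norm_num),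
    Nat.prime_dvd_prime_iff_eq hp (by norm_num), Nat.prime_dvd_prime_iff_eq hp (by norm_num),
    Nat.prime_dvd_prime_iff_eq hp (by norm_num), Nat.prime_dvd_prime_iff_eq hp (by norm_num),
    Nat.prime_dvd_prime_iff_eq hp (by norm_num)] at h
  tauto

lemma isUnit_sub_two_pow {q a k : ℕ} (hq : q ∣ 11184810) (ha : Odd a) (hk : 1 ≤ k)
    (h : ∀ p ∈ coveringPrimes, p ∣ q → a % p ≠ 2 ^ k % p) :
    IsUnit ((a : ZMod q) - 2 ^ k) := by
  have hcast : ∀ d : ℕ, d ∣ q → ((a + 2 ^ k * 11184809 : ℕ) : ZMod d) = a - 2 ^ k := by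
    intro d hd
    have h0 : ((11184809 : ℕ) : ZMod d) + 1 = 0 := by
      rw [← Nat.cast_add_one]
      exact (ZMod.natCast_eq_zero_iff _ _).2 (hd.trans hq)
    rw [Nat.cast_add, Nat.cast_mul, eq_neg_of_add_eq_zero_left h0]
    push_cast
    ring
  rw [← hcast q dvd_rfl, ZMod.isUnit_iff_coprime]
  refine Nat.coprime_of_dvd fun p hp hpb hpq => ?_
  rcases eq_two_or_mem_coveringPrimes hp (hpq.trans hq) with rfl | hp'
  · have h2 : Even (2 ^ k * 11184809) := (Nat.even_pow.2 ⟨even_two, by omega⟩).mul_right _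
    exact Nat.not_even_iff_odd.2 (ha.add_even h2) (even_iff_two_dvd.2 hpb)
  · refine h p hp' hpq ?_
    rw [← ZMod.natCast_eq_natCast_iff']
    have h3 := hcast p hpq
    rw [(ZMod.natCast_eq_zero_iff _ _).2 hpb] at h3
    push_cast
    exact (sub_eq_zero.1 h3.symm)

lemma tendsto_log_two_div_atTop :
    Tendsto (fun N : ℕ => 6 * (2 * Real.log N / N)) atTop (nhds 0) := by
  have h := (Real.isLittleO_log_id_atTop.tendsto_div_nhds_zero.comp
    (tendsto_natCast_atTop_atTop (R := ℝ))).const_mul 12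
  rw [mul_zero] at h
  refine h.congr fun N => ?_
  simp only [Function.comp_apply, id]
  ring

lemma quasiNonRep_of_covering {a : ℕ} (ha : Odd a)
    (h : ∀ k, 1 ≤ k → ∃ p ∈ coveringPrimes, a % p = 2 ^ k % p) : QuasiNonRep 11184810 a := by
  refine ⟨by norm_num, ha.pos, ?_⟩
  refine squeeze_zero' (Eventually.of_forall fun N => by positivity)
    ((eventually_ge_atTop 1).mono fun N hN => ?_) tendsto_log_two_div_atTop
  have hsub : (AP 11184810 a \ U) ∩ Set.Icc 1 N ⊆
      ((coveringPrimes.toFinset ×ˢ Icc 1 (Nat.log 2 N)).image fun x => x.1 + 2 ^ x.2 :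
        Finset ℕ) := by
    rintro n ⟨⟨⟨j, rfl⟩, hnU⟩, hn1, hnN⟩
    have hodd : Odd (11184810 * j + a) := by
      rw [show 11184810 * j = 2 * (5592405 * j) by ring]
      exact (even_two_mul _).add_odd ha
    obtain ⟨r, k, hr, hk, hrk⟩ : ∃ r k : ℕ, r.Prime ∧ 0 < k ∧ 11184810 * j + a = r + 2 ^ k := by
      by_contra hcon
      exact hnU ⟨hn1, hodd, hcon⟩
    obtain ⟨p, hp, hpk⟩ := h k hk
    have hpr : p ∣ r := by
      have h1 : (a : ZMod p) = ((2 ^ k : ℕ) : ZMod p) :=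
        (ZMod.natCast_eq_natCast_iff' _ _ _).2 hpk
      have h2 : ((11184810 : ℕ) : ZMod p) = 0 :=
        (ZMod.natCast_eq_zero_iff _ _).2 (dvd_of_mem_coveringPrimes hp)
      have h3 := congrArg (Nat.cast : ℕ → ZMod p) hrk
      rw [Nat.cast_add, Nat.cast_mul, h2, zero_mul, zero_add, h1, Nat.cast_add] at h3
      exact (ZMod.natCast_eq_zero_iff _ _).1 (right_eq_add.1 h3)
    have hpr' := (Nat.prime_dvd_prime_iff_eq (prime_of_mem_coveringPrimes hp) hr).1 hpr
    rw [mem_coe, mem_image]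
    refine ⟨(r, k), mem_product.2 ⟨?_, mem_Icc.2 ⟨hk, ?_⟩⟩, hrk.symm⟩
    · rw [← hpr']
      exact List.mem_toFinset.2 hp
    · exact Nat.le_log_of_pow_le one_lt_two (le_of_add_le_right (hrk ▸ hnN))
  have hcard := Set.ncard_le_ncard hsub (finite_toSet _)
  rw [Set.ncard_coe_finset] at hcard
  replace hcard := hcard.trans card_image_le
  rw [card_product, Nat.card_Icc, show #coveringPrimes.toFinset = 6 from rfl,
    Nat.add_sub_cancel] at hcard
  have hN0 : (0 : ℝ) < N := by exact_mod_cast hN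
  rw [← mul_div_assoc]
  gcongr
  calc _ ≤ ((6 * Nat.log 2 N : ℕ) : ℝ) := Nat.cast_le.2 hcard
    _ = 6 * (Nat.log 2 N : ℝ) := by push_cast; ring
    _ ≤ _ := by gcongr; exact log_two_le_two_mul_log hN

/-- Depth-first search through the ways of covering the exponents `ks`, where `ps` lists the primes
whose residue is still free and `A` the residues chosen so far. -/
def coveringSearch : List ℕ → List ℕ → List (ℕ × ℕ) → Bool
  | [], _, A => coveringResidues.any fun s => coveringPrimes.all fun p =>
      A.any fun x => x.1 == p && x.2 == s % p
  | k :: ks, ps, A =>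
      if A.any fun x => x.2 == 2 ^ k % x.1 then coveringSearch ks ps A
      else ps.all fun p => coveringSearch ks (ps.erase p) ((p, 2 ^ k % p) :: A)

lemma exists_residue_of_coveringSearch {a : ℕ} (ks ps : List ℕ) (A : List (ℕ × ℕ))
    (h : coveringSearch ks ps A = true) (hA : ∀ x ∈ A, a % x.1 = x.2)
    (hk : ∀ k ∈ ks, (∃ p ∈ ps, a % p = 2 ^ k % p) ∨ ∃ x ∈ A, x.2 = 2 ^ k % x.1) :
    ∃ s ∈ coveringResidues, ∀ p ∈ coveringPrimes, a % p = s % p := by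
  induction ks generalizing ps A with
  | nil =>
    simp only [coveringSearch, List.any_eq_true, List.all_eq_true, Bool.and_eq_true,
      beq_iff_eq] at h
    obtain ⟨s, hs, h⟩ := h
    refine ⟨s, hs, fun p hp => ?_⟩
    obtain ⟨x, hx, rfl, hxs⟩ := h p hp
    rw [← hxs, hA x hx]
  | cons k ks ih =>
    rw [coveringSearch] at h
    split_ifs at h with hc
    · exact ih ps A h hA fun j hj => hk j (List.mem_cons_of_mem _ hj)
    · simp only [List.any_eq_true, beq_iff_eq] at hc
      obtain ⟨p, hp, hpk⟩ := (hk k List.mem_cons_self).resolve_right hc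
      refine ih _ _ (List.all_eq_true.1 h p hp) ?_ fun j hj => ?_
      · intro x hx
        rcases List.mem_cons.1 hx with rfl | hx
        · exact hpk
        · exact hA x hx
      · rcases hk j (List.mem_cons_of_mem _ hj) with ⟨r, hr, hrj⟩ | ⟨x, hx, hxj⟩
        · by_cases hrp : r = p
          · subst hrp
            exact Or.inr ⟨_, List.mem_cons_self, hpk.symm.trans hrj⟩
          · exact Or.inl ⟨r, (List.mem_erase_of_ne hrp).2 hr, hrj⟩
        · exact Or.inr ⟨x, List.mem_cons_of_mem _ hx, hxj⟩

lemma coveringSearch_range :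
    coveringSearch (List.range' 1 24) coveringPrimes [] = true := by
  decide +kernel

lemma coveringResidues_spec : ∀ s ∈ coveringResidues, s < 11184810 ∧ s % 2 = 1 ∧
    (∀ k ∈ List.range' 1 24, ∃ p ∈ coveringPrimes, s % p = 2 ^ k % p) ∧
    ∀ q ∈ coveringPrimes, ∃ k ∈ List.range' 1 24, ∀ p ∈ coveringPrimes,
      p ≠ q → s % p ≠ 2 ^ k % p := by
  decide +kernel

lemma mem_coveringResidues_of_covering {a : ℕ} (ha : Odd a) (ham : a < 11184810)
    (h : ∀ k, 1 ≤ k → ∃ p ∈ coveringPrimes, a % p = 2 ^ k % p) : a ∈ coveringResidues := by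
  obtain ⟨s, hs, hsa⟩ := exists_residue_of_coveringSearch (a := a) _ _ [] coveringSearch_range
    (by simp) fun k hk => Or.inl (h k (List.mem_range'_1.1 hk).1)
  obtain ⟨hsm, hs2, -⟩ := coveringResidues_spec s hs
  have h2 := Nat.odd_iff.1 ha
  simp only [coveringPrimes, List.mem_cons, List.not_mem_nil, or_false, forall_eq_or_imp,
    forall_eq] at hsa
  have hmod : a ≡ s [MOD 2 * 3 * 5 * 7 * 13 * 17 * 241] := by
    iterate 6 rw [← Nat.modEq_and_modEq_iff_modEq_mul (by norm_num)]
    simp only [Nat.ModEq, h2, hs2, hsa, and_self]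
  rwa [hmod.eq_of_lt_of_lt ham hsm]

lemma covering_of_mem_coveringResidues {s : ℕ} (hs : s ∈ coveringResidues) (k : ℕ) (hk : 1 ≤ k) :
    ∃ p ∈ coveringPrimes, s % p = 2 ^ k % p := by
  obtain ⟨p, hp, h⟩ := (coveringResidues_spec s hs).2.2.1 (1 + (k - 1) % 24)
    (List.mem_range'_1.2 (by omega))
  refine ⟨p, hp, h.trans ?_⟩
  rw [← ZMod.natCast_eq_natCast_iff']
  push_cast
  rw [← two_pow_add_mul_eq (dvd_of_mem_coveringPrimes hp) (by omega) ((k - 1) / 24)]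
  congr 1
  omega

lemma covering_of_quasiNonRep {a : ℕ} (h : QuasiNonRep 11184810 a) (k : ℕ) (hk : 1 ≤ k) :
    ∃ p ∈ coveringPrimes, a % p = 2 ^ k % p := by
  by_contra! hcon
  exact not_quasiNonRep_of_isUnit dvd_rfl hk
    (isUnit_sub_two_pow dvd_rfl (quasiNonRep_even_and_odd h).2 hk fun p hp _ => hcon p hp) h

lemma mem_coveringResidues_of_longest {a : ℕ} (h : QuasiNonRep 11184810 a)
    (hl : ∀ m' a' : ℕ, QuasiNonRep m' a' → ¬ AP 11184810 a ⊂ AP m' a') :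
    a ∈ coveringResidues := by
  have hodd := (quasiNonRep_even_and_odd h).2
  have hcov := covering_of_quasiNonRep h
  have hodd' : Odd (a % 11184810) := by
    rw [Nat.odd_iff] at hodd ⊢
    omega
  have hq : QuasiNonRep 11184810 (a % 11184810) := quasiNonRep_of_covering hodd' fun k hk => by
    obtain ⟨p, hp, hpk⟩ := hcov k hk
    exact ⟨p, hp, by rw [Nat.mod_mod_of_dvd _ (dvd_of_mem_coveringPrimes hp), hpk]⟩
  refine mem_coveringResidues_of_covering hodd (not_le.1 fun hle => ?_) hcov
  refine hl _ _ hq ((Set.ssubset_iff_of_subset ?_).2 ⟨a % 11184810, ⟨0, by simp⟩, ?_⟩)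
  · rintro n ⟨j, rfl⟩
    exact ⟨j + a / 11184810, by omega⟩
  · rintro ⟨j, hj⟩
    omega

lemma not_ssubset_of_mem_coveringResidues {a m' a' : ℕ} (ha : a ∈ coveringResidues)
    (h : QuasiNonRep m' a') : ¬ AP 11184810 a ⊂ AP m' a' := by
  intro hss
  obtain ⟨ham, ha2, -, hfree⟩ := coveringResidues_spec a ha
  obtain ⟨ha'a, hcong⟩ := mem_AP_iff.1 (hss.subset ⟨0, by simp⟩ : a ∈ AP m' a')
  have hdvd : m' ∣ 11184810 := by
    have h1 := (mem_AP_iff.1 (hss.subset ⟨1, rfl⟩ : 11184810 * 1 + a ∈ AP m' a')).2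
    rw [Nat.cast_add, hcong, add_eq_right, mul_one] at h1
    exact (ZMod.natCast_eq_zero_iff _ _).1 h1
  obtain ⟨c, hc⟩ := hdvd
  have ha'0 := h.2.1
  have hc1 : c ≠ 1 := by
    rintro rfl
    rw [mul_one] at hc
    subst hc
    rw [ZMod.natCast_eq_natCast_iff', Nat.mod_eq_of_lt ham,
      Nat.mod_eq_of_lt (ha'a.trans_lt ham)] at hcong
    rw [hcong] at hss
    exact hss.ne rfl
  obtain ⟨q, hq, d, rfl⟩ := Nat.exists_prime_and_dvd hc1
  have hqm : q ∣ 11184810 := ⟨m' * d, by rw [hc]; ring⟩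
  have hsq : ¬ q ∣ m' := by
    rintro ⟨e, rfl⟩
    have hqq : q * q ∣ 11184810 := ⟨e * d, by rw [hc]; ring⟩
    rcases eq_two_or_mem_coveringPrimes hq hqm with rfl | hq'
    · norm_num at hqq
    · simp only [coveringPrimes, List.mem_cons, List.not_mem_nil, or_false] at hq'
      rcases hq' with rfl | rfl | rfl | rfl | rfl | rfl <;> norm_num at hqq
  rcases eq_two_or_mem_coveringPrimes hq hqm with rfl | hq'
  · exact hsq (quasiNonRep_even_and_odd h).1.two_dvd
  · obtain ⟨k, hk, hfree⟩ := hfree q hq'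
    have hk1 := (List.mem_range'_1.1 hk).1
    refine not_quasiNonRep_of_isUnit ⟨_, hc⟩ hk1 ?_ h
    rw [← hcong]
    exact isUnit_sub_two_pow ⟨_, hc⟩ (Nat.odd_iff.2 ha2) hk1 fun p hp hpm =>
      hfree p hp (by rintro rfl; exact hsq hpm)

theorem longest_iff_mem_coveringResidues (a : ℕ) : (QuasiNonRep 11184810 a ∧
      ∀ m' a' : ℕ, QuasiNonRep m' a' → ¬ AP 11184810 a ⊂ AP m' a') ↔ a ∈ coveringResidues :=
  ⟨fun h => mem_coveringResidues_of_longest h.1 h.2, fun h =>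
    ⟨quasiNonRep_of_covering (Nat.odd_iff.2 (coveringResidues_spec a h).2.1)
      (covering_of_mem_coveringResidues h),
      fun _ _ => not_ssubset_of_mem_coveringResidues h⟩⟩

end

theorem stmt5 (a : ℕ) (ha : 0 < a) :
    (QuasiNonRep 11184810 a ∧
      ∀ m' a' : ℕ, QuasiNonRep m' a' → ¬ AP 11184810 a ⊂ AP m' a') ↔
    a ∈ ({509203, 762701, 992077, 1247173, 1254341, 1330207, 1330319, 1730653,
      1730681, 1976473, 2313487, 2344211, 2554843, 3177553, 3292241, 3419789,
      3423373, 3661529, 3661543, 3784439, 4384979, 4442323, 4506097, 4507889,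
      4626967, 5049251, 5050147, 6610811, 7117807, 7576559, 7629217, 8086751,
      8101087, 8252819, 8253043, 8643209, 9053711, 9053767, 9545351, 9560713,
      9666029, 10219379, 10280827, 10581097, 10609769, 10702091, 10913233,
      10913681} : Set ℕ) := by
  rw [longest_iff_mem_coveringResidues]
  simp only [coveringResidues, List.mem_cons, List.not_mem_nil, or_false, Set.mem_insert_iff,
    Set.mem_singleton_iff]
end

section
/- Let a ∈ 𝒰. Then a lies in some infinite arithmetic progression {mh + b : h = 0, 1, 2, …} (with m, b positive integers) that is contained in 𝒰 if and only if there is an integer m > 1 such that gcd(a − 2^k, m) > 1 for every positive integer k. -/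
open Filter

theorem exists_modulus_forall_not_dvd_two_pow_sub (c : ℤ) (hc : ∀ k : ℕ, 0 < k → 2 ^ k ≠ c) :
    ∃ M : ℕ, 0 < M ∧ ∀ k : ℕ, 0 < k → ¬ (M : ℤ) ∣ 2 ^ k - c := by
  rcases eq_or_ne c 0 with rfl | h0
  · refine ⟨3, by norm_num, fun k _ h => ?_⟩
    rw [sub_zero] at h
    exact absurd (Int.prime_three.dvd_of_dvd_pow h) (by norm_num)
  · refine ⟨4 * c.natAbs, by positivity, fun k hk h => hc k hk ?_⟩
    have h4 : 4 * c ∣ 2 ^ k - c := by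
      refine dvd_trans ?_ h
      push_cast
      exact mul_dvd_mul_left 4 ((dvd_abs c c).mpr dvd_rfl)
    obtain ⟨j, hj⟩ := h4
    have hfac : (2 : ℤ) ^ k = (1 + 4 * j) * c := by linear_combination hj
    have hcop : IsCoprime (1 + 4 * j) ((2 : ℤ) ^ k) :=
      IsCoprime.pow_right ⟨1, -2 * j, by ring⟩
    have hunit : IsUnit (1 + 4 * j) := hcop.isUnit_of_dvd' dvd_rfl ⟨c, hfac⟩
    have hj0 : j = 0 := by
      rcases Int.isUnit_iff.mp hunit with h | h <;> omega
    rw [hfac, hj0]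
    ring

theorem one_lt_gcd_of_AP_subset_U {a m b : ℕ} (hm : 0 < m) (hab : a ∈ AP m b)
    (hsub : AP m b ⊆ U) (k : ℕ) (hk : 0 < k) : 1 < m ∧ 1 < Int.gcd ((a : ℤ) - 2 ^ k) m := by
  have hm1 : 1 < m := by
    obtain ⟨x, hx⟩ := (hsub ⟨0, rfl⟩).2.1
    obtain ⟨y, hy⟩ := (hsub ⟨1, rfl⟩).2.1
    omega
  refine ⟨hm1, ?_⟩
  by_contra hlt
  have hpos : 0 < Int.gcd ((a : ℤ) - 2 ^ k) m :=
    Int.gcd_pos_of_ne_zero_right _ (by exact_mod_cast hm.ne')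
  have hcop : IsCoprime ((a : ℤ) - 2 ^ k) m := Int.isCoprime_iff_gcd_eq_one.mpr (by omega)
  obtain ⟨p, hpa, hp, hmod⟩ := Nat.forall_exists_prime_gt_and_zmodEq a hm.ne' hcop
  obtain ⟨h, rfl⟩ := hab
  obtain ⟨t, ht⟩ := hmod.symm.dvd
  have ht' : (p : ℤ) + 2 ^ k = m * (h + t) + b := by
    push_cast at ht
    linear_combination ht
  have hnonneg : 0 ≤ t := by
    by_contra hneg
    have h1 : (m : ℤ) * (h + t) ≤ m * h := by
      apply mul_le_mul_of_nonneg_left <;> omega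
    have h2 : ((m * h + b : ℕ) : ℤ) < p := by exact_mod_cast hpa
    have h3 : (0 : ℤ) < 2 ^ k := by positivity
    push_cast at h2
    linarith
  lift t to ℕ using hnonneg
  exact (hsub ⟨h + t, rfl⟩).2.2 ⟨p, k, hp, hk, by exact_mod_cast ht'.symm⟩

theorem exists_AP_subset_U {a m : ℕ} (ha : a ∈ U) (hm : 0 < m)
    (hgcd : ∀ k : ℕ, 0 < k → 1 < Int.gcd ((a : ℤ) - 2 ^ k) m) :
    ∃ M : ℕ, 0 < M ∧ AP M a ⊆ U := by
  obtain ⟨hapos, hodd, hrep⟩ := ha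
  have key (p : ℕ) : ∃ M : ℕ, 0 < M ∧
      (p.Prime → ∀ k : ℕ, 0 < k → ¬ (M : ℤ) ∣ 2 ^ k - ((a : ℤ) - p)) := by
    by_cases hp : p.Prime
    · obtain ⟨M, hM, h⟩ := exists_modulus_forall_not_dvd_two_pow_sub ((a : ℤ) - p)
        (fun k hk h => hrep ⟨p, k, hp, hk, by zify; linarith⟩)
      exact ⟨M, hM, fun _ => h⟩
    · exact ⟨1, one_pos, fun h => absurd h hp⟩
  choose f hfpos hf using key
  refine ⟨2 * m * ∏ p ∈ m.primeFactors, f p,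
    Nat.mul_pos (by positivity) (Finset.prod_pos fun p _ => hfpos p), ?_⟩
  rintro n ⟨h, rfl⟩
  refine ⟨by positivity, ?_, ?_⟩
  · refine Even.add_odd ?_ hodd
    simp [mul_assoc]
  rintro ⟨p, k, hp, hk, hn⟩
  set P := ∏ p ∈ m.primeFactors, f p
  have hn' : (2 : ℤ) * m * P * h + a = p + 2 ^ k := by exact_mod_cast hn
  obtain ⟨q, hq, hqg⟩ := Nat.exists_prime_and_dvd (hgcd k hk).ne'
  have hqm : (q : ℤ) ∣ m := (Int.natCast_dvd_natCast.mpr hqg).trans (Int.gcd_dvd_right _ _)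
  have hqa : (q : ℤ) ∣ a - 2 ^ k := (Int.natCast_dvd_natCast.mpr hqg).trans (Int.gcd_dvd_left _ _)
  have hqp : (q : ℤ) ∣ p := by
    have : (p : ℤ) = (a - 2 ^ k) + m * (2 * P * h) := by linear_combination -hn'
    rw [this]
    exact dvd_add hqa (hqm.mul_right _)
  obtain rfl : q = p := (Nat.prime_dvd_prime_iff_eq hq hp).mp (Int.natCast_dvd_natCast.mp hqp)
  have hmem : q ∈ m.primeFactors :=
    Nat.mem_primeFactors.mpr ⟨hq, Int.natCast_dvd_natCast.mp hqm, hm.ne'⟩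
  refine hf q hq k hk ?_
  have hdvd : (f q : ℤ) ∣ P := Int.natCast_dvd_natCast.mpr (Finset.dvd_prod_of_mem f hmem)
  have : (2 : ℤ) ^ k - (a - q) = P * (2 * m * h) := by linear_combination -hn'
  rw [this]
  exact hdvd.mul_right _

theorem stmt7 (a : ℕ) (ha : a ∈ U) :
    (∃ m b : ℕ, 0 < m ∧ 0 < b ∧ a ∈ AP m b ∧ AP m b ⊆ U) ↔
    (∃ m : ℤ, 1 < m ∧ ∀ k : ℕ, 0 < k → 1 < Int.gcd ((a : ℤ) - 2 ^ k) m) := by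
  constructor
  · rintro ⟨m, b, hm, -, hab, hsub⟩
    have h := one_lt_gcd_of_AP_subset_U hm hab hsub
    exact ⟨m, by exact_mod_cast (h 1 one_pos).1, fun k hk => (h k hk).2⟩
  · rintro ⟨m, hm, hgcd⟩
    lift m to ℕ using by omega
    obtain ⟨M, hM, hsub⟩ := exists_AP_subset_U ha (by omega) hgcd
    exact ⟨M, a, hM, ha.1, ⟨0, by simp⟩, hsub⟩
end

section
/- Let a ∈ 𝒰. Then a lies in no infinite arithmetic progression {mh + b : h = 0, 1, 2, …} (with m, b positive integers) contained in 𝒰 if and only if the quantity p(a − 2^k) is unbounded as k ranges over the positive integers, where p(n) denotes the least prime divisor of the integer n and p(±1) = +∞; equivalently, if and only if for every real number C there exists a positive integer k such that every prime divisor of a − 2^k exceeds C. -/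
open Filter

/-- If every prime divisor of `a - 2 ^ k` exceeds `m`, then Dirichlet's theorem gives a term of
the progression `{m * h + a}` of the form `p + 2 ^ k` with `p` prime. -/
lemma exists_prime_add_two_pow_eq_mul_add {m a k : ℕ} (hm : 0 < m)
    (hk : ∀ p : ℕ, p.Prime → (p : ℤ) ∣ (a : ℤ) - 2 ^ k → m < p) :
    ∃ p h : ℕ, p.Prime ∧ m * h + a = p + 2 ^ k := by
  have hcop : IsCoprime ((a : ℤ) - 2 ^ k) (m : ℤ) := by
    rw [Int.isCoprime_iff_gcd_eq_one, Int.gcd, Int.natAbs_natCast]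
    refine Nat.coprime_of_dvd fun q hq h1 h2 => ?_
    exact (hk q hq (Int.natCast_dvd.2 h1)).not_ge (Nat.le_of_dvd hm h2)
  obtain ⟨p, hpa, hp, hmod⟩ := Nat.forall_exists_prime_gt_and_zmodEq a hm.ne' hcop
  obtain ⟨c, hc⟩ := hmod.symm.dvd
  have hc0 : 0 ≤ c := by
    have hm' : (0 : ℤ) < m := by exact_mod_cast hm
    have h2 : (0 : ℤ) < 2 ^ k := by positivity
    have hpa' : (a : ℤ) < p := by exact_mod_cast hpa
    by_contra! hneg
    nlinarith
  lift c to ℕ using hc0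
  refine ⟨p, c, hp, ?_⟩
  zify
  linarith

/-- The terms of the progression with first term `a ∈ U` and common difference `3 * 2 ^ N * N!`
are never of the form `p + 2 ^ k` with `p` a prime such that `a + p ≤ N`. -/
lemma mul_add_ne_prime_add_two_pow {a N h p k : ℕ} (ha : a ∈ U) (hp : p.Prime) (hk : 0 < k)
    (hN : a + p ≤ N) : 3 * 2 ^ N * N.factorial * h + a ≠ p + 2 ^ k := by
  intro heq
  have hNlt : N < 2 ^ N := Nat.lt_two_pow_self
  rcases Nat.eq_zero_or_pos h with rfl | hh
  · exact ha.2.2 ⟨p, k, hp, hk, by simpa using heq⟩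
  rcases le_or_gt N k with hNk | hNk
  · have hap : a ≡ p [MOD 2 ^ N] := by
      have h1 : 2 ^ N ∣ 3 * 2 ^ N * N.factorial * h :=
        ⟨3 * N.factorial * h, by ring⟩
      have h2 : 2 ^ N ∣ 2 ^ k := pow_dvd_pow 2 hNk
      calc a ≡ 3 * 2 ^ N * N.factorial * h + a [MOD 2 ^ N] := by
            simpa using ((Nat.modEq_zero_iff_dvd.2 h1).add_right a).symm
        _ = p + 2 ^ k := heq
        _ ≡ p [MOD 2 ^ N] := by
            simpa using (Nat.modEq_zero_iff_dvd.2 h2).add_left p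
    obtain rfl := hap.eq_of_lt_of_lt (by omega) (by omega)
    have h3 : 3 ∣ 2 ^ k := ⟨2 ^ N * N.factorial * h, by linarith⟩
    have := Nat.Prime.dvd_of_dvd_pow Nat.prime_three h3
    omega
  · have h1 : 2 ^ k ≤ 2 ^ N := Nat.pow_le_pow_right two_pos hNk.le
    have h2 : 0 < N.factorial * h := Nat.mul_pos N.factorial_pos hh
    nlinarith

/-- If every `a - 2 ^ k` has a prime divisor at most `N - a`, then the progression with first term
`a ∈ U` and common difference `3 * 2 ^ N * N!` is contained in `U`. -/
lemma AP_subset_U {a N : ℕ} (ha : a ∈ U)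
    (hN : ∀ k : ℕ, 0 < k → ∃ q : ℕ, q.Prime ∧ (q : ℤ) ∣ (a : ℤ) - 2 ^ k ∧ a + q ≤ N) :
    AP (3 * 2 ^ N * N.factorial) a ⊆ U := by
  rintro n ⟨h, rfl⟩
  have hN0 : N ≠ 0 := by have := ha.1; obtain ⟨q, -, -, hq⟩ := hN 1 one_pos; omega
  refine ⟨by have := ha.1; omega, ?_, ?_⟩
  · refine Even.add_odd ?_ ha.2.1
    simp [Nat.even_mul, Nat.even_pow, hN0]
  · rintro ⟨p, k, hp, hk, heq⟩
    obtain ⟨q, hq, hqd, hqN⟩ := hN k hk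
    have hqp : q ∣ p := by
      have h1 : q ∣ 3 * 2 ^ N * N.factorial * h :=
        ((Nat.dvd_factorial hq.pos (by omega)).mul_left _).mul_right _
      have h2 : (p : ℤ) = ((3 * 2 ^ N * N.factorial * h : ℕ) : ℤ) + (a - 2 ^ k) := by
        zify at heq; push_cast; linarith
      rw [← Int.natCast_dvd_natCast, h2]
      exact dvd_add (Int.natCast_dvd_natCast.2 h1) hqd
    obtain rfl := (Nat.prime_dvd_prime_iff_eq hq hp).1 hqp
    exact mul_add_ne_prime_add_two_pow ha hp hk hqN heq

theorem stmt8 (a : ℕ) (ha : a ∈ U) :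
    (¬ ∃ m b : ℕ, 0 < m ∧ 0 < b ∧ a ∈ AP m b ∧ AP m b ⊆ U) ↔
    (∀ C : ℝ, ∃ k : ℕ, 0 < k ∧
      ∀ p : ℕ, p.Prime → (p : ℤ) ∣ (a : ℤ) - 2 ^ k → C < p) := by
  constructor
  · intro hno
    by_contra! hC
    obtain ⟨C, hC⟩ := hC
    refine hno ⟨_, a, ?_, ha.1, ⟨0, by simp⟩, AP_subset_U (N := a + ⌈C⌉₊) ha fun k hk => ?_⟩
    · positivity
    · obtain ⟨q, hq, hqd, hqC⟩ := hC k hk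
      have : q ≤ ⌈C⌉₊ := by exact_mod_cast hqC.trans (Nat.le_ceil C)
      exact ⟨q, hq, hqd, by omega⟩
  · rintro hC ⟨m, b, hm, -, ⟨h₀, hab⟩, hU⟩
    obtain ⟨k, hk, hdvd⟩ := hC m
    obtain ⟨p, h, hp, heq⟩ := exists_prime_add_two_pow_eq_mul_add hm
      fun p hp hpd => by exact_mod_cast hdvd p hp hpd
    refine (hU ⟨h + h₀, rfl⟩).2.2 ⟨p, k, hp, hk, ?_⟩
    rw [← heq, hab]
    ring
end

section
/- Let a be a positive integer that lies in some infinite arithmetic progression {mh + b : h = 0, 1, 2, …} (with m, b positive integers) contained in 𝒰. Then a lies in some infinite arithmetic progression contained in 𝒰 whose common difference is the product of a power of 2 and a squarefree odd integer. Consequently, the union of all infinite arithmetic progressions of positive odd integers contained in 𝒰 equals the union of those whose common difference is a power of 2 times a squarefree odd integer. -/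
open Filter

/-- By Dirichlet's theorem, every `a - 2 ^ k` shares an odd prime factor with the common difference
of a progression in `U` through `a`. -/
theorem exists_odd_prime_dvd_of_AP_subset_U {m a : ℕ} (hm : 0 < m) (hU : AP m a ⊆ U) {k : ℕ}
    (hk : 0 < k) : ∃ p : ℕ, p.Prime ∧ p ≠ 2 ∧ p ∣ m ∧ (p : ℤ) ∣ a - 2 ^ k := by
  have haU : a ∈ U := hU ⟨0, by simp⟩
  have hcop : ¬ IsCoprime ((a : ℤ) - 2 ^ k) m := by
    intro hc
    obtain ⟨q, hqa, hq, hmod⟩ := Nat.forall_exists_prime_gt_and_zmodEq a hm.ne' hc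
    have hpos : 0 < 2 ^ k := Nat.two_pow_pos k
    have hdvd : (m : ℤ) ∣ ((q + 2 ^ k - a : ℕ) : ℤ) := by
      rw [Nat.cast_sub (by omega)]
      have h := hmod.symm.dvd
      push_cast
      convert h using 1
      ring
    obtain ⟨h, hh⟩ := Int.natCast_dvd_natCast.mp hdvd
    exact (hU ⟨h, rfl⟩).2.2 ⟨q, k, hq, hk, by omega⟩
  rw [Int.isCoprime_iff_gcd_eq_one] at hcop
  obtain ⟨p, hp, hpd⟩ := Nat.exists_prime_and_dvd hcop
  have hpa : (p : ℤ) ∣ a - 2 ^ k := (Int.natCast_dvd_natCast.mpr hpd).trans (Int.gcd_dvd_left _ _)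
  have hpm : (p : ℤ) ∣ m := (Int.natCast_dvd_natCast.mpr hpd).trans (Int.gcd_dvd_right _ _)
  refine ⟨p, hp, ?_, Int.natCast_dvd_natCast.mp hpm, hpa⟩
  rintro rfl
  have h2 : (2 : ℤ) ∣ 2 ^ k := dvd_pow_self 2 hk.ne'
  have h2a : (2 : ℤ) ∣ a := by simpa using dvd_add hpa h2
  have := haU.2.1
  rw [Nat.odd_iff] at this
  omega

/-- If every `a - 2 ^ k` shares a prime factor with the odd number `s`, then the progression through
`a` with common difference `2 ^ j * s` lies in `U` for large `j`. -/
theorem AP_two_pow_mul_subset_U {a s : ℕ} (haU : a ∈ U) (hs : Odd s)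
    (hcov : ∀ k : ℕ, 0 < k → ∃ p : ℕ, p.Prime ∧ p ∣ s ∧ (p : ℤ) ∣ a - 2 ^ k) :
    AP (2 ^ (a + s + 1) * s) a ⊆ U := by
  rintro n ⟨h, rfl⟩
  refine ⟨by have := haU.1; omega, ?_, ?_⟩
  · refine Even.add_odd ?_ haU.2.1
    rw [pow_succ]
    exact ⟨2 ^ (a + s) * s * h, by ring⟩
  rintro ⟨q, k, hq, hk, hn⟩
  obtain ⟨p, hp, hps, hpa⟩ := hcov k hk
  have hqs : q ∣ s := by
    have h1 : (p : ℤ) ∣ q := by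
      have h2 : (q : ℤ) = 2 ^ (a + s + 1) * s * h + (a - 2 ^ k) := by
        have : (2 ^ (a + s + 1) * s * h + a : ℤ) = q + 2 ^ k := by exact_mod_cast hn
        linarith
      rw [h2]
      exact dvd_add (((Int.natCast_dvd_natCast.mpr hps).mul_left _).mul_right _) hpa
    rwa [← (Nat.prime_dvd_prime_iff_eq hp hq).mp (Int.natCast_dvd_natCast.mp h1)]
  have hqle : q ≤ s := Nat.le_of_dvd hs.pos hqs
  have hbig : a + s < 2 ^ (a + s) := Nat.lt_two_pow_self
  have hmod : a ≡ q + 2 ^ k [MOD 2 ^ (a + s + 1)] := by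
    rw [← hn, mul_assoc]
    simp [Nat.ModEq]
  have hdouble : 2 ^ (a + s + 1) = 2 * 2 ^ (a + s) := pow_succ' 2 (a + s)
  rcases lt_or_ge k (a + s + 1) with hkJ | hkJ
  · have hkle : 2 ^ k ≤ 2 ^ (a + s) := Nat.pow_le_pow_right two_pos (by omega)
    exact haU.2.2 ⟨q, k, hq, hk, hmod.eq_of_lt_of_lt (by omega) (by omega)⟩
  · have hkmod : 2 ^ k ≡ 0 [MOD 2 ^ (a + s + 1)] :=
      (Nat.modEq_zero_iff_dvd).mpr (pow_dvd_pow 2 hkJ)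
    have haq : a = q := (hmod.trans (hkmod.add_left q)).eq_of_lt_of_lt (by omega) (by omega)
    have hpow : 2 ^ (a + s + 1) * s * h = 2 ^ k := by omega
    have hq2 : q ∣ 2 ^ k := hpow ▸ (hqs.mul_left _).mul_right _
    have : q = 2 := (Nat.prime_dvd_prime_iff_eq hq Nat.prime_two).mp (hq.dvd_of_dvd_pow hq2)
    have hodd := haU.2.1
    rw [haq, this] at hodd
    exact absurd hodd (by decide)

theorem exists_AP_subset_U_two_pow_mul_squarefree {m b a : ℕ} (hm : 0 < m) (ha : a ∈ AP m b)
    (hU : AP m b ⊆ U) :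
    ∃ j s : ℕ, Squarefree s ∧ Odd s ∧ AP (2 ^ j * s) a ⊆ U := by
  have haU : AP m a ⊆ U := by
    obtain ⟨h, rfl⟩ := ha
    rintro n ⟨i, rfl⟩
    exact hU ⟨i + h, by ring⟩
  have hodd : Odd (∏ p ∈ m.primeFactors.erase 2, p) := by
    refine Finset.prod_induction _ Odd (fun _ _ => Odd.mul) odd_one fun p hp => ?_
    rw [Finset.mem_erase] at hp
    exact (Nat.prime_of_mem_primeFactors hp.2).odd_of_ne_two hp.1
  refine ⟨_, ∏ p ∈ m.primeFactors.erase 2, p, ?_, hodd,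
    AP_two_pow_mul_subset_U (haU ⟨0, by simp⟩) hodd fun k hk => ?_⟩
  · refine Squarefree.squarefree_of_dvd ?_ (UniqueFactorizationMonoid.squarefree_radical (a := m))
    rw [Nat.radical_eq_prod_primeFactors]
    exact Finset.prod_dvd_prod_of_subset _ _ _ (Finset.erase_subset _ _)
  · obtain ⟨p, hp, hp2, hpm, hpa⟩ := exists_odd_prime_dvd_of_AP_subset_U hm haU hk
    exact ⟨p, hp, Finset.dvd_prod_of_mem _ (by simp [hp, hp2, hpm, hm.ne']), hpa⟩

theorem stmt9 :
    (∀ a : ℕ, (∃ m b : ℕ, 0 < m ∧ 0 < b ∧ a ∈ AP m b ∧ AP m b ⊆ U) →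
      ∃ m b : ℕ, 0 < m ∧ 0 < b ∧ a ∈ AP m b ∧ AP m b ⊆ U ∧
        ∃ j s : ℕ, Squarefree s ∧ Odd s ∧ m = 2 ^ j * s) ∧
    {n : ℕ | ∃ m b : ℕ, 0 < m ∧ 0 < b ∧ AP m b ⊆ U ∧ n ∈ AP m b} =
      {n : ℕ | ∃ m b : ℕ, 0 < m ∧ 0 < b ∧ AP m b ⊆ U ∧
        (∃ j s : ℕ, Squarefree s ∧ Odd s ∧ m = 2 ^ j * s) ∧ n ∈ AP m b} := by
  have key : ∀ a : ℕ, (∃ m b : ℕ, 0 < m ∧ 0 < b ∧ a ∈ AP m b ∧ AP m b ⊆ U) →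
      ∃ m b : ℕ, 0 < m ∧ 0 < b ∧ a ∈ AP m b ∧ AP m b ⊆ U ∧
        ∃ j s : ℕ, Squarefree s ∧ Odd s ∧ m = 2 ^ j * s := by
    rintro a ⟨m, b, hm, -, ha, hU⟩
    obtain ⟨j, s, hsq, hodd, hsub⟩ := exists_AP_subset_U_two_pow_mul_squarefree hm ha hU
    exact ⟨2 ^ j * s, a, Nat.mul_pos (by positivity) hodd.pos, (hU ha).1, ⟨0, by simp⟩, hsub,
      j, s, hsq, hodd, rfl⟩
  refine ⟨key, Set.ext fun n => ⟨?_, ?_⟩⟩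
  · rintro ⟨m, b, hm, hb, hU, hn⟩
    obtain ⟨m', b', hm', hb', hn', hU', hform⟩ := key n ⟨m, b, hm, hb, hn, hU⟩
    exact ⟨m', b', hm', hb', hU', hform, hn'⟩
  · rintro ⟨m, b, hm, hb, hU, -, hn⟩
    exact ⟨m, b, hm, hb, hU, hn⟩
end

section
/- Assume that there are infinitely many Mersenne primes, i.e., for every N there is a prime of the form 2^r − 1 exceeding N. Let a be a positive integer that lies in some infinite arithmetic progression {mh + b : h = 0, 1, 2, …} (with m, b positive integers) contained in 𝒰. Then a lies in some infinite arithmetic progression contained in 𝒰 whose common difference is a squarefree integer. Consequently, under this assumption, the union of all infinite arithmetic progressions of positive odd integers contained in 𝒰 equals the union of those whose common difference is squarefree. -/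
open Filter

lemma pos_odd_of_AP_subset {m a : ℕ} (h : AP m a ⊆ U) : 0 < a ∧ Odd a ∧ 2 ∣ m := by
  have h0 : a ∈ U := h ⟨0, by simp⟩
  have h1 : m * 1 + a ∈ U := h ⟨1, rfl⟩
  refine ⟨h0.1, h0.2.1, ?_⟩
  obtain ⟨x, hx⟩ := h0.2.1
  obtain ⟨y, hy⟩ := h1.2.1
  omega

lemma AP_subset_AP {m a b : ℕ} (ha : a ∈ AP m b) : AP m a ⊆ AP m b := by
  obtain ⟨h, rfl⟩ := ha
  rintro n ⟨t, rfl⟩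
  exact ⟨t + h, by ring⟩

lemma exists_prime_dvd_of_AP_subset {m a k : ℕ} (hm : 0 < m) (h : AP m a ⊆ U) (hk : 0 < k) :
    ∃ p : ℕ, p.Prime ∧ p ∣ m ∧ a ≡ 2 ^ k [MOD p] := by
  by_contra! hp
  have hcop : IsCoprime ((a : ℤ) - 2 ^ k) m := by
    rw [Int.isCoprime_iff_gcd_eq_one]
    by_contra hg
    obtain ⟨p, hpp, hpd⟩ := Nat.exists_prime_and_dvd hg
    have h1 : (p : ℤ) ∣ (a : ℤ) - 2 ^ k :=
      (Int.natCast_dvd_natCast.2 hpd).trans (Int.gcd_dvd_left _ _)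
    have h2 : (p : ℤ) ∣ m := (Int.natCast_dvd_natCast.2 hpd).trans (Int.gcd_dvd_right _ _)
    refine hp p hpp (Int.natCast_dvd_natCast.1 h2) (Nat.ModEq.symm ?_)
    rw [Nat.modEq_iff_dvd]
    exact_mod_cast h1
  obtain ⟨p, hpa, hpp, hmod⟩ := Nat.forall_exists_prime_gt_and_zmodEq a hm.ne' hcop
  have hle : a ≤ p + 2 ^ k := hpa.le.trans (Nat.le_add_right _ _)
  obtain ⟨t, ht⟩ : m ∣ p + 2 ^ k - a := by
    refine (Nat.modEq_iff_dvd' hle).1 (Nat.ModEq.symm ?_)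
    rw [← Int.natCast_modEq_iff]
    push_cast
    simpa using hmod.add_right (2 ^ k)
  exact (h ⟨t, by omega⟩ : p + 2 ^ k ∈ U).2.2 ⟨p, k, hpp, hk, rfl⟩

lemma add_two_pow_mod_eq {r p a k : ℕ} (hr : 0 < r) (hp : 2 * p + 1 < 2 ^ r - 1)
    (ha : a < 2 ^ r - 1) (h : p + 2 ^ k ≡ a [MOD 2 ^ r - 1]) : p + 2 ^ (k % r) = a := by
  have h1 : 2 ^ r ≡ 1 [MOD 2 ^ r - 1] :=
    ((Nat.modEq_iff_dvd' Nat.one_le_two_pow).2 dvd_rfl).symm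
  have h2 : 2 ^ k ≡ 2 ^ (k % r) [MOD 2 ^ r - 1] := by
    conv_lhs => rw [← Nat.div_add_mod k r, pow_add, pow_mul]
    simpa using (h1.pow (k / r)).mul_right (2 ^ (k % r))
  have h3 : 2 ^ (k % r) * 2 ≤ 2 ^ r := by
    rw [← pow_succ]
    exact Nat.pow_le_pow_right two_pos (Nat.mod_lt k hr)
  exact ((h2.add_left p).symm.trans h).eq_of_lt_of_lt (by omega) ha

lemma exists_squarefree_AP_subset
    (hMersenne : ∀ N : ℕ, ∃ r : ℕ, 0 < r ∧ Nat.Prime (2 ^ r - 1) ∧ N < 2 ^ r - 1)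
    {m a : ℕ} (hm : 0 < m) (h : AP m a ⊆ U) :
    ∃ M : ℕ, 0 < M ∧ Squarefree M ∧ AP M a ⊆ U := by
  obtain ⟨ha, hodd, h2m⟩ := pos_odd_of_AP_subset h
  obtain ⟨r, hr, hq, hlarge⟩ := hMersenne (2 * m + a + 1)
  set R := UniqueFactorizationMonoid.radical m
  have hdvd {p : ℕ} (hp : p.Prime) (hpm : p ∣ m) : p ∣ R :=
    (UniqueFactorizationMonoid.dvd_radical_iff_of_irreducible hp hm.ne').2 hpm
  have hRm : R ∣ m := UniqueFactorizationMonoid.radical_dvd_self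
  have hsq : Squarefree (R * (2 ^ r - 1)) := by
    refine (Nat.squarefree_mul ?_).2
      ⟨UniqueFactorizationMonoid.squarefree_radical, hq.prime.squarefree⟩
    refine ((Nat.Prime.coprime_iff_not_dvd hq).2 fun hd => ?_).symm
    have := Nat.le_of_dvd hm (hd.trans hRm)
    omega
  refine ⟨R * (2 ^ r - 1), Nat.pos_of_ne_zero hsq.ne_zero, hsq, ?_⟩
  rintro n ⟨t, rfl⟩
  have h2 : 2 ∣ R * (2 ^ r - 1) * t := ((hdvd Nat.prime_two h2m).mul_right _).mul_right _
  refine ⟨by omega, (even_iff_two_dvd.2 h2).add_odd hodd, ?_⟩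
  rintro ⟨s, k, hs, hk, hsk⟩
  obtain ⟨p, hp, hpm, hpk⟩ := exists_prime_dvd_of_AP_subset hm h hk
  have hps : p = s := by
    refine (Nat.prime_dvd_prime_iff_eq hp hs).1 (Nat.modEq_zero_iff_dvd.1 ?_)
    refine Nat.ModEq.add_right_cancel' (2 ^ k) ?_
    rw [← hsk, zero_add]
    refine Nat.ModEq.trans ?_ hpk
    simpa using (Nat.modEq_zero_iff_dvd.2
      (((hdvd hp hpm).mul_right (2 ^ r - 1)).mul_right t)).add_right a
  subst hps
  have hpm' := Nat.le_of_dvd hm hpm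
  have hmod : p + 2 ^ k ≡ a [MOD 2 ^ r - 1] := by
    rw [← hsk]
    simpa using (Nat.modEq_zero_iff_dvd.2
      ((dvd_mul_left (2 ^ r - 1) R).mul_right t)).add_right a
  have heq := add_two_pow_mod_eq hr (by omega) (by omega) hmod
  rcases Nat.eq_zero_or_pos (k % r) with h0 | h0
  · rw [h0, pow_zero] at heq
    have hp2 : p = 2 := (Nat.prime_dvd_prime_iff_eq Nat.prime_two hp).1 (by
      obtain ⟨x, hx⟩ := hodd
      omega) |>.symm
    subst hp2
    have : a % 2 = 2 ^ k % 2 := hpk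
    have h2k : 2 ∣ 2 ^ k := dvd_pow_self 2 hk.ne'
    obtain ⟨x, hx⟩ := hodd
    omega
  · exact (h ⟨0, by simp⟩ : a ∈ U).2.2 ⟨p, k % r, hp, h0, heq.symm⟩

theorem stmt10
    (hMersenne : ∀ N : ℕ, ∃ r : ℕ, 0 < r ∧ Nat.Prime (2 ^ r - 1) ∧ N < 2 ^ r - 1) :
    (∀ a : ℕ, (∃ m b : ℕ, 0 < m ∧ 0 < b ∧ a ∈ AP m b ∧ AP m b ⊆ U) →
      ∃ m b : ℕ, 0 < m ∧ 0 < b ∧ a ∈ AP m b ∧ AP m b ⊆ U ∧ Squarefree m) ∧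
    {n : ℕ | ∃ m b : ℕ, 0 < m ∧ 0 < b ∧ AP m b ⊆ U ∧ n ∈ AP m b} =
      {n : ℕ | ∃ m b : ℕ, 0 < m ∧ 0 < b ∧ AP m b ⊆ U ∧ Squarefree m ∧ n ∈ AP m b} := by
  have key : ∀ a : ℕ, (∃ m b : ℕ, 0 < m ∧ 0 < b ∧ a ∈ AP m b ∧ AP m b ⊆ U) →
      ∃ m b : ℕ, 0 < m ∧ 0 < b ∧ a ∈ AP m b ∧ AP m b ⊆ U ∧ Squarefree m := by
    rintro a ⟨m, b, hm, -, hab, hsub⟩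
    obtain ⟨M, hM, hsq, hMsub⟩ :=
      exists_squarefree_AP_subset hMersenne hm ((AP_subset_AP hab).trans hsub)
    exact ⟨M, a, hM, (pos_odd_of_AP_subset hMsub).1, ⟨0, by simp⟩, hMsub, hsq⟩
  refine ⟨key, Set.ext fun n => ⟨?_, ?_⟩⟩
  · rintro ⟨m, b, hm, hb, hsub, hn⟩
    obtain ⟨M, c, hM, hc, hnc, hMsub, hsq⟩ := key n ⟨m, b, hm, hb, hn, hsub⟩
    exact ⟨M, c, hM, hc, hMsub, hsq, hnc⟩
  · rintro ⟨m, b, hm, hb, hsub, -, hn⟩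
    exact ⟨m, b, hm, hb, hsub, hn⟩
end

section
/- Each of the numbers 1, 3 and 127 belongs to 𝒰, and none of them lies in any infinite arithmetic progression {mh + b : h = 0, 1, 2, …} (with m, b positive integers) that is contained in 𝒰. -/
open Filter

/-- If `a - 2 ^ k` is invertible modulo `m`, then, by Dirichlet's theorem, every progression with
difference `m` through `a` contains a number of the form `p + 2 ^ k` with `p` prime. -/
theorem not_AP_subset_U_of_isUnit {a m b k : ℕ} (hm : 0 < m) (hk : 0 < k)
    (ha : a ∈ AP m b) (hu : IsUnit ((a : ZMod m) - 2 ^ k)) : ¬ AP m b ⊆ U := by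
  intro hsub
  have hpos := Nat.two_pow_pos k
  have : NeZero m := ⟨hm.ne'⟩
  obtain ⟨p, hpa, hp, hpm⟩ := Nat.forall_exists_prime_gt_and_eq_mod hu a
  have hmod : a ≡ p + 2 ^ k [MOD m] := by
    rw [← ZMod.natCast_eq_natCast_iff]
    push_cast
    rw [hpm]
    ring
  obtain ⟨d, hd⟩ := (Nat.modEq_iff_dvd' (by omega)).mp hmod
  obtain ⟨h, rfl⟩ := ha
  have hmem : p + 2 ^ k ∈ AP m b := ⟨h + d, by rw [mul_add]; omega⟩
  exact (hsub hmem).2.2 ⟨p, k, hp, hk, rfl⟩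

theorem one_mem_U : 1 ∈ U := by
  refine ⟨by norm_num, by decide, ?_⟩
  rintro ⟨p, k, hp, -, h⟩
  have := Nat.two_pow_pos k
  have := hp.two_le
  omega

theorem three_mem_U : 3 ∈ U := by
  refine ⟨by norm_num, by decide, ?_⟩
  rintro ⟨p, k, hp, hk, h⟩
  have := hp.two_le
  have : 2 ^ 1 ≤ 2 ^ k := Nat.pow_le_pow_right (by norm_num) hk
  omega

theorem one_hundred_twenty_seven_mem_U : 127 ∈ U := by
  refine ⟨by norm_num, by decide, ?_⟩
  rintro ⟨p, k, hp, hk, h⟩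
  have hk7 : k < 7 := by
    by_contra! hk7
    have : 2 ^ 7 ≤ 2 ^ k := Nat.pow_le_pow_right (by norm_num) hk7
    omega
  obtain rfl : p = 127 - 2 ^ k := by omega
  interval_cases k <;> norm_num at hp

theorem stmt11 :
    ∀ a ∈ ({1, 3, 127} : Set ℕ),
      a ∈ U ∧ ¬ ∃ m b : ℕ, 0 < m ∧ 0 < b ∧ a ∈ AP m b ∧ AP m b ⊆ U := by
  rintro a (rfl | rfl | rfl)
  · refine ⟨one_mem_U, fun ⟨m, b, hm, _, ha, hsub⟩ => ?_⟩
    refine not_AP_subset_U_of_isUnit hm one_pos ha ?_ hsub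
    convert (isUnit_one (M := ZMod m)).neg using 1
    push_cast
    ring
  · refine ⟨three_mem_U, fun ⟨m, b, hm, _, ha, hsub⟩ => ?_⟩
    refine not_AP_subset_U_of_isUnit hm one_pos ha ?_ hsub
    convert isUnit_one (M := ZMod m) using 1
    push_cast
    ring
  · refine ⟨one_hundred_twenty_seven_mem_U, fun ⟨m, b, hm, _, ha, hsub⟩ => ?_⟩
    refine not_AP_subset_U_of_isUnit hm (k := 7) (by norm_num) ha ?_ hsub
    convert (isUnit_one (M := ZMod m)).neg using 1
    push_cast
    ring
end

section
/- Let m, a, m₀, a₀ be positive integers and let W be a set of positive integers of asymptotic density zero. If {mh + a : h = 0, 1, 2, …} ⊆ {m₀h + a₀ : h = 0, 1, 2, …} ∪ W, then m₀ divides m and m₀ divides a − a₀. -/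
open Filter

/-- An infinite arithmetic progression of positive integers is not contained in a set of
asymptotic density zero. -/
theorem DensityZero.not_AP_subset {W : Set ℕ} (hW : DensityZero W) {d b : ℕ} (hd : 0 < d)
    (hb : 0 < b) : ¬ AP d b ⊆ W := by
  intro hsub
  have hpos : (0 : ℝ) < 1 / ((d + b : ℕ) : ℝ) := by positivity
  have htend : Tendsto (fun n : ℕ => (d + b) * n) atTop atTop :=
    tendsto_id.const_mul_atTop' (by omega)
  obtain ⟨n, hlt, hn⟩ :=
    (((hW.comp htend).eventually (gt_mem_nhds hpos)).and (eventually_ge_atTop 1)).exists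
  have hcard : n ≤ Nat.card ↥(W ∩ Set.Icc 1 ((d + b) * n)) := by
    have hinj : Function.Injective fun h : ℕ => d * h + b := fun x y hxy =>
      Nat.eq_of_mul_eq_mul_left hd (Nat.add_right_cancel hxy)
    have himage : (((Finset.range n).image fun h => d * h + b : Finset ℕ) : Set ℕ) ⊆
        W ∩ Set.Icc 1 ((d + b) * n) := by
      intro x hx
      simp only [Finset.coe_image, Finset.coe_range, Set.mem_image, Set.mem_Iio] at hx
      obtain ⟨h, hh, rfl⟩ := hx
      refine ⟨hsub ⟨h, rfl⟩, by omega, ?_⟩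
      nlinarith [Nat.mul_le_mul_left d hh.le, Nat.mul_le_mul_left b hn]
    have hle := Set.ncard_le_ncard himage ((Set.finite_Icc _ _).inter_of_right _)
    rwa [Set.ncard_coe_finset, Finset.card_image_of_injective _ hinj, Finset.card_range] at hle
  have hn' : (0 : ℝ) < n := by exact_mod_cast hn
  have hdb : (0 : ℝ) < ((d + b : ℕ) : ℝ) := by positivity
  have hcard' : (n : ℝ) ≤ (Nat.card ↥(W ∩ Set.Icc 1 ((d + b) * n)) : ℝ) := by
    exact_mod_cast hcard
  simp only [Function.comp_apply, Nat.cast_mul] at hlt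
  rw [div_lt_div_iff₀ (by positivity) hdb] at hlt
  nlinarith

theorem stmt12 (m a m₀ a₀ : ℕ) (hm : 0 < m) (ha : 0 < a) (hm₀ : 0 < m₀) (ha₀ : 0 < a₀)
    (W : Set ℕ) (hWpos : ∀ n ∈ W, 0 < n) (hWd : DensityZero W)
    (h : AP m a ⊆ AP m₀ a₀ ∪ W) :
    m₀ ∣ m ∧ (m₀ : ℤ) ∣ (a : ℤ) - (a₀ : ℤ) := by
  have key : ∀ k : ℕ, (m₀ : ℤ) ∣ (a : ℤ) + m * k - a₀ := by
    intro k
    obtain ⟨x, ⟨j, rfl⟩, hxW⟩ := Set.not_subset.mp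
      (hWd.not_AP_subset (Nat.mul_pos hm hm₀) (Nat.add_pos_left ha (m * k)))
    obtain ⟨i, hi⟩ | hw := h (show m * m₀ * j + (a + m * k) ∈ AP m a from ⟨m₀ * j + k, by ring⟩)
    · have hi' : (m : ℤ) * m₀ * j + (a + m * k) = m₀ * i + a₀ := by exact_mod_cast hi
      exact ⟨i - m * j, by linear_combination hi'⟩
    · exact absurd hw hxW
  have h0 : (m₀ : ℤ) ∣ (a : ℤ) - a₀ := by simpa using key 0
  refine ⟨?_, h0⟩
  have hdiff := dvd_sub (key 1) h0
  have heq : (a : ℤ) + m * (1 : ℕ) - a₀ - (a - a₀) = m := by push_cast; ring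
  rw [heq] at hdiff
  exact_mod_cast hdiff
end

section
/- Every member of the arithmetic progression {11184810 s + 992077 : s = 0, 1, 2, …} belongs to 𝒰; that is, no integer of the form 11184810 s + 992077 with s ≥ 0 can be written as p + 2^k with p a prime and k a positive integer. -/
open Filter

theorem two_pow_add_one_modEq (n : ℕ) :
    2 ^ (n + 1) ≡ 2 ^ (n % 24 + 1) [MOD 11184810] := by
  induction n using Nat.strong_induction_on with
  | _ n ih =>
    by_cases h : n < 24
    · rw [Nat.mod_eq_of_lt h]
    · obtain ⟨m, rfl⟩ : ∃ m, n = m + 24 := ⟨n - 24, by omega⟩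
      rw [Nat.add_mod_right]
      refine Nat.ModEq.trans ?_ (ih m (by omega))
      have hperiod : 2 ^ 25 ≡ 2 [MOD 11184810] := by decide
      have hmul := hperiod.mul_left (2 ^ m)
      rwa [← pow_add, ← pow_succ] at hmul

/-- The congruences `k ≡ t + 1 [MOD 24]` are covered by primes `q` dividing `992077 - 2 ^ k`,
none of which can itself be the prime summand. -/
theorem exists_covering_prime : ∀ t < 24, ∃ q ∈ [3, 5, 7, 13, 17, 241],
    q ≠ 1 ∧ q ∣ 11184810 ∧ 992077 ≡ 2 ^ (t + 1) [MOD q] ∧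
      ¬ 992077 ≡ q + 2 ^ (t + 1) [MOD 11184810] := by
  decide

theorem stmt13 : ∀ s : ℕ, 11184810 * s + 992077 ∈ U := by
  intro s
  refine ⟨by omega, ⟨5592405 * s + 496038, by ring⟩, ?_⟩
  rintro ⟨p, k, hp, hk, h⟩
  obtain ⟨n, rfl⟩ : ∃ n, k = n + 1 := ⟨k - 1, by omega⟩
  obtain ⟨q, -, hq_ne_one, hqM, hcong, hne⟩ :=
    exists_covering_prime (n % 24) (Nat.mod_lt _ (by norm_num))
  have hpow := two_pow_add_one_modEq n
  have hsum : 992077 ≡ p + 2 ^ (n % 24 + 1) [MOD 11184810] := by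
    have hprog : 992077 ≡ 11184810 * s + 992077 [MOD 11184810] := by
      simp [Nat.ModEq]
    rw [h] at hprog
    exact hprog.trans (hpow.add_left p)
  have hzero : p + 2 ^ (n % 24 + 1) ≡ 0 + 2 ^ (n % 24 + 1) [MOD q] := by
    rw [zero_add]
    exact (hsum.of_dvd hqM).symm.trans hcong
  have hdvd : q ∣ p := (Nat.modEq_zero_iff_dvd).1 (Nat.ModEq.add_right_cancel' _ hzero)
  obtain rfl := (hp.eq_one_or_self_of_dvd q hdvd).resolve_left hq_ne_one
  exact hne hsum
end

section
/- Every member of the arithmetic progression {11184810 s + 3292241 : s = 0, 1, 2, …} belongs to 𝒰; that is, no integer of the form 11184810 s + 3292241 with s ≥ 0 can be written as p + 2^k with p a prime and k a positive integer. -/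
open Filter

/-- Modulo `11184810 = 2 * 3 * 5 * 7 * 13 * 17 * 241`, positive powers of `2` have period `24`. -/
lemma two_pow_mod_period (k : ℕ) (hk : 0 < k) :
    ∃ r < 24, 2 ^ k ≡ 2 ^ (r + 1) [MOD 11184810] := by
  refine ⟨(k - 1) % 24, Nat.mod_lt _ (by norm_num), ?_⟩
  have h : ∀ t r : ℕ, 2 ^ (24 * t + (r + 1)) ≡ 2 ^ (r + 1) [MOD 11184810] := by
    intro t r
    induction t with
    | zero => simp [Nat.ModEq]
    | succ t ih =>
      refine Nat.ModEq.trans ?_ ih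
      have h25 : 2 ^ 25 ≡ 2 [MOD 11184810] := by decide
      have := h25.mul_right (2 ^ (24 * t + r))
      convert this using 1 <;> ring
  have := h ((k - 1) / 24) ((k - 1) % 24)
  rwa [show 24 * ((k - 1) / 24) + ((k - 1) % 24 + 1) = k by omega] at this

theorem stmt14 : ∀ s : ℕ, 11184810 * s + 3292241 ∈ U := by
  intro s
  refine ⟨by omega, ⟨5592405 * s + 1646120, by ring⟩, ?_⟩
  rintro ⟨p, k, hp, hk, h⟩
  obtain ⟨r, hr, hpow⟩ := two_pow_mod_period k hk
  have dvd_eq : ∀ q, q ≠ 1 → q ∣ p → p = q := fun q hq hd =>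
    ((hp.eq_one_or_self_of_dvd q hd).resolve_left hq).symm
  have h3 := dvd_eq 3 (by norm_num)
  have h5 := dvd_eq 5 (by norm_num)
  have h7 := dvd_eq 7 (by norm_num)
  have h13 := dvd_eq 13 (by norm_num)
  have h17 := dvd_eq 17 (by norm_num)
  have h241 := dvd_eq 241 (by norm_num)
  clear dvd_eq
  generalize 2 ^ k = x at h hpow
  unfold Nat.ModEq at hpow
  interval_cases r <;> norm_num at hpow <;> omega
end

section
/- Let m₁, …, m_t be positive integers and a₁, …, a_t integers such that every integer is congruent to a_i modulo m_i for some 1 ≤ i ≤ t. Let p be a prime. If the set {a_i : 1 ≤ i ≤ t, p ∣ m_i} does not contain a complete residue system modulo p, then the subsequence of those m_i with p ∤ m_i is coverable, i.e., there exist integers b_i (for the indices i with p ∤ m_i) such that every integer is congruent to b_i modulo m_i for some i with p ∤ m_i. In particular, if the sequence m₁, …, m_t is coverable and the number of indices i with p ∣ m_i is less than p, then the subsequence of those m_i with p ∤ m_i is coverable. -/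
/-- If the residue class of `c` modulo `p` avoids all `a i` with `p ∣ m i`, then rescaling the
covering restricted to this class gives a covering by the moduli prime to `p`. -/
theorem exists_cover_of_not_modEq {ι : Type*} (m : ι → ℕ) (a : ι → ℤ) (p : ℕ) (hp : p.Prime)
    (h : ∀ n : ℤ, ∃ i, n ≡ a i [ZMOD (m i : ℤ)])
    (c : ℤ) (hc : ∀ i, p ∣ m i → ¬ c ≡ a i [ZMOD (p : ℤ)]) :
    ∃ b : ι → ℤ, ∀ n : ℤ, ∃ i, ¬ p ∣ m i ∧ n ≡ b i [ZMOD (m i : ℤ)] := by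
  refine ⟨fun i => Nat.gcdA p (m i) * (a i - c), fun n => ?_⟩
  obtain ⟨i, hi⟩ := h (c + p * n)
  have hpi : ¬ p ∣ m i := fun hd => hc i hd <| by
    have h1 : c + p * n ≡ a i [ZMOD (p : ℤ)] := hi.of_dvd (Int.natCast_dvd_natCast.2 hd)
    have h2 : c ≡ c + p * n [ZMOD (p : ℤ)] := Int.modEq_iff_dvd.2 ⟨n, by ring⟩
    exact h2.trans h1
  refine ⟨i, hpi, ?_⟩
  have bezout := Nat.gcd_eq_gcd_ab p (m i)
  rw [Nat.Coprime.gcd_eq_one ((Nat.Prime.coprime_iff_not_dvd hp).2 hpi), Nat.cast_one] at bezout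
  obtain ⟨k, hk⟩ := Int.modEq_iff_dvd.1 hi
  refine Int.modEq_iff_dvd.2 ⟨Nat.gcdA p (m i) * k - Nat.gcdB p (m i) * n, ?_⟩
  linear_combination Nat.gcdA p (m i) * hk - n * bezout

/-- Fewer than `p` integers miss some residue class modulo `p`. -/
theorem exists_not_modEq_of_card_lt {ι : Type*} (s : Finset ι) (a : ι → ℤ) (p : ℕ) [NeZero p]
    (hs : s.card < p) : ∃ c : ℤ, ∀ i ∈ s, ¬ c ≡ a i [ZMOD (p : ℤ)] := by
  have hlt : (s.image fun i => (a i : ZMod p)).card < (Finset.univ : Finset (ZMod p)).card := by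
    rw [Finset.card_univ, ZMod.card]
    exact Finset.card_image_le.trans_lt hs
  obtain ⟨x, -, hx⟩ := Finset.exists_mem_notMem_of_card_lt_card hlt
  obtain ⟨c, rfl⟩ := ZMod.intCast_surjective x
  exact ⟨c, fun i hi hci =>
    hx (Finset.mem_image.2 ⟨i, hi, ((ZMod.intCast_eq_intCast_iff _ _ _).2 hci).symm⟩)⟩


theorem stmt15 :
    (∀ (t : ℕ) (m : Fin t → ℕ) (a : Fin t → ℤ) (p : ℕ),
      (∀ i, 0 < m i) → p.Prime →
      (∀ n : ℤ, ∃ i, n ≡ a i [ZMOD (m i : ℤ)]) →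
      (∃ c : ℤ, ∀ i, p ∣ m i → ¬ c ≡ a i [ZMOD (p : ℤ)]) →
      ∃ b : Fin t → ℤ, ∀ n : ℤ, ∃ i, ¬ p ∣ m i ∧ n ≡ b i [ZMOD (m i : ℤ)]) ∧
    (∀ (t : ℕ) (m : Fin t → ℕ) (p : ℕ),
      (∀ i, 0 < m i) → p.Prime →
      (∃ a : Fin t → ℤ, ∀ n : ℤ, ∃ i, n ≡ a i [ZMOD (m i : ℤ)]) →
      (Finset.univ.filter fun i => p ∣ m i).card < p →
      ∃ b : Fin t → ℤ, ∀ n : ℤ, ∃ i, ¬ p ∣ m i ∧ n ≡ b i [ZMOD (m i : ℤ)]) := by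
  refine ⟨fun t m a p _ hp h ⟨c, hc⟩ => exists_cover_of_not_modEq m a p hp h c hc,
    fun t m p _ hp ⟨a, h⟩ hcard => ?_⟩
  have : NeZero p := ⟨hp.ne_zero⟩
  obtain ⟨c, hc⟩ := exists_not_modEq_of_card_lt _ a p hcard
  exact exists_cover_of_not_modEq m a p hp h c fun i hi =>
    hc i (Finset.mem_filter.2 ⟨Finset.mem_univ i, hi⟩)
end

section
/- Let p₁, …, p_t be distinct odd primes forming a well constructed prime set, i.e., the sequence r_{p₁}, …, r_{p_t} of multiplicative orders of 2 modulo p₁, …, p_t is coverable. Then t ≥ 6 and p₁⋯p_t ≥ 5592405. Furthermore, t = 6 if and only if p₁⋯p_t = 5592405. -/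
open Finset

theorem exists_subset_card_eq_of_uniquely_covered {ι τ : Type*} [DecidableEq ι]
    {S : Finset ι} {a : ι → ℤ} {m : ι → ℕ}
    (hcov : ∀ n : ℤ, ∃ i ∈ S, n ≡ a i [ZMOD m i]) {k : ι} {x : ℤ}
    (hxk : x ≡ a k [ZMOD m k]) (hx : ∀ i ∈ S, x ≡ a i [ZMOD m i] → i = k)
    (T : Finset τ) (y : τ → ℕ) (hk : ∀ s ∈ T, ¬ m k ∣ y s)
    (hsep : ∀ s ∈ T, ∀ s' ∈ T, ∀ i ∈ S, y s ≡ y s' [MOD m i] → ¬ m i ∣ y s → s = s') :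
    ∃ R ⊆ S.erase k, #R = #T ∧ ∀ i ∈ R, ∃ s ∈ T, ¬ m i ∣ y s := by
  choose g hgS hg using fun s => hcov (x + y s)
  have hgk : ∀ s ∈ T, g s ≠ k := by
    intro s hs h
    have h1 := hg s
    rw [h] at h1
    have h2 := (h1.trans hxk.symm).symm.dvd
    rw [add_sub_cancel_left] at h2
    exact hk s hs (Int.natCast_dvd_natCast.mp h2)
  have hnd : ∀ s ∈ T, ¬ m (g s) ∣ y s := by
    intro s hs h
    refine hgk s hs (hx _ (hgS s) (Int.ModEq.trans ?_ (hg s)))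
    refine Int.modEq_iff_dvd.mpr ?_
    rw [add_sub_cancel_left]
    exact Int.natCast_dvd_natCast.mpr h
  refine ⟨T.image g, image_subset_iff.mpr fun s hs => mem_erase.mpr ⟨hgk s hs, hgS s⟩,
    card_image_of_injOn ?_, forall_mem_image.mpr fun s hs => ⟨s, hs, hnd s hs⟩⟩
  intro s hs s' hs' h
  refine hsep s hs s' hs' (g s) (hgS s) ?_ (hnd s hs)
  have h1 := hg s'
  rw [← h] at h1
  exact Int.natCast_modEq_iff.mp (Int.ModEq.add_left_cancel' x ((hg s).trans h1.symm))

/-- The numbers `j * p ^ b * N / p ^ (v_p N)`. -/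
def offset (N p b j : ℕ) : ℕ := j * p ^ b * ordCompl[p] N

theorem pow_succ_not_dvd_offset {N p b j : ℕ} (hN : N ≠ 0) (hp : p.Prime) (hj : j ∈ Ico 1 p) :
    ¬ p ^ (b + 1) ∣ offset N p b j := by
  rw [mem_Ico] at hj
  intro h
  rw [offset] at h
  have h1 := ((Nat.coprime_ordCompl hp hN).pow_left (b + 1)).dvd_of_dvd_mul_right h
  rw [pow_succ, mul_comm j, Nat.mul_dvd_mul_iff_left (pow_pos hp.pos b)] at h1
  exact absurd (Nat.le_of_dvd (by omega) h1) (by omega)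

theorem not_dvd_offset_iff {N m p b j : ℕ} (hN : N ≠ 0) (hm : m ∣ N) (hp : p.Prime)
    (hj : j ∈ Ico 1 p) : ¬ m ∣ offset N p b j ↔ p ^ (b + 1) ∣ m := by
  refine ⟨fun h => ?_, fun h h' => pow_succ_not_dvd_offset hN hp hj (h.trans h')⟩
  have hm0 : m ≠ 0 := ne_zero_of_dvd_ne_zero hN hm
  rw [hp.pow_dvd_iff_le_factorization hm0]
  by_contra! hlt
  apply h
  rw [← Nat.ordProj_mul_ordCompl_eq_self m p, offset]
  exact mul_dvd_mul (dvd_mul_of_dvd_right (pow_dvd_pow p (by omega)) j)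
    (Nat.ordCompl_dvd_ordCompl_of_dvd hm p)

theorem pow_dvd_offset_of_ne {N p q e c l : ℕ} (hp : p.Prime) (hq : q.Prime)
    (hpq : p ≠ q) (h : p ^ e ∣ N) : p ^ e ∣ offset N q c l := by
  refine dvd_mul_of_dvd_right ?_ _
  rw [← Nat.ordProj_mul_ordCompl_eq_self N q] at h
  exact (((Nat.coprime_primes hp hq).mpr hpq).pow e _).dvd_of_dvd_mul_left h

theorem offset_separated {N m p b j q c l : ℕ} (hN : N ≠ 0) (hm : m ∣ N) (hp : p.Prime)
    (hj : j ∈ Ico 1 p) (hq : q.Prime) (hl : l ∈ Ico 1 q)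
    (h : offset N p b j ≡ offset N q c l [MOD m]) (hnd : ¬ m ∣ offset N p b j) :
    p = q ∧ b = c ∧ j = l := by
  have hpm := (not_dvd_offset_iff hN hm hp hj).mp hnd
  have hqm : q ^ (c + 1) ∣ m :=
    (not_dvd_offset_iff hN hm hq hl).mp fun h' => hnd ((h.dvd_iff dvd_rfl).mpr h')
  by_cases hpq : p = q
  swap
  · exact absurd ((h.dvd_iff hpm).mpr (pow_dvd_offset_of_ne hp hq hpq (hpm.trans hm)))
      (pow_succ_not_dvd_offset hN hp hj)
  subst hpq
  have key : ∀ {b c j}, b < c → p ^ (b + 1) ∣ offset N p c j := fun hbc =>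
    dvd_mul_of_dvd_left (dvd_mul_of_dvd_right (pow_dvd_pow p hbc) _) _
  rcases lt_trichotomy b c with hbc | rfl | hbc
  · exact absurd ((h.dvd_iff hpm).mpr (key hbc)) (pow_succ_not_dvd_offset hN hp hj)
  · refine ⟨rfl, rfl, ?_⟩
    have h1 := h.of_dvd hpm
    unfold offset at h1
    have h2 := Nat.ModEq.cancel_right_of_coprime
      ((Nat.coprime_ordCompl hp hN).pow_left (b + 1)) h1
    rw [mul_comm j, mul_comm l, pow_succ] at h2
    have h3 := Nat.ModEq.mul_left_cancel' (pow_pos hp.pos b).ne' h2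
    rw [mem_Ico] at hj hl
    exact h3.eq_of_lt_of_lt hj.2 hl.2
  · exact absurd ((h.dvd_iff hqm).mp (key hbc)) (pow_succ_not_dvd_offset hN hp hl)

/-- A finite family of residue classes covers the integers and no class can be omitted. -/
structure IrredundantCover {ι : Type*} (S : Finset ι) (a : ι → ℤ) (m : ι → ℕ) : Prop where
  covers : ∀ n : ℤ, ∃ i ∈ S, n ≡ a i [ZMOD m i]
  irredundant : ∀ k ∈ S, ∃ x : ℤ, x ≡ a k [ZMOD m k] ∧ ∀ i ∈ S, x ≡ a i [ZMOD m i] → i = k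

theorem exists_irredundantCover {ι : Type*} [DecidableEq ι] (S : Finset ι) (a : ι → ℤ) (m : ι → ℕ)
    (h : ∀ n : ℤ, ∃ i ∈ S, n ≡ a i [ZMOD m i]) : ∃ R ⊆ S, IrredundantCover R a m := by
  induction S using Finset.strongInduction with
  | H S ih =>
    by_cases hred : ∃ k ∈ S, ∀ n : ℤ, ∃ i ∈ S.erase k, n ≡ a i [ZMOD m i]
    · obtain ⟨k, hk, hcov⟩ := hred
      obtain ⟨R, hR, hR'⟩ := ih _ (erase_ssubset hk) hcov
      exact ⟨R, hR.trans (erase_subset _ _), hR'⟩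
    · push Not at hred
      refine ⟨S, Subset.rfl, h, fun k hk => ?_⟩
      obtain ⟨x, hx⟩ := hred k hk
      have huniq : ∀ i ∈ S, x ≡ a i [ZMOD m i] → i = k := fun i hi hxi => by
        by_contra hik
        exact hx i (mem_erase.mpr ⟨hik, hi⟩) hxi
      obtain ⟨i, hi, hxi⟩ := h x
      exact ⟨x, huniq i hi hxi ▸ hxi, huniq⟩

/-- The sum of `p - 1` over the prime factors `p` of `n`, with multiplicity. -/
def primeWeight (n : ℕ) : ℕ := ∑ p ∈ n.primeFactors, n.factorization p * (p - 1)

namespace IrredundantCover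

variable {ι : Type*} [DecidableEq ι] {S : Finset ι} {a : ι → ℤ} {m : ι → ℕ}

theorem prime_le_card (h : IrredundantCover S a m) (hm : ∀ i ∈ S, m i ≠ 0) {p e : ℕ}
    (hp : p.Prime) (he : e ≠ 0) {k : ι} (hk : k ∈ S) (hpk : p ^ e ∣ m k) :
    p ≤ #{i ∈ S | p ^ e ∣ m i} := by
  obtain ⟨x, hxk, hx⟩ := h.irredundant k hk
  obtain ⟨b, rfl⟩ := Nat.exists_eq_succ_of_ne_zero he
  have hN : ∏ i ∈ S, m i ≠ 0 := prod_ne_zero_iff.mpr hm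
  have hdvd : ∀ i ∈ S, m i ∣ ∏ i ∈ S, m i := fun i hi => dvd_prod_of_mem m hi
  obtain ⟨R, hRS, hRT, hR⟩ := exists_subset_card_eq_of_uniquely_covered h.covers hxk hx (Ico 1 p)
    (offset (∏ i ∈ S, m i) p b)
    (fun j hj => (not_dvd_offset_iff hN (hdvd k hk) hp hj).mpr hpk)
    (fun j hj l hl i hi h1 h2 => (offset_separated hN (hdvd i hi) hp hj hp hl h1 h2).2.2)
  have h2 : insert k R ⊆ {i ∈ S | p ^ (b + 1) ∣ m i} := by
    refine insert_subset (mem_filter.mpr ⟨hk, hpk⟩) fun i hi => ?_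
    have hiS := mem_of_mem_erase (hRS hi)
    obtain ⟨j, hj, hij⟩ := hR i hi
    exact mem_filter.mpr ⟨hiS, (not_dvd_offset_iff hN (hdvd i hiS) hp hj).mp hij⟩
  have h3 := card_le_card h2
  rw [card_insert_of_notMem fun hkR => notMem_erase k S (hRS hkR), hRT, Nat.card_Ico] at h3
  have := hp.pos
  change p ≤ #{i ∈ S | p ^ (b + 1) ∣ m i}
  omega

theorem primeWeight_lt_card (h : IrredundantCover S a m) (hm : ∀ i ∈ S, m i ≠ 0) {k : ι}
    (hk : k ∈ S) : primeWeight (m k) < #S := by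
  obtain ⟨x, hxk, hx⟩ := h.irredundant k hk
  have hN : ∏ i ∈ S, m i ≠ 0 := prod_ne_zero_iff.mpr hm
  have hdvd : ∀ i ∈ S, m i ∣ ∏ i ∈ S, m i := fun i hi => dvd_prod_of_mem m hi
  let T : Finset (Σ _ : ℕ, ℕ × ℕ) :=
    (m k).primeFactors.sigma fun p => range ((m k).factorization p) ×ˢ Ico 1 p
  have hT : ∀ s ∈ T, s.1.Prime ∧ s.1 ^ (s.2.1 + 1) ∣ m k ∧ s.2.2 ∈ Ico 1 s.1 := by
    intro s hs
    simp only [T, mem_sigma, mem_product, mem_range] at hs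
    have hp := Nat.prime_of_mem_primeFactors hs.1
    exact ⟨hp, (hp.pow_dvd_iff_le_factorization (hm k hk)).mpr hs.2.1, hs.2.2⟩
  obtain ⟨R, hRS, hRT, hR⟩ := exists_subset_card_eq_of_uniquely_covered h.covers hxk hx T
    (fun s => offset (∏ i ∈ S, m i) s.1 s.2.1 s.2.2)
    (fun s hs => (not_dvd_offset_iff hN (hdvd k hk) (hT s hs).1 (hT s hs).2.2).mpr (hT s hs).2.1)
    (by
      rintro ⟨p, b, j⟩ hs ⟨q, c, l⟩ hs' i hi h1 h2
      obtain ⟨rfl, rfl, rfl⟩ := offset_separated hN (hdvd i hi) (hT _ hs).1 (hT _ hs).2.2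
        (hT _ hs').1 (hT _ hs').2.2 h1 h2
      rfl)
  have h2 : #T = primeWeight (m k) := by
    simp [T, primeWeight, card_sigma]
  rw [← h2, ← hRT]
  exact (card_le_card hRS).trans_lt (card_erase_lt_of_mem hk)

end IrredundantCover

theorem le_two_pow_primeWeight {n : ℕ} (hn : n ≠ 0) : n ≤ 2 ^ primeWeight n := by
  conv_lhs => rw [← Nat.prod_factorization_pow_eq_self hn]
  rw [primeWeight, ← prod_pow_eq_pow_sum]
  refine prod_le_prod' fun p _ => ?_
  rw [mul_comm, pow_mul]
  refine Nat.pow_le_pow_left ?_ _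
  have := Nat.lt_two_pow_self (n := p - 1)
  omega

theorem primeWeight_eq_list_sum (n : ℕ) :
    primeWeight n = (n.primeFactorsList.map (· - 1)).sum := by
  rw [Finset.sum_list_map_count]
  simp only [primeWeight, Nat.primeFactorsList_count_eq, Nat.primeFactors, smul_eq_mul]

theorem mem_of_primeWeight_le_five {n : ℕ} (hn : n ≠ 0) (h : primeWeight n ≤ 5) :
    n ∈ ({1, 2, 3, 4, 5, 6, 8, 9, 10, 12, 16, 18, 24, 32} : Finset ℕ) := by
  have h1 : n < 33 := by
    have := (le_two_pow_primeWeight hn).trans (Nat.pow_le_pow_right two_pos h)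
    omega
  rw [primeWeight_eq_list_sum] at h
  have key : ∀ n < 33, n ≠ 0 → (n.primeFactorsList.map (· - 1)).sum ≤ 5 →
      n ∈ ({1, 2, 3, 4, 5, 6, 8, 9, 10, 12, 16, 18, 24, 32} : Finset ℕ) := by
    decide +kernel
  exact key n h1 hn h

theorem dvd_two_pow_sub_one_iff {p e : ℕ} : p ∣ 2 ^ e - 1 ↔ orderOf (2 : ZMod p) ∣ e := by
  rw [orderOf_dvd_iff_pow_eq_one, ← ZMod.natCast_eq_zero_iff, Nat.cast_sub Nat.one_le_two_pow,
    sub_eq_zero]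
  simp

theorem orderOf_two_ne_zero {p : ℕ} (hp : p.Prime) (hodd : Odd p) :
    orderOf (2 : ZMod p) ≠ 0 := by
  have : NeZero p := ⟨hp.ne_zero⟩
  have hu : IsUnit (2 : ZMod p) := by
    exact_mod_cast (ZMod.isUnit_iff_coprime 2 p).mpr (Nat.coprime_two_left.mpr hodd)
  exact (isOfFinOrder_iff_isUnit.mpr hu).orderOf_pos.ne'

theorem mem_of_primeWeight_orderOf_le_five {p : ℕ} (hp : p.Prime) (hodd : Odd p)
    (h : primeWeight (orderOf (2 : ZMod p)) ≤ 5) :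
    (orderOf (2 : ZMod p), p) ∈ ({(2, 3), (3, 7), (4, 5), (5, 31), (8, 17), (9, 73), (10, 11),
      (12, 13), (16, 257), (18, 19), (24, 241), (32, 65537)} : Finset (ℕ × ℕ)) := by
  have h0 := orderOf_two_ne_zero hp hodd
  have key : ∀ d ∈ ({1, 2, 3, 4, 5, 6, 8, 9, 10, 12, 16, 18, 24, 32} : Finset ℕ),
      ∀ p ∈ (2 ^ d - 1).primeFactorsList, (∀ e ∈ Ico 1 d, ¬ p ∣ 2 ^ e - 1) →
      (d, p) ∈ ({(2, 3), (3, 7), (4, 5), (5, 31), (8, 17), (9, 73), (10, 11),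
      (12, 13), (16, 257), (18, 19), (24, 241), (32, 65537)} : Finset (ℕ × ℕ)) := by
    decide +kernel
  refine key _ (mem_of_primeWeight_le_five h0 h) p ?_ fun e he hpe => ?_
  · have : 1 < 2 ^ orderOf (2 : ZMod p) := Nat.one_lt_two_pow h0
    exact (Nat.mem_primeFactorsList (by omega)).mpr ⟨hp, dvd_two_pow_sub_one_iff.mpr dvd_rfl⟩
  · rw [mem_Ico] at he
    exact absurd (Nat.le_of_dvd (by omega) (dvd_two_pow_sub_one_iff.mp hpe)) (by omega)

namespace IrredundantCover

variable {ι : Type*} [DecidableEq ι] {S : Finset ι} {a : ι → ℤ} {p : ι → ℕ}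

theorem subset_image_of_pow_dvd_orderOf
    (h : IrredundantCover S a fun i => orderOf (2 : ZMod (p i)))
    (hp : ∀ i, (p i).Prime) (hodd : ∀ i, Odd (p i)) (hinj : Function.Injective p)
    {q e : ℕ} (hq : q.Prime) (he : e ≠ 0) (P : Finset ℕ) (hPq : #P ≤ q)
    (hP : ∀ i ∈ S, q ^ e ∣ orderOf (2 : ZMod (p i)) → p i ∈ P) {k : ι} (hk : k ∈ S)
    (hqk : q ^ e ∣ orderOf (2 : ZMod (p k))) :
    #P = q ∧ P ⊆ S.image p := by
  have h1 : q ≤ #(S.image p ∩ P) := by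
    refine (h.prime_le_card (fun i _ => orderOf_two_ne_zero (hp i) (hodd i)) hq he hk hqk).trans ?_
    refine card_le_card_of_injOn p (fun i hi => ?_) hinj.injOn
    have hi := mem_filter.mp hi
    exact mem_inter.mpr ⟨mem_image_of_mem p hi.1, hP i hi.1 hi.2⟩
  have h2 := card_le_card (inter_subset_right : S.image p ∩ P ⊆ P)
  exact ⟨by omega, inter_eq_right.mp (eq_of_subset_of_card_le inter_subset_right (by omega))⟩

theorem orderOf_two_mem_of_primeWeight_le_five
    (h : IrredundantCover S a fun i => orderOf (2 : ZMod (p i)))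
    (hp : ∀ i, (p i).Prime) (hodd : ∀ i, Odd (p i)) (hinj : Function.Injective p)
    (hw : ∀ i ∈ S, primeWeight (orderOf (2 : ZMod (p i))) ≤ 5) :
    (∀ i ∈ S, (orderOf (2 : ZMod (p i)), p i) ∈
      ({(2, 3), (3, 7), (4, 5), (8, 17), (12, 13), (24, 241)} : Finset (ℕ × ℕ))) ∧
    241 ∈ S.image p := by
  have tab i (hi : i ∈ S) := mem_of_primeWeight_orderOf_le_five (hp i) (hodd i) (hw i hi)
  simp only [mem_insert, mem_singleton, Prod.mk.injEq] at tab ⊢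
  have step {q e : ℕ} (hq : q.Prime) (he : e ≠ 0) (P : Finset ℕ) (hPq : #P < q)
      (hP : ∀ i ∈ S, q ^ e ∣ orderOf (2 : ZMod (p i)) → p i ∈ P) (i : ι) (hi : i ∈ S) :
      ¬ q ^ e ∣ orderOf (2 : ZMod (p i)) := fun hd =>
    hPq.ne (h.subset_image_of_pow_dvd_orderOf hp hodd hinj hq he P hPq.le hP hi hd).1
  have h5 := step (q := 5) (e := 1) (by norm_num) one_ne_zero {31, 11} (by decide) (by
    intro i hi hd
    have tab := tab i hi
    simp only [mem_insert, mem_singleton]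
    omega)
  have h9 := step (q := 3) (e := 2) (by norm_num) two_ne_zero {73, 19} (by decide) (by
    intro i hi hd
    have tab := tab i hi
    simp only [mem_insert, mem_singleton]
    omega)
  have h32 := step (q := 2) (e := 5) (by norm_num) (by norm_num) {65537} (by decide) (by
    intro i hi hd
    have tab := tab i hi
    simp only [mem_singleton]
    omega)
  have h16 := step (q := 2) (e := 4) (by norm_num) (by norm_num) {257} (by decide) (by
    intro i hi hd
    have h32 := h32 i hi
    have tab := tab i hi
    simp only [mem_singleton]
    omega)
  have tab' : ∀ i ∈ S, orderOf (2 : ZMod (p i)) = 2 ∧ p i = 3 ∨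
      orderOf (2 : ZMod (p i)) = 3 ∧ p i = 7 ∨ orderOf (2 : ZMod (p i)) = 4 ∧ p i = 5 ∨
      orderOf (2 : ZMod (p i)) = 8 ∧ p i = 17 ∨ orderOf (2 : ZMod (p i)) = 12 ∧ p i = 13 ∨
      orderOf (2 : ZMod (p i)) = 24 ∧ p i = 241 := by
    intro i hi
    have h5 := h5 i hi
    have h9 := h9 i hi
    have h32 := h32 i hi
    have h16 := h16 i hi
    rcases tab i hi with h | h | h | h | h | h | h | h | h | h | h | h <;> omega
  refine ⟨tab', ?_⟩
  by_contra h241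
  have hne i (hi : i ∈ S) : p i ≠ 241 := fun h => h241 (mem_image.mpr ⟨i, hi, h⟩)
  have h8 := step (q := 2) (e := 3) (by norm_num) (by norm_num) {17} (by decide) (by
    intro i hi hd
    have hne := hne i hi
    have tab := tab' i hi
    simp only [mem_singleton]
    omega)
  have h3 := step (q := 3) (e := 1) (by norm_num) (by norm_num) {7, 13} (by decide) (by
    intro i hi hd
    have hne := hne i hi
    have tab := tab' i hi
    simp only [mem_insert, mem_singleton]
    omega)
  have h4 := step (q := 2) (e := 2) (by norm_num) (by norm_num) {5} (by decide) (by
    intro i hi hd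
    have h8 := h8 i hi
    have h3 := h3 i hi
    have tab := tab' i hi
    simp only [mem_singleton]
    omega)
  have h2 := step (q := 2) (e := 1) (by norm_num) (by norm_num) {3} (by decide) (by
    intro i hi hd
    have h4 := h4 i hi
    have h3 := h3 i hi
    have tab := tab' i hi
    simp only [mem_singleton]
    omega)
  obtain ⟨i, hi, -⟩ := h.covers 0
  have h2 := h2 i hi
  have h3 := h3 i hi
  have tab := tab' i hi
  omega

theorem image_eq_of_card_le_six
    (h : IrredundantCover S a fun i => orderOf (2 : ZMod (p i)))
    (hp : ∀ i, (p i).Prime) (hodd : ∀ i, Odd (p i)) (hinj : Function.Injective p)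
    (hS : #S ≤ 6) : S.image p = {3, 5, 7, 13, 17, 241} := by
  have hlt i (hi : i ∈ S) :=
    h.primeWeight_lt_card (fun i _ => orderOf_two_ne_zero (hp i) (hodd i)) hi
  obtain ⟨tab, h241⟩ := h.orderOf_two_mem_of_primeWeight_le_five hp hodd hinj fun i hi =>
    Nat.le_of_lt_succ ((hlt i hi).trans_le hS)
  obtain ⟨k, hk, hpk⟩ := mem_image.mp h241
  have hord : orderOf (2 : ZMod (p k)) = 24 := by
    simpa [hpk] using tab k hk
  have hw : primeWeight 24 = 5 := by
    rw [primeWeight_eq_list_sum]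
    decide +kernel
  have h6 : 5 < #S := by simpa [hord, hw] using hlt k hk
  refine eq_of_subset_of_card_le (image_subset_iff.mpr fun i hi => ?_) ?_
  · have := tab i hi
    simp only [mem_insert, mem_singleton, Prod.mk.injEq] at this ⊢
    tauto
  · rw [card_image_of_injective S hinj]
    exact h6

theorem exists_prime_ge_of_seven_le_card
    (h : IrredundantCover S a fun i => orderOf (2 : ZMod (p i)))
    (hp : ∀ i, (p i).Prime) (hodd : ∀ i, Odd (p i)) (hinj : Function.Injective p)
    (hS : 7 ≤ #S) : ∃ k ∈ S, 23 ≤ p k := by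
  by_contra! hlt
  have hsub : S.image p ⊆ {3, 5, 7, 11, 13, 17, 19} := by
    refine image_subset_iff.mpr fun i hi => ?_
    have key : ∀ n < 23, n.Prime → Odd n → n ∈ ({3, 5, 7, 11, 13, 17, 19} : Finset ℕ) := by
      decide
    exact key _ (hlt i hi) (hp i) (hodd i)
  have heq : S.image p = {3, 5, 7, 11, 13, 17, 19} :=
    eq_of_subset_of_card_le hsub (by rwa [card_image_of_injective S hinj])
  obtain ⟨k, hk, hpk⟩ : ∃ k ∈ S, p k = 19 := by
    rw [← mem_image, heq]
    decide
  have hnd : ∀ q ∈ ({3, 5, 7, 11, 13, 17, 19} : Finset ℕ), 9 ∣ orderOf (2 : ZMod q) →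
      q = 19 := by
    intro q hq hd
    have key : ∀ q ∈ ({3, 5, 7, 11, 13, 17, 19} : Finset ℕ), q ≠ 19 →
        ∃ e ∈ ({2, 4, 3, 10, 12, 8} : Finset ℕ), q ∣ 2 ^ e - 1 := by decide
    by_contra hne
    obtain ⟨e, he, hqe⟩ := key q hq hne
    have h9 : ∀ e ∈ ({2, 4, 3, 10, 12, 8} : Finset ℕ), ¬ 9 ∣ e := by decide
    exact h9 e he (hd.trans (dvd_two_pow_sub_one_iff.mp hqe))
  have h19 : 9 ∣ orderOf (2 : ZMod 19) := by
    have h18 : orderOf (2 : ZMod 19) ∣ 18 := dvd_two_pow_sub_one_iff.mp (by norm_num)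
    have h6 : ¬ orderOf (2 : ZMod 19) ∣ 6 := fun h =>
      absurd (dvd_two_pow_sub_one_iff.mpr h) (by norm_num)
    have key : ∀ d ≤ 18, d ∣ 18 → ¬ d ∣ 6 → 9 ∣ d := by decide
    exact key _ (Nat.le_of_dvd (by norm_num) h18) h18 h6
  have := h.subset_image_of_pow_dvd_orderOf hp hodd hinj Nat.prime_three two_ne_zero {19}
    (by decide) (fun i hi hd => mem_singleton.mpr
      (hnd _ (hsub (mem_image_of_mem p hi)) hd)) hk (by rw [hpk]; exact h19)
  exact absurd this.1 (by decide)

end IrredundantCover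

theorem le_prod_of_six_le_card {P : Finset ℕ} (hp : ∀ q ∈ P, q.Prime) (hodd : ∀ q ∈ P, Odd q)
    (hP : 6 ≤ #P) : 255255 ≤ ∏ q ∈ P, q := by
  let A : Finset ℕ := {3, 5, 7, 11, 13, 17}
  have hA : ∀ n < 19, n.Prime → Odd n → n ∈ A := by decide
  have hA17 : ∀ n ∈ A, n ≤ 19 := by decide
  have hcard : #(A \ P) ≤ #(P \ A) := card_sdiff_le_card_sdiff_iff.mpr hP
  calc 255255 = ∏ q ∈ A, q := by decide
    _ = (∏ q ∈ A ∩ P, q) * ∏ q ∈ A \ P, q := (prod_inter_mul_prod_sdiff A P _).symm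
    _ ≤ (∏ q ∈ P ∩ A, q) * ∏ q ∈ P \ A, q := by
      rw [inter_comm]
      refine Nat.mul_le_mul_left _ ?_
      calc ∏ q ∈ A \ P, q ≤ 19 ^ #(A \ P) :=
            prod_le_pow_card _ _ _ fun q hq => hA17 q (mem_sdiff.mp hq).1
        _ ≤ 19 ^ #(P \ A) := Nat.pow_le_pow_right (by norm_num) hcard
        _ ≤ ∏ q ∈ P \ A, q := by
          refine pow_card_le_prod _ _ _ fun q hq => ?_
          rw [mem_sdiff] at hq
          by_contra! hlt
          exact hq.2 (hA q hlt (hp q hq.1) (hodd q hq.1))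
    _ = ∏ q ∈ P, q := prod_inter_mul_prod_sdiff P A _

theorem IrredundantCover.le_prod_of_seven_le_card {ι : Type*} [DecidableEq ι] {S : Finset ι}
    {a : ι → ℤ} {p : ι → ℕ} (h : IrredundantCover S a fun i => orderOf (2 : ZMod (p i)))
    (hp : ∀ i, (p i).Prime) (hodd : ∀ i, Odd (p i)) (hinj : Function.Injective p)
    (hS : 7 ≤ #S) : 5592405 ≤ ∏ i ∈ S, p i := by
  obtain ⟨k, hk, hpk⟩ := h.exists_prime_ge_of_seven_le_card hp hodd hinj hS
  have h1 : 255255 ≤ ∏ q ∈ (S.erase k).image p, q := by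
    refine le_prod_of_six_le_card (forall_mem_image.mpr fun i _ => hp i)
      (forall_mem_image.mpr fun i _ => hodd i) ?_
    rw [card_image_of_injective _ hinj, card_erase_of_mem hk]
    omega
  rw [prod_image hinj.injOn] at h1
  rw [← mul_prod_erase S p hk]
  exact le_trans (by norm_num) (Nat.mul_le_mul hpk h1)

theorem stmt16 (t : ℕ) (p : Fin t → ℕ)
    (hp : ∀ i, (p i).Prime) (hodd : ∀ i, Odd (p i))
    (hinj : Function.Injective p)
    (hcov : ∃ a : Fin t → ℤ, ∀ n : ℤ,
      ∃ i, n ≡ a i [ZMOD (orderOf (2 : ZMod (p i)) : ℤ)]) :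
    6 ≤ t ∧ 5592405 ≤ ∏ i, p i ∧ (t = 6 ↔ ∏ i, p i = 5592405) := by
  obtain ⟨a, ha⟩ := hcov
  obtain ⟨S, -, hS⟩ := exists_irredundantCover univ a (fun i => orderOf (2 : ZMod (p i)))
    fun n => (ha n).imp fun i hi => ⟨mem_univ i, hi⟩
  have hsix : #S ≤ 6 → #S = 6 ∧ ∏ i ∈ S, p i = 5592405 := fun h => by
    have himg := hS.image_eq_of_card_le_six hp hodd hinj h
    refine ⟨?_, ?_⟩
    · rw [← card_image_of_injective S hinj, himg]
      decide
    · rw [← prod_image (f := fun q => q) hinj.injOn, himg]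
      decide
  have hSt : #S ≤ t := card_finset_fin_le S
  have hle : ∏ i ∈ S, p i ≤ ∏ i, p i :=
    prod_le_prod_of_subset_of_one_le' (subset_univ S) fun i _ _ => (hp i).one_le
  have h6 : 6 ≤ t := by
    by_contra! h
    have := hsix (by omega)
    omega
  refine ⟨h6, ?_, fun ht => ?_, fun hprod => ?_⟩
  · rcases le_or_gt #S 6 with h | h
    · exact (hsix h).2 ▸ hle
    · exact (hS.le_prod_of_seven_le_card hp hodd hinj h).trans hle
  · have h := hsix (by omega)
    have huniv : S = univ := (card_eq_iff_eq_univ S).mp (by rw [h.1, Fintype.card_fin, ht])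
    rw [← huniv, h.2]
  · have hsub : univ.image p ⊆ (5592405 : ℕ).primeFactorsList.toFinset :=
      image_subset_iff.mpr fun i _ => List.mem_toFinset.mpr <|
        (Nat.mem_primeFactorsList (by norm_num)).mpr
          ⟨hp i, hprod ▸ dvd_prod_of_mem p (mem_univ i)⟩
    have hcard : #(5592405 : ℕ).primeFactorsList.toFinset = 6 := by decide +kernel
    have := card_le_card hsub
    rw [card_image_of_injective _ hinj, hcard, card_univ, Fintype.card_fin] at this
    omega
end

section
/- The number 509203 belongs to 𝒰, and for every positive integer k one has gcd(509203 − 2^k, 2^24 − 1) > 1, where 509203 − 2^k is regarded as an integer (possibly negative) and the gcd is taken of its absolute value with 2^24 − 1. -/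
open Filter

/-- Powers of two modulo `2 ^ 24 - 1` depend only on the exponent modulo `24`. -/
theorem two_pow_modEq_two_pow_mod (k : ℕ) :
    (2 : ℤ) ^ k ≡ 2 ^ (k % 24) [ZMOD 2 ^ 24 - 1] := by
  have h : ((2 : ℤ) ^ 24) ^ (k / 24) ≡ 1 ^ (k / 24) [ZMOD 2 ^ 24 - 1] :=
    Int.ModEq.pow _ (by decide)
  have h' := h.mul_right (2 ^ (k % 24))
  rwa [one_pow, one_mul, ← pow_mul, ← pow_add, Nat.div_add_mod] at h'

theorem one_lt_gcd_sub_two_pow (k : ℕ) :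
    1 < Int.gcd ((509203 : ℤ) - 2 ^ k) (2 ^ 24 - 1) := by
  have h : (509203 - 2 ^ k : ℤ) ≡ 509203 - 2 ^ (k % 24) [ZMOD 2 ^ 24 - 1] :=
    (Int.ModEq.refl _).sub (two_pow_modEq_two_pow_mod k)
  rw [← Int.gcd_emod, h, Int.gcd_emod]
  have hk : k % 24 < 24 := Nat.mod_lt _ (by norm_num)
  generalize k % 24 = r at hk
  interval_cases r <;> norm_num

theorem mem_U_509203 : 509203 ∈ U := by
  refine ⟨by norm_num, by decide, ?_⟩
  rintro ⟨p, k, hp, hk, h⟩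
  have hk' : k < 19 := by
    by_contra! hle
    have := Nat.pow_le_pow_right (n := 2) (by norm_num) hle
    omega
  obtain rfl : p = 509203 - 2 ^ k := by omega
  clear h
  interval_cases k <;> norm_num at hp

theorem stmt18 :
    509203 ∈ U ∧
    ∀ k : ℕ, 0 < k → 1 < Int.gcd ((509203 : ℤ) - 2 ^ k) (2 ^ 24 - 1) :=
  ⟨mem_U_509203, fun k _ => one_lt_gcd_sub_two_pow k⟩
end
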